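/- Let S be a non-empty countable set. The set ext 𝒫(S) of extreme points of the set of partially exchangeable probability measures on S^ℕ equals the union of the following three sets: (1) the laws of trajectories of recurrent Markov chains on subsets of S with non-random initial state; (2) the laws of vertex sequences of proper Gibbs measures on Eulerian paths on sourced Eulerian digraphs whose vertex sets are subsets of S; (3) the laws of processes formed by first following a uniform random Eulerian path on a finite Eulerian digraph with source and sink whose vertex set is a subset of S, followed by the trajectory of a recurrent Markov chain defined on a disjoint subset of S with non-random initial state. -/

import Mathlib

open MeasureTheory Filter Set
open scoped ENNReal

namespace DF

/-! ### Sequences over a countable state space -/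

variable {S : Type}

/-- The number of transitions from `u` to `v` among the first `n` steps of the sequence `x`. -/
noncomputable def transCount (x : ℕ → S) (n : ℕ) (u v : S) : ℕ :=
  Set.ncard {i : ℕ | i < n ∧ x i = u ∧ x (i + 1) = v}

/-- The equivalence `(x₀,…,xₙ) ≃ (y₀,…,yₙ)` of finite sequences: same initial state and the same
transition counts between every ordered pair of states. -/
def FinEquiv (x y : ℕ → S) (n : ℕ) : Prop :=
  x 0 = y 0 ∧ ∀ u v : S, transCount x n u v = transCount y n u v

/-- The equivalence `x ≃ y` of infinite sequences: they eventually agree and their initial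
segments up to that point are `≃`-equivalent. -/
def InfEquiv (x y : ℕ → S) : Prop :=
  ∃ N : ℕ, (∀ n : ℕ, N ≤ n → x n = y n) ∧ FinEquiv x y N

/-- The transition numbers `M(u,v) = #{i ≥ 0 : (xᵢ, xᵢ₊₁) = (u,v)}` of an infinite sequence. -/
noncomputable def transNum (x : ℕ → S) (u v : S) : ℕ∞ :=
  Set.encard {i : ℕ | x i = u ∧ x (i + 1) = v}

/-- The sigma-algebra on `S^ℕ` generated by the transition numbers. -/
noncomputable def transSigma (S : Type) : MeasurableSpace (ℕ → S) :=
  ⨆ u : S, ⨆ v : S, MeasurableSpace.comap (fun x => transNum x u v) (⊤ : MeasurableSpace ℕ∞)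

/-- The tail sigma-algebra `⋂ₙ σ(Xₙ, Xₙ₊₁, …)` on `S^ℕ`. -/
def tailSigma (S : Type) [MeasurableSpace S] : MeasurableSpace (ℕ → S) :=
  ⨅ n : ℕ, MeasurableSpace.comap (fun (x : ℕ → S) (i : ℕ) => x (i + n))
    (inferInstance : MeasurableSpace (ℕ → S))

/-- A measure on `S^ℕ` is partially exchangeable if any two `≃`-equivalent finite initial
segments have the same probability. -/
def PartiallyExchangeable [MeasurableSpace S] (μ : Measure (ℕ → S)) : Prop :=
  ∀ (n : ℕ) (x y : ℕ → S), FinEquiv x y n →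
    μ {ω | ∀ i ≤ n, ω i = x i} = μ {ω | ∀ i ≤ n, ω i = y i}

/-- The set of partially exchangeable probability measures on `S^ℕ`. -/
def PEProb (S : Type) [MeasurableSpace S] : Set (Measure (ℕ → S)) :=
  {μ | μ Set.univ = 1 ∧ PartiallyExchangeable μ}

/-- `μ` is an extreme point of the convex set of partially exchangeable probability measures. -/
def IsExtremePE [MeasurableSpace S] (μ : Measure (ℕ → S)) : Prop :=
  μ ∈ PEProb S ∧
    ∀ μ₁ ∈ PEProb S, ∀ μ₂ ∈ PEProb S, ∀ t : ℝ≥0∞, 0 < t → t < 1 →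
      μ = t • μ₁ + (1 - t) • μ₂ → μ₁ = μ₂

/-! ### Digraphs -/

/-- A digraph on vertex set `V` with edge set `E`: each edge has a tail (`src`) and head (`dst`).
Multiple edges and loops are allowed. -/
structure DigraphStruct (V E : Type) where
  src : E → V
  dst : E → V

namespace DigraphStruct

variable {V E : Type} (G : DigraphStruct V E)

def outEdges (v : V) : Set E := {e | G.src e = v}

def inEdges (v : V) : Set E := {e | G.dst e = v}

noncomputable def outDeg (v : V) : ℕ := (G.outEdges v).ncard

noncomputable def inDeg (v : V) : ℕ := (G.inEdges v).ncard

def LocallyFinite : Prop := ∀ v : V, (G.outEdges v).Finite ∧ (G.inEdges v).Finite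

/-- Adjacency in the underlying undirected graph. -/
def undirAdj (u v : V) : Prop :=
  ∃ e : E, (G.src e = u ∧ G.dst e = v) ∨ (G.src e = v ∧ G.dst e = u)

/-- `G` is connected as an undirected graph. -/
def Connected : Prop := ∀ u v : V, Relation.ReflTransGen G.undirAdj u v

def dirAdj (u v : V) : Prop := ∃ e : E, G.src e = u ∧ G.dst e = v

/-- One step along an edge of the edge set `B`. -/
def step (B : Set E) (u v : V) : Prop := ∃ e ∈ B, G.src e = u ∧ G.dst e = v

/-- `(G,o)` is an infinite sourced Eulerian digraph (with sink at infinity). -/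
structure IsSourcedEulerian (o : V) : Prop where
  infinite : Infinite V
  locFin : G.LocallyFinite
  conn : G.Connected
  balanced : ∀ v : V, v ≠ o → G.inDeg v = G.outDeg v
  source : G.outDeg o = G.inDeg o + 1

/-- The reversal of `G`: head and tail of every edge are exchanged. -/
def rev : DigraphStruct V E := ⟨G.dst, G.src⟩

/-- One-step transition probability of the random walk on `G`. -/
noncomputable def stepProb (u v : V) : ℝ≥0∞ :=
  ({e : E | G.src e = u ∧ G.dst e = v}.ncard : ℝ≥0∞) / (G.outDeg u : ℝ≥0∞)

open Classical in
/-- `μ` is the law of the random walk on `G` started at `o`, characterised through its cylinder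
probabilities. -/
def IsWalkLaw [MeasurableSpace V] (o : V) (μ : Measure (ℕ → V)) : Prop :=
  μ Set.univ = 1 ∧
    ∀ (n : ℕ) (x : ℕ → V),
      μ {ω | ∀ i ≤ n, ω i = x i} =
        if x 0 = o then ∏ i ∈ Finset.range n, G.stepProb (x i) (x (i + 1)) else 0

/-- `G` is transient: from every starting point, the random walk on `G` visits every vertex at
most finitely often almost surely. -/
def TransientDigraph [MeasurableSpace V] : Prop :=
  ∀ (o : V) (μ : Measure (ℕ → V)),
    G.IsWalkLaw o μ → μ {ω | ∀ v : V, {i : ℕ | ω i = v}.Finite} = 1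

/-- An infinite path in `G` indexed by `ℕ`, encoded by its sequence of edges. -/
def IsInfPath (γ : ℕ → E) : Prop := ∀ i : ℕ, G.dst (γ i) = G.src (γ (i + 1))

/-- A transient path: it visits every vertex at most finitely often. -/
def IsTransientPath (γ : ℕ → E) : Prop := ∀ v : V, {i : ℕ | G.src (γ i) = v}.Finite

/-- The edge set of the last-exit arboretum `𝓛(γ)`: the edges crossed by `γ` as it exits their
tail for the last time. -/
def lastExitSet (γ : ℕ → E) : Set E :=
  {e | ∃ i : ℕ, γ i = e ∧ ∀ j : ℕ, i < j → G.src (γ j) ≠ G.src (γ i)}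

end DigraphStruct

/-! ### Finite paths, Eulerian paths, arborescences -/

/-- `IsPathList G o z P` means that the list of edges `P` forms a directed path from `o`
to `z` in `G`. -/
def IsPathList {V E : Type} (G : DigraphStruct V E) : V → V → List E → Prop
  | o, z, [] => o = z
  | o, z, e :: es => G.src e = o ∧ IsPathList G (G.dst e) z es

/-- `P` is an Eulerian path from `o` to `z`: a path crossing every edge exactly once. -/
def IsEulerList {V E : Type} (G : DigraphStruct V E) (o z : V) (P : List E) : Prop :=
  IsPathList G o z P ∧ P.Nodup ∧ ∀ e : E, e ∈ P

/-- `B` is (the edge set of) a spanning in-arborescence of `G` rooted at `z`. -/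
def IsFinArb {V E : Type} (G : DigraphStruct V E) (z : V) (B : Set E) : Prop :=
  (∀ e ∈ B, G.src e ≠ z) ∧
  (∀ v : V, v ≠ z → ∃! e : E, e ∈ B ∧ G.src e = v) ∧
  (∀ v : V, Relation.ReflTransGen (G.step B) v z)

/-- `(G,o,z)` is a finite Eulerian digraph with source `o` and sink `z`. -/
structure IsFinEulerian {V E : Type} (G : DigraphStruct V E) (o z : V) : Prop where
  finV : Finite V
  finE : Finite E
  reach_from : ∀ v : V, Relation.ReflTransGen G.dirAdj o v
  reach_to : ∀ v : V, Relation.ReflTransGen G.dirAdj v z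
  bal_ne : o ≠ z → (∀ v : V, v ≠ o → v ≠ z → G.inDeg v = G.outDeg v) ∧
      G.outDeg o = G.inDeg o + 1 ∧ G.inDeg z = G.outDeg z + 1
  bal_eq : o = z → ∀ v : V, G.inDeg v = G.outDeg v

/-! ### Wired uniform spanning in-arborescences -/

/-- An exhaustion of the vertex set by finite subsets. -/
def IsExhaustion {V : Type} (Vn : ℕ → Set V) : Prop :=
  (∀ n, (Vn n).Finite) ∧ (∀ n, Vn n ⊆ Vn (n + 1)) ∧ (⋃ n, Vn n) = Set.univ

/-- `B` is (the edge set of) a spanning in-arborescence of the wired graph `G_U^*`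
(all vertices outside `U` identified to a single boundary vertex) rooted at the boundary. -/
def IsWiredArb {V E : Type} (G : DigraphStruct V E) (U : Set V) (B : Set E) : Prop :=
  (∀ e ∈ B, G.src e ∈ U) ∧ (∀ v ∈ U, ∃! e : E, e ∈ B ∧ G.src e = v) ∧
  (∀ v ∈ U, ∃ v' : V, v' ∉ U ∧ Relation.ReflTransGen (G.step B) v v')

/-- The probability, under the uniform spanning in-arborescence of the wired graph `G_U^*`
rooted at the boundary, that all edges of `F` are present. -/
noncomputable def wiredUACyl {V E : Type} (G : DigraphStruct V E) (U : Set V) (F : Finset E) :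
    ℝ≥0∞ :=
  (Nat.card {B : Set E // IsWiredArb G U B ∧ (F : Set E) ⊆ B} : ℝ≥0∞) /
    (Nat.card {B : Set E // IsWiredArb G U B} : ℝ≥0∞)

/-- `κ` is the law of the wired uniform spanning in-arboretum of `G` (as a random edge set,
encoded as an element of `E → Bool`): its cylinder probabilities are the limits along any
exhaustion of the uniform spanning in-arborescence measures of the wired graphs. -/
def IsWUALaw {V E : Type} (G : DigraphStruct V E) (κ : Measure (E → Bool)) : Prop :=
  κ Set.univ = 1 ∧
    ∀ Vn : ℕ → Set V, IsExhaustion Vn → ∀ F : Finset E,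
      Filter.Tendsto (fun n => wiredUACyl G (Vn n) F) Filter.atTop
        (nhds (κ {A | ∀ e ∈ F, A e = true}))

/-- A spanning in-arboretum rooted at infinity all of whose components are one-ended:
every vertex has out-degree exactly one, and the past of every vertex is finite. -/
def IsOneEndedSpanningArb {V E : Type} (G : DigraphStruct V E) (A : Set E) : Prop :=
  (∀ v : V, ∃! e : E, e ∈ A ∧ G.src e = v) ∧
    ∀ v : V, {u : V | Relation.ReflTransGen (G.step A) u v}.Finite

/-! ### Proper Gibbs measures on Eulerian paths -/

/-- `w` is a finite path in `G` starting at `o` (encoded by its edges). -/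
def PrefixPath {V E : Type} (G : DigraphStruct V E) (o : V) {n : ℕ} (w : Fin n → E) : Prop :=
  (∀ h : 0 < n, G.src (w ⟨0, h⟩) = o) ∧
    ∀ (i : ℕ) (h : i + 1 < n), G.dst (w ⟨i, Nat.lt_of_succ_lt h⟩) = G.src (w ⟨i + 1, h⟩)

/-- A proper Gibbs measure on Eulerian paths from `o` to `∞` in `G`: a probability measure on
edge sequences, supported on half-infinite paths started at `o` crossing every edge exactly once,
such that conditionally on the steps after time `n` the first `n` steps are a uniform Eulerian
path (from `o`, in the digraph spanned by the edges not crossed after time `n`, to the position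
at time `n`). Uniformity is expressed by invariance under replacing the first `n` steps by any
other path from `o` crossing the same set of edges. -/
def ProperGibbs {V E : Type} [MeasurableSpace E] (G : DigraphStruct V E) (o : V)
    (μ : Measure (ℕ → E)) : Prop :=
  μ Set.univ = 1 ∧
  μ {γ | (∀ i : ℕ, G.dst (γ i) = G.src (γ (i + 1))) ∧ G.src (γ 0) = o ∧ Function.Bijective γ}
      = 1 ∧
  ∀ (n : ℕ) (w w' : Fin n → E), Function.Injective w → Function.Injective w' →
    Set.range w = Set.range w' → PrefixPath G o w → PrefixPath G o w' →
    ∀ B : Set (ℕ → E),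
      μ {γ | (∀ i : Fin n, γ (i : ℕ) = w i) ∧ (fun t : ℕ => γ (n + t)) ∈ B} =
        μ {γ | (∀ i : Fin n, γ (i : ℕ) = w' i) ∧ (fun t : ℕ => γ (n + t)) ∈ B}

/-! ### Loop erasure and Wilson's algorithm rooted at infinity -/

/-- The loop-erasure times of the (transient) vertex sequence `p`:
`t₀ = 0`, `tᵢ₊₁ = 1 + max {t ≥ tᵢ : p t = p tᵢ}`. -/
noncomputable def leTimes {V : Type} (p : ℕ → V) : ℕ → ℕ
  | 0 => 0
  | i + 1 => sSup {t : ℕ | leTimes p i ≤ t ∧ p t = p (leTimes p i)} + 1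

/-- The loop-erasure times of the vertex sequence `p` run up to time `k`. -/
noncomputable def leTimesF {V : Type} (p : ℕ → V) (k : ℕ) : ℕ → ℕ
  | 0 => 0
  | i + 1 => sSup {t : ℕ | leTimesF p k i ≤ t ∧ t ≤ k ∧ p t = p (leTimesF p k i)} + 1

/-- The set of vertices incident to an edge of `A`. -/
def vertsOf {V E : Type} (G : DigraphStruct V E) (A : Set E) : Set V :=
  {u | ∃ e ∈ A, G.src e = u ∨ G.dst e = u}

open Classical in
/-- The set of edges of the loop-erasure of the walk `x` (an edge sequence) stopped when it
first hits `U`; if it never hits `U`, the loop-erasure of the whole (transient) walk. -/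
noncomputable def stoppedLEedges {V E : Type} (G : DigraphStruct V E) (U : Set V) (x : ℕ → E) :
    Set E :=
  if ∃ t : ℕ, G.src (x t) ∈ U then
    {e | ∃ i : ℕ,
      leTimesF (fun t => G.src (x t)) (sInf {t : ℕ | G.src (x t) ∈ U}) i <
          sInf {t : ℕ | G.src (x t) ∈ U} ∧
        x (leTimesF (fun t => G.src (x t)) (sInf {t : ℕ | G.src (x t) ∈ U}) i) = e}
  else Set.range fun i => x (leTimes (fun t => G.src (x t)) i)

/-- The partial edge sets generated by Wilson's algorithm rooted at infinity, run with the
enumeration `v` of the vertices and with `W j` the random walk used at stage `j + 1`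
(started at `v j`). -/
noncomputable def wilsonA {V E : Type} (G : DigraphStruct V E) (v : ℕ → V) (W : ℕ → ℕ → E) :
    ℕ → Set E
  | 0 => ∅
  | j + 1 =>
      wilsonA G v W j ∪
        stoppedLEedges G (vertsOf G (wilsonA G v W j) ∪ {u | ∃ i < j, v i = u}) (W j)

open Classical in
/-- Cylinder probabilities for the random walk on `G` started at `v`, recorded as a sequence of
edges: the probability that the first `n` crossed edges are `x 0, …, x (n-1)`. -/
noncomputable def edgeWalkCyl {V E : Type} (G : DigraphStruct V E) (v : V) (x : ℕ → E) (n : ℕ) :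
    ℝ≥0∞ :=
  if (0 < n → G.src (x 0) = v) ∧ (∀ i : ℕ, i + 1 < n → G.dst (x i) = G.src (x (i + 1))) then
    ∏ i ∈ Finset.range n, ((G.outDeg (G.src (x i)) : ℝ≥0∞))⁻¹
  else 0

/-- `P` is the joint law of a sequence of independent random walks on `G`, the `j`-th walk
started at `v j`. -/
def IsIndepWalksLaw {V E : Type} [MeasurableSpace E] (G : DigraphStruct V E) (v : ℕ → V)
    (P : Measure (ℕ → ℕ → E)) : Prop :=
  P Set.univ = 1 ∧
    ∀ (m n : ℕ) (x : ℕ → ℕ → E),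
      P {ω | ∀ j < m, ∀ t < n, ω j t = x j t} =
        ∏ j ∈ Finset.range m, edgeWalkCyl G (v j) (x j) n

/-- `μ` is the law of the random walk on `G` started at `o`, recorded as its sequence of crossed
edges. -/
def IsEdgeWalkLaw {V E : Type} [MeasurableSpace E] (G : DigraphStruct V E) (o : V)
    (μ : Measure (ℕ → E)) : Prop :=
  μ Set.univ = 1 ∧ ∀ (n : ℕ) (x : ℕ → E), μ {ω | ∀ i < n, ω i = x i} = edgeWalkCyl G o x n

/-! ### Finite approximations and Gibbs measures on arboreta -/

/-- A finite digraph with vertices and edges labelled by natural numbers. -/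
structure FinDigraph where
  VS : Finset ℕ
  ES : Finset ℕ
  fsrc : ℕ → ℕ
  fdst : ℕ → ℕ

/-- `B` is a spanning in-arborescence of the finite digraph `H` rooted at `z`. -/
def FinDigraph.IsArb (H : FinDigraph) (z : ℕ) (B : Finset ℕ) : Prop :=
  B ⊆ H.ES ∧ (∀ e ∈ B, H.fsrc e ≠ z) ∧
  (∀ v ∈ H.VS, v ≠ z → ∃! e : ℕ, e ∈ B ∧ H.fsrc e = v) ∧
  (∀ v ∈ H.VS, Relation.ReflTransGen
      (fun a b => ∃ e ∈ B, H.fsrc e = a ∧ H.fdst e = b) v z)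

/-- A finite digraph `H` with a distinguished vertex `z`, together with a partial isomorphism
to a digraph on `(V, E)`: vertex and edge domains `A`, `F` in `H` and maps `φV`, `φE` to `V`, `E`. -/
structure PIso (V E : Type) where
  H : FinDigraph
  z : ℕ
  A : Finset ℕ
  F : Finset ℕ
  φV : ℕ → V
  φE : ℕ → E

/-- The data of `p` really is a partial isomorphism to `G`. -/
def PIso.Valid {V E : Type} (p : PIso V E) (G : DigraphStruct V E) : Prop :=
  ↑p.A ⊆ ↑p.H.VS ∧ ↑p.F ⊆ ↑p.H.ES ∧ p.z ∈ p.H.VS ∧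
  Set.InjOn p.φV ↑p.A ∧ Set.InjOn p.φE ↑p.F ∧
  ∀ e ∈ p.F, p.H.fsrc e ∈ p.A ∧ p.H.fdst e ∈ p.A ∧
    G.src (p.φE e) = p.φV (p.H.fsrc e) ∧ G.dst (p.φE e) = p.φV (p.H.fdst e)

/-- The partial isomorphism `p` identifies a neighbourhood of (a preimage of) `w`:
`w` is in the range of `φV` and `φE` maps the edges incident to its preimage bijectively onto
the edges incident to `w`. -/
def PIso.GoodAt {V E : Type} (p : PIso V E) (G : DigraphStruct V E) (w : V) : Prop :=
  ∃ w' ∈ p.A, p.φV w' = w ∧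
    (∀ e' ∈ p.H.ES, (p.H.fsrc e' = w' ∨ p.H.fdst e' = w') → e' ∈ p.F) ∧
    ∀ e : E, (G.src e = w ∨ G.dst e = w) →
      ∃! e' : ℕ, e' ∈ p.F ∧ (p.H.fsrc e' = w' ∨ p.H.fdst e' = w') ∧ p.φE e' = e

/-- `a` is a finite approximation to `G`: a sequence of finite digraphs with distinguished
vertices `zₙ` and partial isomorphisms to `G`, identifying larger and larger neighbourhoods of
every finite vertex set, with the distinguished vertices escaping to infinity. -/
def IsFinApproxSeq {V E : Type} (G : DigraphStruct V E) (a : ℕ → PIso V E) : Prop :=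
  (∀ n, (a n).Valid G) ∧
  (∀ W : Finset V, ∃ N, ∀ n ≥ N, ∀ w ∈ W, (a n).GoodAt G w) ∧
  (∀ W : Finset V, ∃ N, ∀ n ≥ N, ¬((a n).z ∈ (a n).A ∧ (a n).φV (a n).z ∈ (W : Set V)))

/-- The probability, under the uniform spanning in-arborescence of `p.H` rooted at `p.z`, that
every edge of `F` is in the image of the arborescence under the partial isomorphism. -/
noncomputable def pisoUACyl {V E : Type} (p : PIso V E) (F : Finset E) :
    ℝ≥0∞ :=
  (Nat.card {B : Finset ℕ // p.H.IsArb p.z B ∧ ∀ e ∈ F, ∃ e' ∈ B, e' ∈ p.F ∧ p.φE e' = e} :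
      ℝ≥0∞) /
    (Nat.card {B : Finset ℕ // p.H.IsArb p.z B} : ℝ≥0∞)

/-- `μ` (a measure on edge sets, encoded as elements of `E → Bool`) is a Gibbs measure on
spanning in-arboreta of `G` rooted at infinity: it is a weak limit of mixtures (over a random
finite approximation to `G`) of uniform spanning in-arborescence measures on finite
approximations to `G`. -/
def IsArbGibbs {V E : Type} (G : DigraphStruct V E) (μ : Measure (E → Bool)) : Prop :=
  μ Set.univ = 1 ∧
  ∃ (Ω : Type) (mΩ : MeasurableSpace Ω) (ν : @Measure Ω mΩ) (a : Ω → ℕ → PIso V E),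
    ν Set.univ = 1 ∧ (∀ ω : Ω, IsFinApproxSeq G (a ω)) ∧
    ∀ F : Finset E,
      Filter.Tendsto (fun n => ∫⁻ ω, pisoUACyl (a ω n) F ∂ν) Filter.atTop
        (nhds (μ {A : E → Bool | ∀ e ∈ F, A e = true}))

/-! ### Stacks -/

open Classical in
/-- The state (current vertex, remaining stacks) after `n` steps of following the stacks `σ`
starting from `o`: at each step we cross the edge at the front of the list at the current vertex
and delete it from the list (doing nothing if the list is empty). -/
noncomputable def stackState {V E : Type} (G : DigraphStruct V E) (o : V) (σ : V → List E) :
    ℕ → V × (V → List E)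
  | 0 => (o, σ)
  | n + 1 =>
    let p := stackState G o σ n
    match p.2 p.1 with
    | [] => p
    | e :: rest => (G.dst e, Function.update p.2 p.1 rest)

/-- The edge crossed at step `n` when following the stacks `σ` from `o` (`none` if the
current stack is exhausted). -/
noncomputable def stackEdge {V E : Type} (G : DigraphStruct V E) (o : V) (σ : V → List E)
    (n : ℕ) : Option E :=
  ((stackState G o σ n).2 (stackState G o σ n).1).head?

/-- The sigma-algebra on stack configurations. -/
noncomputable def stackMS (V E : Type) : MeasurableSpace (V → List E) :=
  @MeasurableSpace.pi V (fun _ => List E) fun _ => ⊤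

open Classical in
/-- `ρ` is the law of the random stack configuration built from a random arboretum with law `κ`:
place the arboretum edge at the bottom of the stack at each vertex, and an independent,
uniformly random ordering of the remaining outgoing edges on top of it. -/
def IsStackLaw {V E : Type} (G : DigraphStruct V E) (κ : Measure (E → Bool))
    (ρ : @Measure (V → List E) (stackMS V E)) : Prop :=
  ρ Set.univ = 1 ∧
    ∀ (K : Finset V) (s : V → List E),
      ρ {σ | ∀ v ∈ K, σ v = s v} =
        if ∀ v ∈ K, (s v).Nodup ∧ ∀ e : E, e ∈ s v ↔ G.src e = v then
          κ {A | ∀ v ∈ K, ∃ e : E, (s v).getLast? = some e ∧ A e = true} *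
            ∏ v ∈ K, (((G.outDeg v - 1).factorial : ℝ≥0∞))⁻¹
        else 0

/-! ### Markov chains -/

open Classical in
/-- `ν` is the law of the trajectory of a Markov chain with state space `S' ⊆ S`, transition
kernel `p` and deterministic initial state `s0`. -/
def IsMCLaw {S : Type} [MeasurableSpace S] (S' : Set S) (p : S → S → ℝ≥0∞) (s0 : S)
    (ν : Measure (ℕ → S)) : Prop :=
  ν Set.univ = 1 ∧ s0 ∈ S' ∧
  (∀ u ∈ S', (∑' v : S, p u v) = 1 ∧ ∀ v : S, p u v ≠ 0 → v ∈ S') ∧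
  (∀ u : S, u ∉ S' → ∀ v : S, p u v = 0) ∧
  ∀ (n : ℕ) (y : ℕ → S),
    ν {x | ∀ i ≤ n, x i = y i} =
      if y 0 = s0 then ∏ i ∈ Finset.range n, p (y i) (y (i + 1)) else 0

/-- `ν` is the law of the trajectory of a recurrent Markov chain on a subset of `S` with
non-random initial state: the chain returns to its initial state infinitely often a.s. -/
def IsRecMCLaw {S : Type} [MeasurableSpace S] (ν : Measure (ℕ → S)) : Prop :=
  ∃ (S' : Set S) (p : S → S → ℝ≥0∞) (s0 : S),
    IsMCLaw S' p s0 ν ∧ ν {x | {i : ℕ | x i = s0}.Infinite} = 1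

/-- `ν` is the law of the sequence of vertices visited by (the unique) proper Gibbs measure on
Eulerian paths from `o` to `∞` on a sourced Eulerian digraph whose vertex set is a subset
of `S`. -/
def IsGibbsVertexLaw {S : Type} [MeasurableSpace S] (ν : Measure (ℕ → S)) : Prop :=
  ∃ (Vs : Set S) (E : Type) (mE : MeasurableSpace E) (G : DigraphStruct (↥Vs) E) (o : ↥Vs),
    Countable E ∧ G.IsSourcedEulerian o ∧
    ∃ μp : @Measure (ℕ → E) (@MeasurableSpace.pi ℕ (fun _ => E) fun _ => mE),
      @ProperGibbs (↥Vs) E mE G o μp ∧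
      ∀ A : Set (ℕ → S), MeasurableSet A →
        ν A = μp ((fun (γ : ℕ → E) (i : ℕ) => ((G.src (γ i) : S))) ⁻¹' A)

/-- Concatenation of a finite list with an infinite sequence. -/
def concatSeq {S : Type} (l : List S) (y : ℕ → S) : ℕ → S :=
  fun i => if h : i < l.length then l.get ⟨i, h⟩ else y (i - l.length)

/-- `ν` is the law of a process following a uniform random Eulerian path on a finite Eulerian
digraph with source and sink whose vertex set is a subset of `S`, followed by the trajectory of
an (independent) recurrent Markov chain on a disjoint subset of `S` with non-random initial
state. -/
def IsMixedLaw {S : Type} [MeasurableSpace S] (ν : Measure (ℕ → S)) : Prop :=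
  ∃ (Vf : Finset S) (Ef : Type) (_ : Finite Ef)
    (Gf : DigraphStruct {s : S // s ∈ Vf} Ef) (of zf : {s : S // s ∈ Vf})
    (Vr : Set S) (p : S → S → ℝ≥0∞) (s1 : S) (νMC : Measure (ℕ → S)),
    IsFinEulerian Gf of zf ∧ Disjoint (↑Vf : Set S) Vr ∧
    IsMCLaw Vr p s1 νMC ∧ νMC {x | {i : ℕ | x i = s1}.Infinite} = 1 ∧
    ∀ A : Set (ℕ → S), MeasurableSet A →
      ν A =
        (∑' L : {L : List Ef // IsEulerList Gf of zf L},
            νMC ((fun y => concatSeq (((of : S)) ::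
              (L : List Ef).map fun e => ((Gf.dst e : S))) y) ⁻¹' A)) /
          (Nat.card {L : List Ef // IsEulerList Gf of zf L} : ℝ≥0∞)

set_option linter.unusedSectionVars false
set_option linter.deprecated false

section PartP1

/-! ### Lists, steps, cylinders -/

/-- Consecutive pairs of a list. -/
def steps : List S → List (S × S)
  | [] => []
  | [_] => []
  | a :: b :: l => (a, b) :: steps (b :: l)

@[simp] lemma steps_nil : steps ([] : List S) = [] := rfl
@[simp] lemma steps_single (a : S) : steps [a] = [] := rfl
@[simp] lemma steps_cons_cons (a b : S) (l : List S) :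
    steps (a :: b :: l) = (a, b) :: steps (b :: l) := rfl

lemma steps_append (a : List S) (s : S) (b : List S) :
    steps (a ++ s :: b) = steps (a ++ [s]) ++ steps (s :: b) := by
  induction a with
  | nil => simp
  | cons x a ih =>
    cases a with
    | nil => simp
    | cons y a => simpa using ih

lemma steps_fst (a : List S) (s : S) : (steps (a ++ [s])).map Prod.fst = a := by
  induction a with
  | nil => simp
  | cons x a ih =>
    cases a with
    | nil => simp
    | cons y a => simpa using ih

lemma steps_snd (s : S) (a : List S) : (steps (s :: a)).map Prod.snd = a := by
  induction a generalizing s with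
  | nil => simp
  | cons x a ih => simp [ih]

lemma steps_length (l : List S) : (steps l).length = l.length - 1 := by
  cases l with
  | nil => simp
  | cons s a => 
    have := congrArg List.length (steps_snd s a)
    simpa using this

/-- Equivalence of words. -/
def LEqv (l l' : List S) : Prop := l.head? = l'.head? ∧ (steps l).Perm (steps l')

lemma LEqv.symm {l l' : List S} (h : LEqv l l') : LEqv l' l := ⟨h.1.symm, h.2.symm⟩
lemma LEqv.refl (l : List S) : LEqv l l := ⟨rfl, List.Perm.refl _⟩
lemma LEqv.trans {l l' l'' : List S} (h : LEqv l l') (h' : LEqv l' l'') : LEqv l l'' :=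
  ⟨h.1.trans h'.1, h.2.trans h'.2⟩

lemma LEqv.length_eq {l l' : List S} (h : LEqv l l') : l.length = l'.length := by
  have h2 := h.2.length_eq
  rw [steps_length, steps_length] at h2
  cases l with
  | nil => 
    have := h.1
    cases l' <;> simp_all
  | cons a l =>
    have := h.1
    cases l' with
    | nil => simp_all
    | cons b l' => simp at h2 ⊢; omega

lemma LEqv.last_eq {a a' : List S} {s s' : S} (h : LEqv (a ++ [s]) (a' ++ [s'])) : s = s' := by
  have key : ∀ (a : List S) (s : S) (o : S), (a ++ [s]).head? = some o →
      (o ::ₘ ((steps (a ++ [s])).map Prod.snd : Multiset S)) =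
        s ::ₘ ((steps (a ++ [s])).map Prod.fst : Multiset S) := by
    intro a s o ho
    obtain ⟨l, hl⟩ : ∃ l, a ++ [s] = o :: l := by
      cases a with
      | nil => simp at ho; exact ⟨[], by simp [ho]⟩
      | cons x a => simp at ho; exact ⟨a ++ [s], by simp [ho]⟩
    rw [steps_fst]
    rw [hl, steps_snd, Multiset.cons_coe, Multiset.cons_coe, ← hl, Multiset.coe_eq_coe]
    exact List.perm_append_singleton s a
  obtain ⟨o, ho⟩ : ∃ o, (a ++ [s]).head? = some o := by
    cases a <;> simp
  have h1 := key a s o ho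
  have h2 := key a' s' o (h.1 ▸ ho)
  have h3 : ((steps (a ++ [s])).map Prod.snd : Multiset S) =
      ((steps (a' ++ [s'])).map Prod.snd : Multiset S) :=
    Multiset.coe_eq_coe.2 (h.2.map _)
  have h4 : ((steps (a ++ [s])).map Prod.fst : Multiset S) =
      ((steps (a' ++ [s'])).map Prod.fst : Multiset S) :=
    Multiset.coe_eq_coe.2 (h.2.map _)
  rw [h3, h2, h4] at h1
  exact ((Multiset.cons_inj_left _).1 h1).symm

lemma head?_append_cons (a : List S) (s : S) (b : List S) :
    (a ++ s :: b).head? = (a ++ [s]).head? := by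
  cases a <;> simp

/-- Extend on the right. -/
lemma LEqv.append_right {a a' : List S} {s : S} (h : LEqv (a ++ [s]) (a' ++ [s])) (b : List S) :
    LEqv (a ++ s :: b) (a' ++ s :: b) := by
  refine ⟨?_, ?_⟩
  · rw [head?_append_cons, head?_append_cons a']; exact h.1
  · rw [steps_append, steps_append a']; exact h.2.append_right _

/-- Extend on the left. -/
lemma LEqv.append_left {b b' : List S} (h : LEqv b b') (a : List S) :
    LEqv (a ++ b) (a ++ b') := by
  cases b with
  | nil =>
    have := h.1
    cases b' with
    | nil => exact LEqv.refl _
    | cons => simp at this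
  | cons s b =>
    cases b' with
    | nil => have := h.1; simp at this
    | cons s' b' =>
      have := h.1
      simp at this
      subst this
      refine ⟨?_, ?_⟩
      · rw [head?_append_cons a s b, head?_append_cons a s b']
      · rw [steps_append a s b, steps_append a s b']; exact h.2.append_left _

/-- The shift. -/
def shift (n : ℕ) (ω : ℕ → S) : ℕ → S := fun t => ω (n + t)

lemma shift_shift (m n : ℕ) (ω : ℕ → S) : shift n (shift m ω) = shift (m + n) ω := by
  funext t; simp [shift, add_assoc]

@[simp] lemma shift_zero (ω : ℕ → S) : shift 0 ω = ω := by funext t; simp [shift]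

/-- First `n` letters. -/
def pre (ω : ℕ → S) (n : ℕ) : List S := (List.range n).map ω

@[simp] lemma pre_length (ω : ℕ → S) (n : ℕ) : (pre ω n).length = n := by simp [pre]
@[simp] lemma pre_zero (ω : ℕ → S) : pre ω 0 = [] := by simp [pre]
lemma pre_succ (ω : ℕ → S) (n : ℕ) : pre ω (n + 1) = pre ω n ++ [ω n] := by
  simp [pre, List.range_succ]

lemma pre_add (ω : ℕ → S) (m n : ℕ) : pre ω (m + n) = pre ω m ++ pre (shift m ω) n := by
  simp [pre, List.range_add, shift, Function.comp_def]

lemma pre_succ' (ω : ℕ → S) (n : ℕ) : pre ω (n + 1) = ω 0 :: pre (shift 1 ω) n := by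
  rw [add_comm, pre_add]; simp [pre]

lemma pre_getElem (ω : ℕ → S) (n i : ℕ) (h : i < (pre ω n).length) : (pre ω n)[i] = ω i := by
  simp [pre]

lemma pre_congr {ω ω' : ℕ → S} {n : ℕ} : pre ω n = pre ω' n ↔ ∀ i < n, ω i = ω' i := by
  simp [pre, List.map_inj_left]

/-- Cylinder sets. -/
def cyl (l : List S) : Set (ℕ → S) := {ω | pre ω l.length = l}

lemma mem_cyl {l : List S} {ω : ℕ → S} : ω ∈ cyl l ↔ pre ω l.length = l := Iff.rfl

@[simp] lemma cyl_nil : cyl ([] : List S) = univ := by ext; simp [cyl]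

lemma mem_cyl_append {a b : List S} {ω : ℕ → S} :
    ω ∈ cyl (a ++ b) ↔ ω ∈ cyl a ∧ shift a.length ω ∈ cyl b := by
  rw [mem_cyl, mem_cyl, mem_cyl, List.length_append, pre_add]
  constructor
  · intro h; exact List.append_inj h (by simp)
  · rintro ⟨h1, h2⟩; rw [h1, h2]

lemma mem_cyl_single {s : S} {ω : ℕ → S} : ω ∈ cyl [s] ↔ ω 0 = s := by
  simp [cyl, pre]

lemma mem_cyl_cons {s : S} {l : List S} {ω : ℕ → S} :
    ω ∈ cyl (s :: l) ↔ ω 0 = s ∧ shift 1 ω ∈ cyl l := by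
  rw [show s :: l = [s] ++ l from rfl, mem_cyl_append, mem_cyl_single]; simp

lemma mem_cyl_pre (ω : ℕ → S) (n : ℕ) : ω ∈ cyl (pre ω n) := by simp [cyl]

lemma mem_cyl_pre_iff {ω x : ℕ → S} {n : ℕ} : ω ∈ cyl (pre x n) ↔ ∀ i < n, ω i = x i := by
  simp [cyl, pre_congr]

lemma mem_cyl_iff {l : List S} {ω : ℕ → S} :
    ω ∈ cyl l ↔ ∀ i (h : i < l.length), ω i = l[i] := by
  rw [mem_cyl]
  constructor
  · intro h i hi
    have : (pre ω l.length)[i]'(by simpa using hi) = l[i] := by simp [h]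
    rwa [pre_getElem] at this
  · intro h
    apply List.ext_getElem (by simp)
    intro i h1 h2
    rw [pre_getElem, h i h2]

/-- Concatenation -/
def cat (l : List S) (y : ℕ → S) : ℕ → S := concatSeq l y

lemma cat_lt (l : List S) (y : ℕ → S) (i : ℕ) (h : i < l.length) : cat l y i = l[i] := by
  simp [cat, concatSeq, h]

lemma cat_ge (l : List S) (y : ℕ → S) (i : ℕ) : cat l y (l.length + i) = y i := by
  simp [cat, concatSeq]

@[simp] lemma shift_cat (l : List S) (y : ℕ → S) : shift l.length (cat l y) = y := by
  funext i; simp [shift, cat_ge]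

lemma cat_mem_cyl (l : List S) (y : ℕ → S) : cat l y ∈ cyl l := by
  rw [mem_cyl_iff]; intro i hi; exact cat_lt l y i hi

lemma cat_shift {l : List S} {ω : ℕ → S} (h : ω ∈ cyl l) : cat l (shift l.length ω) = ω := by
  funext i
  by_cases hi : i < l.length
  · rw [cat_lt _ _ _ hi, (mem_cyl_iff.1 h) i hi]
  · obtain ⟨k, rfl⟩ := Nat.exists_eq_add_of_le (not_lt.1 hi)
    rw [cat_ge]; rfl

lemma cat_append (a b : List S) (y : ℕ → S) : cat (a ++ b) y = cat a (cat b y) := by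
  have h : cat a (cat b y) ∈ cyl (a ++ b) := by
    rw [mem_cyl_append]
    exact ⟨cat_mem_cyl _ _, by rw [shift_cat]; exact cat_mem_cyl _ _⟩
  rw [← cat_shift h, List.length_append, ← shift_shift, shift_cat, shift_cat]

@[simp] lemma cat_nil (y : ℕ → S) : cat [] y = y := by
  funext i; simp [cat, concatSeq]

lemma transCount_eq (x : ℕ → S) (n : ℕ) (u v : S) [DecidableEq S] :
    transCount x n u v = List.count (u, v) (steps (pre x (n + 1))) := by
  induction n with
  | zero => simp [transCount, pre]
  | succ n ih =>
    have h1 : steps (pre x (n + 1 + 1)) = steps (pre x (n + 1)) ++ [(x n, x (n + 1))] := by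
      rw [pre_succ x (n + 1), pre_succ x n, List.append_assoc, List.singleton_append, steps_append]
      simp
    rw [h1, List.count_append, ← ih, transCount, transCount]
    by_cases h : x n = u ∧ x (n + 1) = v
    · have : {i : ℕ | i < n + 1 ∧ x i = u ∧ x (i + 1) = v} =
          insert n {i : ℕ | i < n ∧ x i = u ∧ x (i + 1) = v} := by
        ext i
        simp only [mem_setOf_eq, mem_insert_iff]
        constructor
        · rintro ⟨h1, h2⟩
          rcases Nat.lt_succ_iff_lt_or_eq.1 h1 with h3 | h3
          · exact Or.inr ⟨h3, h2⟩
          · exact Or.inl h3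
        · rintro (rfl | ⟨h1, h2⟩)
          · exact ⟨Nat.lt_succ_self _, h⟩
          · exact ⟨h1.trans (Nat.lt_succ_self _), h2⟩
      rw [this, ncard_insert_of_notMem (by simp)
        ((Set.finite_lt_nat n).subset (fun i hi => hi.1))]
      simp [h.1, h.2]
    · have : {i : ℕ | i < n + 1 ∧ x i = u ∧ x (i + 1) = v} =
          {i : ℕ | i < n ∧ x i = u ∧ x (i + 1) = v} := by
        ext i
        simp only [mem_setOf_eq]
        constructor
        · rintro ⟨h1, h2⟩
          rcases Nat.lt_succ_iff_lt_or_eq.1 h1 with h3 | h3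
          · exact ⟨h3, h2⟩
          · subst h3; exact absurd h2 h
        · rintro ⟨h1, h2⟩
          exact ⟨h1.trans (Nat.lt_succ_self _), h2⟩
      rw [this]
      have : List.count (u, v) [(x n, x (n + 1))] = 0 := by
        rw [List.count_eq_zero]
        simp only [List.mem_singleton, Prod.mk.injEq]
        rintro ⟨h1, h2⟩; exact h ⟨h1.symm, h2.symm⟩
      rw [this]; rfl

lemma finEquiv_iff (x y : ℕ → S) (n : ℕ) :
    FinEquiv x y n ↔ LEqv (pre x (n + 1)) (pre y (n + 1)) := by
  classical
  rw [FinEquiv, LEqv]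
  simp only [transCount_eq, List.perm_iff_count, Prod.forall]
  simp [pre_succ']

/-- Word version of partial exchangeability. -/
def LPE [MeasurableSpace S] (μ : Measure (ℕ → S)) : Prop :=
  ∀ l l' : List S, LEqv l l' → μ (cyl l) = μ (cyl l')

lemma exists_pre (l : List S) (h : l ≠ []) : ∃ x : ℕ → S, pre x l.length = l := by
  cases l with
  | nil => exact absurd rfl h
  | cons s l => exact ⟨cat (s :: l) (fun _ => s), cat_mem_cyl _ _⟩

lemma pe_iff [MeasurableSpace S] (μ : Measure (ℕ → S)) : PartiallyExchangeable μ ↔ LPE μ := by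
  have hc : ∀ (n : ℕ) (x : ℕ → S), {ω : ℕ → S | ∀ i ≤ n, ω i = x i} = cyl (pre x (n + 1)) := by
    intro n x; ext ω; simp [mem_cyl_pre_iff, Nat.lt_succ_iff]
  constructor
  · intro h l l' hl
    have hlen := hl.length_eq
    by_cases h0 : l = []
    · subst h0
      have : l' = [] := List.length_eq_zero_iff.1 (by simpa using hlen.symm)
      rw [this]
    · obtain ⟨x, hx⟩ := exists_pre l h0
      obtain ⟨y, hy⟩ := exists_pre l' (by rintro rfl; simp at hlen; exact h0 hlen)
      obtain ⟨n, hn⟩ : ∃ n, l.length = n + 1 :=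
        ⟨l.length - 1, (Nat.succ_pred_eq_of_pos (List.length_pos_iff.2 h0)).symm⟩
      rw [← hlen] at hy
      rw [hn] at hx hy
      have := h n x y ((finEquiv_iff x y n).2 (by rwa [hx, hy]))
      rwa [hc, hc, hx, hy] at this
  · intro h n x y hxy
    rw [hc, hc]
    exact h _ _ ((finEquiv_iff x y n).1 hxy)

/-! ### Measures on sequences -/

section meas
variable [MeasurableSpace S] [DiscreteMeasurableSpace S]

lemma measurable_shift (n : ℕ) : Measurable (shift n : (ℕ → S) → (ℕ → S)) :=
  measurable_pi_lambda _ (fun i => measurable_pi_apply (n + i))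

lemma measurableSet_coord (i : ℕ) (A : Set S) : MeasurableSet {ω : ℕ → S | ω i ∈ A} :=
  measurable_pi_apply i (MeasurableSet.of_discrete (s := A))

lemma measurableSet_cyl (l : List S) : MeasurableSet (cyl l) := by
  have : cyl l = ⋂ i : Fin l.length, {ω : ℕ → S | ω i ∈ ({l[i]} : Set S)} := by
    ext ω
    simp only [mem_cyl_iff, mem_iInter, mem_setOf_eq, mem_singleton_iff]
    exact ⟨fun h i => h i i.2, fun h i hi => h ⟨i, hi⟩⟩
  rw [this]
  exact MeasurableSet.iInter (fun i => measurableSet_coord _ _)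

lemma measurable_cat (l : List S) : Measurable (cat l : (ℕ → S) → (ℕ → S)) := by
  refine measurable_pi_lambda _ (fun i => ?_)
  by_cases hi : i < l.length
  · simp only [cat_lt _ _ _ hi]; exact measurable_const
  · obtain ⟨k, rfl⟩ := Nat.exists_eq_add_of_le (not_lt.1 hi)
    simp only [cat_ge]; exact measurable_pi_apply k

variable [Countable S]

lemma generate_cyl : (inferInstance : MeasurableSpace (ℕ → S)) =
    MeasurableSpace.generateFrom (range (cyl : List S → Set (ℕ → S))) := by
  apply le_antisymm
  · change MeasurableSpace.pi ≤ _
    rw [MeasurableSpace.pi]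
    refine iSup_le (fun i => ?_)
    rintro _ ⟨A, -, rfl⟩
    have : (fun ω : ℕ → S => ω i) ⁻¹' A =
        ⋃ l ∈ {l : List S | ∃ ω : ℕ → S, ω i ∈ A ∧ l = pre ω (i + 1)}, cyl l := by
      ext ω
      simp only [mem_preimage, mem_iUnion, mem_setOf_eq, exists_prop]
      constructor
      · intro h; exact ⟨pre ω (i + 1), ⟨ω, h, rfl⟩, mem_cyl_pre _ _⟩
      · rintro ⟨_, ⟨ω', h', rfl⟩, h⟩
        rw [mem_cyl_pre_iff] at h
        rwa [h i (Nat.lt_succ_self i)]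
    rw [this]
    exact MeasurableSet.biUnion (Set.to_countable _)
      (fun l _ => MeasurableSpace.measurableSet_generateFrom ⟨l, rfl⟩)
  · apply MeasurableSpace.generateFrom_le
    rintro _ ⟨l, rfl⟩
    exact measurableSet_cyl l

lemma isPiSystem_cyl : IsPiSystem (range (cyl : List S → Set (ℕ → S))) := by
  have key : ∀ a b : List S, a.length ≤ b.length → (cyl a ∩ cyl b).Nonempty →
      cyl a ∩ cyl b = cyl b := by
    rintro a b hab ⟨ω, h1, h2⟩
    apply inter_eq_right.2
    intro ω' h'
    rw [mem_cyl_iff] at *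
    intro i hi
    rw [h' i (by omega), ← h2 i (by omega), h1 i hi]
  rintro _ ⟨a, rfl⟩ _ ⟨b, rfl⟩ hne
  rcases le_total a.length b.length with h | h
  · exact ⟨b, (key a b h hne).symm⟩
  · rw [inter_comm] at hne ⊢
    exact ⟨a, (key b a h hne).symm⟩

lemma measure_cyl_split (μ : Measure (ℕ → S)) (l : List S) :
    μ (cyl l) = ∑' s : S, μ (cyl (l ++ [s])) := by
  rw [← measure_iUnion]
  · congr 1
    ext ω
    simp [mem_cyl_append, mem_cyl_single]
  · intro s s' hs
    refine Set.disjoint_left.2 (fun ω h h' => hs ?_)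
    rw [mem_cyl_append, mem_cyl_single] at h h'
    rw [← h.2, h'.2]
  · exact fun s => measurableSet_cyl _

lemma ext_cyl {μ ν : Measure (ℕ → S)} [IsFiniteMeasure μ]
    (h : ∀ l : List S, l ≠ [] → μ (cyl l) = ν (cyl l)) : μ = ν := by
  have h' : ∀ l : List S, μ (cyl l) = ν (cyl l) := by
    intro l
    by_cases hl : l = []
    · subst hl
      rw [measure_cyl_split μ, measure_cyl_split ν]
      exact tsum_congr (fun s => h _ (by simp))
    · exact h l hl
  refine ext_of_generate_finite (range cyl) generate_cyl isPiSystem_cyl ?_ ?_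
  · rintro _ ⟨l, rfl⟩; exact h' l
  · simpa using h' []

/-- The law of the process after the word `a`, restricted to the event that it starts with `a`. -/
noncomputable def aft (μ : Measure (ℕ → S)) (a : List S) : Measure (ℕ → S) :=
  (μ.restrict (cyl a)).map (shift a.length)

end meas

end PartP1

section PartP2

/-! ### General tools -/
section tools
variable [MeasurableSpace S] [DiscreteMeasurableSpace S] [Countable S]

lemma aft_apply (μ : Measure (ℕ → S)) (a : List S) {A : Set (ℕ → S)} (hA : MeasurableSet A) :
    aft μ a A = μ (cyl a ∩ shift a.length ⁻¹' A) := by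
  rw [aft, Measure.map_apply (measurable_shift _) hA,
    Measure.restrict_apply (measurable_shift _ hA), inter_comm]

lemma cyl_append_eq (a b : List S) : cyl (a ++ b) = cyl a ∩ shift a.length ⁻¹' cyl b := by
  ext ω; rw [mem_cyl_append]; rfl

lemma aft_cyl (μ : Measure (ℕ → S)) (a b : List S) : aft μ a (cyl b) = μ (cyl (a ++ b)) := by
  rw [aft_apply _ _ (measurableSet_cyl _), cyl_append_eq]

instance aft_finite (μ : Measure (ℕ → S)) [IsFiniteMeasure μ] (a : List S) :
    IsFiniteMeasure (aft μ a) := by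
  unfold aft; infer_instance

lemma aft_lpe {μ : Measure (ℕ → S)} (h : LPE μ) (a : List S) : LPE (aft μ a) := by
  intro l l' hl
  rw [aft_cyl, aft_cyl]
  exact h _ _ (hl.append_left a)

/-- words of equal last letter -/
lemma LEqv.exists_last {a l' : List S} {s : S} (h : LEqv (a ++ [s]) l') :
    ∃ a', l' = a' ++ [s] ∧ a'.length = a.length := by
  have hlen := h.length_eq
  rcases List.eq_nil_or_concat l' with rfl | ⟨a', s', rfl⟩
  · simp at hlen
  · rw [List.concat_eq_append] at *
    have := h.last_eq
    subst this
    exact ⟨a', rfl, by simpa using hlen.symm⟩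

lemma LEqv.len {a a' : List S} {s : S} (h : LEqv (a ++ [s]) (a' ++ [s])) :
    a.length = a'.length := by
  have := h.length_eq; simpa using this

lemma cyl_single_eq (s : S) : cyl [s] = {ω : ℕ → S | ω 0 = s} := by
  ext ω; exact mem_cyl_single

lemma cyl_inter_single {s : S} {b : List S} (hb : b ≠ []) :
    (cyl b ∩ cyl [s] = cyl b ∧ b.head? = some s) ∨ cyl b ∩ cyl [s] = (∅ : Set (ℕ → S)) := by
  cases b with
  | nil => exact absurd rfl hb
  | cons t b =>
    by_cases h : t = s
    · left
      subst h
      refine ⟨inter_eq_left.2 ?_, by simp⟩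
      intro ω h
      rw [mem_cyl_cons] at h
      exact mem_cyl_single.2 h.1
    · right
      ext ω
      simp only [mem_inter_iff, mem_cyl_cons, mem_empty_iff_false, iff_false]
      rintro ⟨⟨h1, -⟩, h2, -⟩
      exact h (h1.symm.trans h2)

lemma aft_tail {μ : Measure (ℕ → S)} [IsFiniteMeasure μ] (h : LPE μ) {a a' : List S} {s : S}
    (ha : LEqv (a ++ [s]) (a' ++ [s])) :
    (aft μ a).restrict (cyl [s]) = (aft μ a').restrict (cyl [s]) := by
  apply ext_cyl
  intro b hb
  rw [Measure.restrict_apply (measurableSet_cyl _), Measure.restrict_apply (measurableSet_cyl _)]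
  rcases cyl_inter_single (s := s) hb with ⟨h1, h2⟩ | h1
  · rw [h1, aft_cyl, aft_cyl]
    cases b with
    | nil => exact absurd rfl hb
    | cons t b =>
      simp at h2
      subst h2
      exact h _ _ (ha.append_right b)
  · rw [h1]; simp

lemma tail_eq {μ : Measure (ℕ → S)} [IsFiniteMeasure μ] (h : LPE μ) {a a' : List S} {s : S}
    (ha : LEqv (a ++ [s]) (a' ++ [s])) {C : Set (ℕ → S)} (hC : MeasurableSet C)
    (hCs : C ⊆ cyl [s]) :
    μ (cyl a ∩ shift a.length ⁻¹' C) = μ (cyl a' ∩ shift a'.length ⁻¹' C) := by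
  rw [← aft_apply _ _ hC, ← aft_apply _ _ hC]
  have := congrArg (fun ν => ν C) (aft_tail h ha)
  simpa [Measure.restrict_apply hC, inter_eq_left.2 hCs] using this

lemma lpe_smul {μ : Measure (ℕ → S)} (h : LPE μ) (c : ℝ≥0∞) : LPE (c • μ) := by
  intro l l' hl
  simp [h l l' hl]

lemma lpe_sub {μ ρ : Measure (ℕ → S)} [IsFiniteMeasure ρ] (h : LPE μ) (h' : LPE ρ) (hle : ρ ≤ μ) :
    LPE (μ - ρ) := by
  intro l l' hl
  rw [Measure.sub_apply (measurableSet_cyl _) hle, Measure.sub_apply (measurableSet_cyl _) hle,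
    h l l' hl, h' l l' hl]

lemma ext_le {μ : Measure (ℕ → S)} (h : IsExtremePE μ) {ρ : Measure (ℕ → S)} (hρ : LPE ρ)
    (hle : ρ ≤ μ) : ρ = ρ univ • μ := by
  obtain ⟨⟨h1, hpe⟩, hext⟩ := h
  rw [pe_iff] at hpe
  have : IsProbabilityMeasure μ := ⟨h1⟩
  have : IsFiniteMeasure ρ := isFiniteMeasure_of_le μ hle
  have ht1 : ρ univ ≤ 1 := h1 ▸ hle univ
  have hadd : (μ - ρ) + ρ = μ := Measure.sub_add_cancel_of_le hle
  by_cases h0 : ρ univ = 0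
  · rw [h0, zero_smul]; exact Measure.measure_univ_eq_zero.1 h0
  have hsub : (μ - ρ) univ = 1 - ρ univ := by
    rw [Measure.sub_apply MeasurableSet.univ hle, h1]
  by_cases h01 : ρ univ = 1
  · rw [h01, one_smul]
    rw [h01, tsub_self] at hsub
    rw [Measure.measure_univ_eq_zero.1 hsub, zero_add] at hadd
    exact hadd
  have hlt : ρ univ < 1 := lt_of_le_of_ne ht1 h01
  have htop : ρ univ ≠ ⊤ := measure_ne_top _ _
  have h10 : 1 - ρ univ ≠ 0 := (tsub_pos_of_lt hlt).ne'
  have h1t : 1 - ρ univ ≠ ⊤ := ne_top_of_le_ne_top ENNReal.one_ne_top tsub_le_self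
  have e1 : ρ univ • ((ρ univ)⁻¹ • ρ) = ρ := by
    rw [smul_smul, ENNReal.mul_inv_cancel h0 htop, one_smul]
  have e2 : (1 - ρ univ) • ((1 - ρ univ)⁻¹ • (μ - ρ)) = μ - ρ := by
    rw [smul_smul, ENNReal.mul_inv_cancel h10 h1t, one_smul]
  have key := hext ((ρ univ)⁻¹ • ρ)
    ⟨by simp [ENNReal.inv_mul_cancel h0 htop], (pe_iff _).2 (lpe_smul hρ _)⟩
    ((1 - ρ univ)⁻¹ • (μ - ρ))
    ⟨by rw [Measure.smul_apply, hsub, smul_eq_mul, ENNReal.inv_mul_cancel h10 h1t],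
      (pe_iff _).2 (lpe_smul (lpe_sub hpe hρ hle) _)⟩
    (ρ univ) (pos_iff_ne_zero.2 h0) hlt (by rw [e1, e2, add_comm]; exact hadd.symm)
  have e3 : μ = (ρ univ)⁻¹ • ρ := by
    have e4 : (1 - ρ univ) • ((ρ univ)⁻¹ • ρ) + ρ univ • ((ρ univ)⁻¹ • ρ) = μ := by
      rw [e1, key, e2, hadd]
    rw [← add_smul, tsub_add_cancel_of_le ht1, one_smul] at e4
    exact e4.symm
  conv_rhs => rw [e3]
  exact e1.symm

lemma ext_of_le {μ : Measure (ℕ → S)} (h1 : μ univ = 1) (hpe : LPE μ)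
    (h : ∀ ρ : Measure (ℕ → S), LPE ρ → ρ ≤ μ → ρ = ρ univ • μ) : IsExtremePE μ := by
  refine ⟨⟨h1, (pe_iff _).2 hpe⟩, ?_⟩
  have key : ∀ (ν : Measure (ℕ → S)), ν ∈ PEProb S → ∀ t : ℝ≥0∞, 0 < t → t < 1 → t • ν ≤ μ →
      ν = μ := by
    intro ν hν t ht0 ht1 hle
    have := h _ (lpe_smul ((pe_iff _).1 hν.2) t) hle
    rw [Measure.smul_apply, hν.1, smul_eq_mul, mul_one] at this
    have e := congrArg (fun κ => t⁻¹ • κ) this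
    simpa [smul_smul, ENNReal.inv_mul_cancel ht0.ne' (ht1.trans ENNReal.one_lt_top).ne] using e
  intro μ₁ h₁ μ₂ h₂ t ht0 ht1 he
  rw [key μ₁ h₁ t ht0 ht1 (by rw [he]; exact Measure.le_add_right le_rfl),
    key μ₂ h₂ (1 - t) (tsub_pos_of_lt ht1)
      (ENNReal.sub_lt_self ENNReal.one_ne_top one_ne_zero ht0.ne')
      (by rw [he]; exact Measure.le_add_left le_rfl)]

/-- Events invariant under replacing an initial word by an equivalent one. -/
def PInv (A : Set (ℕ → S)) : Prop :=
  ∀ (a a' : List S) (s : S) (ω : ℕ → S), LEqv (a ++ [s]) (a' ++ [s]) → ω 0 = s →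
    cat a ω ∈ A → cat a' ω ∈ A

lemma pinv_inter {μ : Measure (ℕ → S)} [IsFiniteMeasure μ] (h : LPE μ) {A : Set (ℕ → S)}
    (hA : MeasurableSet A) (hinv : PInv A) {l l' : List S} (hl : LEqv l l') :
    μ (cyl l ∩ A) = μ (cyl l' ∩ A) := by
  rcases List.eq_nil_or_concat l with rfl | ⟨a, s, rfl⟩
  · have := hl.length_eq
    rw [List.length_nil] at this
    rw [List.length_eq_zero_iff.1 this.symm]
  · rw [List.concat_eq_append] at *
    obtain ⟨a', rfl, hlen⟩ := hl.exists_last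
    have e : ∀ b b' : List S, LEqv (b ++ [s]) (b' ++ [s]) →
        cyl (b ++ [s]) ∩ A = cyl b ∩ shift b.length ⁻¹' (cyl [s] ∩ cat b' ⁻¹' A) := by
      intro b b' hb
      ext ω
      rw [cyl_append_eq]
      simp only [mem_inter_iff, mem_preimage]
      constructor
      · rintro ⟨⟨h1, h2⟩, h3⟩
        refine ⟨h1, h2, ?_⟩
        apply hinv b b' s _ hb (mem_cyl_single.1 h2)
        rwa [cat_shift h1]
      · rintro ⟨h1, h2, h3⟩
        refine ⟨⟨h1, h2⟩, ?_⟩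
        have := hinv b' b s _ hb.symm (mem_cyl_single.1 h2) h3
        rwa [cat_shift h1] at this
    rw [e a a' hl, e a' a' (LEqv.refl _)]
    exact tail_eq h hl ((measurableSet_cyl _).inter (measurable_cat _ hA)) inter_subset_left

lemma lpe_restrict {μ : Measure (ℕ → S)} [IsFiniteMeasure μ] (h : LPE μ) {A : Set (ℕ → S)}
    (hA : MeasurableSet A) (hinv : PInv A) : LPE (μ.restrict A) := by
  intro l l' hl
  rw [Measure.restrict_apply (measurableSet_cyl _), Measure.restrict_apply (measurableSet_cyl _)]
  exact pinv_inter h hA hinv hl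

lemma IsExtremePE.prob {μ : Measure (ℕ → S)} (h : IsExtremePE μ) : IsProbabilityMeasure μ :=
  ⟨h.1.1⟩
lemma IsExtremePE.lpe {μ : Measure (ℕ → S)} (h : IsExtremePE μ) : LPE μ := (pe_iff _).1 h.1.2

lemma ext_zero_one {μ : Measure (ℕ → S)} (h : IsExtremePE μ) {A : Set (ℕ → S)}
    (hA : MeasurableSet A) (hinv : PInv A) : μ A = 0 ∨ μ A = 1 := by
  have := h.prob
  have := congrArg (fun κ => κ A) (ext_le h (lpe_restrict h.lpe hA hinv) Measure.restrict_le_self)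
  simp only [Measure.restrict_apply hA, inter_self, Measure.smul_apply, Measure.restrict_apply_univ,
    smul_eq_mul] at this
  by_cases h0 : μ A = 0
  · exact Or.inl h0
  · right
    have h2 : μ A * μ A = μ A * 1 := by rw [mul_one]; exact this.symm
    exact (ENNReal.mul_right_inj h0 (measure_ne_top _ _)).1 h2

lemma ext_ae {μ : Measure (ℕ → S)} (h : IsExtremePE μ) {A : Set (ℕ → S)}
    (hA : MeasurableSet A) (hinv : PInv A) : (∀ᵐ ω ∂μ, ω ∉ A) ∨ (∀ᵐ ω ∂μ, ω ∈ A) := by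
  have := h.prob
  rcases ext_zero_one h hA hinv with h0 | h1
  · left; exact measure_eq_zero_iff_ae_notMem.1 h0
  · right; exact (mem_ae_iff_prob_eq_one hA).2 h1

end tools

end PartP2

section PartP3

/-! ### Recurrent partially exchangeable measures -/

/-- Words avoiding `o`. -/
abbrev AW (o : S) := {c : List S // o ∉ c}

lemma first_hit (o : S) (ω : ℕ → S) (n : ℕ) (h : ∃ m, n ≤ m ∧ ω m = o) :
    ∃ c : AW o, ω ∈ cyl (pre ω n ++ c.1 ++ [o]) := by
  classical
  have h' : ∃ k, ω (n + k) = o := by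
    obtain ⟨m, hm, h⟩ := h
    exact ⟨m - n, by rwa [Nat.add_sub_cancel' hm]⟩
  have h1 := Nat.find_spec h'
  have h2 : ∀ k < Nat.find h', ω (n + k) ≠ o := fun k hk => Nat.find_min h' hk
  refine ⟨⟨pre (shift n ω) (Nat.find h'), ?_⟩, ?_⟩
  · simp only [pre, List.mem_map, List.mem_range, not_exists, not_and]
    intro k hk; exact h2 k hk
  · rw [← pre_add]
    have : pre ω (n + Nat.find h') ++ [o] = pre ω (n + Nat.find h' + 1) := by
      rw [pre_succ, h1]
    rw [this]; exact mem_cyl_pre _ _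

lemma aw_unique {o : S} {c c' : List S} (hc : o ∉ c) (hc' : o ∉ c') {y : ℕ → S}
    (h : y ∈ cyl (c ++ [o])) (h' : y ∈ cyl (c' ++ [o])) : c = c' := by
  have key : ∀ {c c' : List S}, o ∉ c → o ∉ c' → y ∈ cyl (c ++ [o]) → y ∈ cyl (c' ++ [o]) →
      ¬ c.length < c'.length := by
    intro c c' hc hc' h h' hlt
    rw [mem_cyl_append, mem_cyl_single] at h
    rw [mem_cyl_append, mem_cyl_iff] at h'
    have h1 := h'.1 c.length hlt
    have h2 : y c.length = o := h.2
    apply hc'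
    rw [← h2, h1]; exact List.getElem_mem _
  have hl : c.length = c'.length :=
    le_antisymm (not_lt.1 (key hc' hc h' h)) (not_lt.1 (key hc hc' h h'))
  rw [mem_cyl_append, mem_cyl] at h h'
  rw [← h.1, ← h'.1, hl]

section rec
variable [MeasurableSpace S] [DiscreteMeasurableSpace S] [Countable S]

/-- Almost surely starts at `o` and visits `o` infinitely often. -/
def RecAt (o : S) (μ : Measure (ℕ → S)) : Prop :=
  ∀ᵐ ω ∂μ, ω 0 = o ∧ ∀ n, ∃ m, n ≤ m ∧ ω m = o

lemma RecAt.start {o : S} {μ : Measure (ℕ → S)} (h : RecAt o μ) : ∀ᵐ ω ∂μ, ω 0 = o := by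
  filter_upwards [h] with ω hω using hω.1

lemma RecAt.ac {o : S} {μ ρ : Measure (ℕ → S)} (h : RecAt o μ) (hle : ρ ≪ μ) : RecAt o ρ :=
  hle.ae_le h

lemma ret_inter {o : S} {μ : Measure (ℕ → S)} (h : RecAt o μ) (b : List S) {A : Set (ℕ → S)}
    (hA : MeasurableSet A) :
    μ (cyl b ∩ A) = ∑' c : AW o, μ (cyl (b ++ c.1 ++ [o]) ∩ A) := by
  rw [← measure_iUnion]
  · apply measure_congr
    filter_upwards [h] with ω hω
    apply propext
    change (ω ∈ cyl b ∩ A) ↔ (ω ∈ ⋃ c : AW o, cyl (b ++ c.1 ++ [o]) ∩ A)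
    simp only [mem_iUnion, mem_inter_iff]
    constructor
    · rintro ⟨h1, h2⟩
      obtain ⟨c, hc⟩ := first_hit o ω b.length (hω.2 _)
      rw [mem_cyl.1 h1] at hc
      exact ⟨c, hc, h2⟩
    · rintro ⟨c, h1, h2⟩
      rw [List.append_assoc, mem_cyl_append] at h1
      exact ⟨h1.1, h2⟩
  · intro c c' hcc
    refine Set.disjoint_left.2 (fun ω h1 h2 => hcc ?_)
    have h1 := h1.1
    have h2 := h2.1
    rw [List.append_assoc, mem_cyl_append] at h1 h2
    exact Subtype.ext (aw_unique c.2 c'.2 h1.2 h2.2)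
  · exact fun c => (measurableSet_cyl _).inter hA

lemma ret {o : S} {μ : Measure (ℕ → S)} (h : RecAt o μ) (b : List S) :
    μ (cyl b) = ∑' c : AW o, μ (cyl (b ++ c.1 ++ [o])) := by
  simpa using ret_inter h b MeasurableSet.univ

lemma steps_loop (a b : List S) (o : S) :
    steps (o :: a ++ (o :: b)) = steps (o :: a ++ [o]) ++ steps (o :: b) := by
  rw [steps_append]

/-- Swapping two loops. -/
lemma swap_loops (o : S) (a b : List S) :
    LEqv ((o :: a) ++ (o :: b) ++ [o]) ((o :: b) ++ (o :: a) ++ [o]) := by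
  refine ⟨by simp, ?_⟩
  have e1 : steps ((o :: a) ++ (o :: b) ++ [o]) =
      steps ((o :: a) ++ [o]) ++ steps ((o :: b) ++ [o]) := by
    rw [List.append_assoc, List.cons_append (a := o) (as := b), steps_append]
  have e2 : steps ((o :: b) ++ (o :: a) ++ [o]) =
      steps ((o :: b) ++ [o]) ++ steps ((o :: a) ++ [o]) := by
    rw [List.append_assoc, List.cons_append (a := o) (as := a), steps_append]
  rw [e1, e2]
  exact List.perm_append_comm

lemma cyl_head_zero {o : S} {μ : Measure (ℕ → S)} (h : ∀ᵐ ω ∂μ, ω 0 = o) {b : List S}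
    (hb : b ≠ []) (hbo : b.head? ≠ some o) : μ (cyl b) = 0 := by
  rw [measure_eq_zero_iff_ae_notMem]
  filter_upwards [h] with ω hω hm
  cases b with
  | nil => exact hb rfl
  | cons s b =>
    rw [mem_cyl_cons] at hm
    simp at hbo
    exact hbo (hm.1.symm.trans hω)

/-- The restriction to paths which start from `o` of the law after word `a`. -/
noncomputable def aftr (μ : Measure (ℕ → S)) (a : List S) (o : S) : Measure (ℕ → S) :=
  (aft μ a).restrict (cyl [o])

instance aftr_finite (μ : Measure (ℕ → S)) [IsFiniteMeasure μ] (a : List S) (o : S) :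
    IsFiniteMeasure (aftr μ a o) := by
  unfold aftr; infer_instance

lemma aftr_cyl (μ : Measure (ℕ → S)) (a b : List S) (o : S) :
    aftr μ a o (cyl (o :: b)) = μ (cyl (a ++ o :: b)) := by
  rw [aftr, Measure.restrict_apply (measurableSet_cyl _)]
  rcases cyl_inter_single (s := o) (b := o :: b) (by simp) with ⟨h1, -⟩ | h1
  · rw [h1, aft_cyl]
  · exfalso
    have : cat (o :: b) (fun _ => o) ∈ cyl (o :: b) ∩ cyl [o] :=
      ⟨cat_mem_cyl _ _, mem_cyl_single.2 (mem_cyl_cons.1 (cat_mem_cyl _ _)).1⟩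
    rw [h1] at this
    exact this

lemma aftr_start (μ : Measure (ℕ → S)) (a : List S) (o : S) : ∀ᵐ ω ∂(aftr μ a o), ω 0 = o := by
  rw [aftr]
  filter_upwards [ae_restrict_mem (measurableSet_cyl [o])] with ω h
  exact mem_cyl_single.1 h

lemma pinv_start (o : S) : PInv (cyl [o]) := by
  intro a a' s ω h hs hm
  rw [mem_cyl_single] at *
  have h1 := h.1
  cases a with
  | nil =>
    have : a'.length = 0 := h.len.symm
    rw [List.length_eq_zero_iff.1 this]; exact hm
  | cons x a =>
    cases a' with
    | nil => have := h.len; simp at this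
    | cons y a' =>
      simp at h1
      rw [← h1]
      have e1 : cat (x :: a) ω 0 = x := (mem_cyl_cons.1 (cat_mem_cyl (x :: a) ω)).1
      have e2 : cat (x :: a') ω 0 = x := (mem_cyl_cons.1 (cat_mem_cyl (x :: a') ω)).1
      rw [e2, ← hm, e1]

lemma aftr_lpe {μ : Measure (ℕ → S)} [IsFiniteMeasure μ] (h : LPE μ) (a : List S) (o : S) :
    LPE (aftr μ a o) :=
  lpe_restrict (aft_lpe h a) (measurableSet_cyl _) (pinv_start o)

lemma stat {o : S} {μ : Measure (ℕ → S)} [IsFiniteMeasure μ] (h : LPE μ) (hr : RecAt o μ) :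
    Measure.sum (fun a : AW o => aftr μ (o :: a.1) o) = μ := by
  symm
  apply ext_cyl
  intro b hb
  rw [Measure.sum_apply _ (measurableSet_cyl _)]
  by_cases hbo : b.head? = some o
  · obtain ⟨b, rfl⟩ : ∃ b', b = o :: b' := by
      cases b with
      | nil => simp at hbo
      | cons x b => simp at hbo; exact ⟨b, by rw [hbo]⟩
    simp_rw [aftr_cyl]
    have e1 : ∀ a : AW o, μ (cyl (o :: a.1 ++ o :: b)) =
        ∑' c : AW o, μ (cyl ((o :: b ++ c.1 ++ [o]) ++ a.1 ++ [o])) := by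
      intro a
      rw [ret hr]
      refine tsum_congr (fun c => ?_)
      have := h _ _ (swap_loops o a.1 (b ++ c.1))
      simp only [List.append_assoc, List.cons_append, List.nil_append] at this ⊢
      exact this
    simp_rw [e1]
    rw [ENNReal.tsum_comm]
    simp_rw [← ret hr]
  · rw [cyl_head_zero hr.start hb hbo]
    symm
    rw [ENNReal.tsum_eq_zero]
    intro a
    exact cyl_head_zero (aftr_start _ _ _) hb hbo

lemma block_prod {o : S} {μ : Measure (ℕ → S)} (h : IsExtremePE μ) (hr : RecAt o μ)
    (a : AW o) (b : List S) :
    μ (cyl (o :: a.1 ++ o :: b)) = μ (cyl (o :: a.1 ++ [o])) * μ (cyl (o :: b)) := by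
  have := h.prob
  have hle : aftr μ (o :: a.1) o ≤ μ := by
    conv_rhs => rw [← stat h.lpe hr]
    exact Measure.le_sum _ a
  have e := ext_le h (aftr_lpe h.lpe _ _) hle
  have e1 := congrArg (fun κ => κ (cyl (o :: b))) e
  have e2 := congrArg (fun κ => κ (cyl [o])) e
  have ho : μ (cyl [o]) = 1 := by
    rw [← mem_ae_iff_prob_eq_one (measurableSet_cyl _)]
    filter_upwards [hr] with ω hω
    exact mem_cyl_single.2 hω.1
  simp only [Measure.smul_apply, aftr_cyl, smul_eq_mul, ho, mul_one] at e1 e2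
  rw [e1, e2]

lemma loop_prod {o : S} {μ : Measure (ℕ → S)} (h : IsExtremePE μ) (hr : RecAt o μ)
    (a : List S) (b : List S) :
    μ (cyl (o :: a ++ o :: b)) = μ (cyl (o :: a ++ [o])) * μ (cyl (o :: b)) := by
  induction hn : a.length using Nat.strong_induction_on generalizing a with
  | _ n ih =>
    by_cases ha : o ∈ a
    · obtain ⟨a1, a2, rfl, ha1⟩ : ∃ a1 a2, a = a1 ++ o :: a2 ∧ o ∉ a1 := by
        classical
        obtain ⟨s, t, h1, h2⟩ := List.eq_append_cons_of_mem ha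
        exact ⟨s, t, h1, h2⟩
      have e1 := block_prod h hr ⟨a1, ha1⟩ (a2 ++ o :: b)
      have e2 := block_prod h hr ⟨a1, ha1⟩ (a2 ++ [o])
      have e3 := ih a2.length (by rw [← hn]; simp; omega) a2 rfl
      simp only [List.append_assoc, List.cons_append] at e1 e2 e3 ⊢
      rw [e1, e2, e3, mul_assoc]
    · exact block_prod h hr ⟨a, ha⟩ b

lemma markov_prod {o : S} {μ : Measure (ℕ → S)} (h : IsExtremePE μ) (hr : RecAt o μ)
    (x y : List S) (u v : S) :
    μ (cyl (x ++ [u, v])) * μ (cyl (y ++ [u])) = μ (cyl (y ++ [u, v])) * μ (cyl (x ++ [u])) := by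
  have hs := hr.start
  by_cases hx : (x ++ [u]).head? = some o
  swap
  · rw [cyl_head_zero hs (by simp) hx, cyl_head_zero (b := x ++ [u, v]) hs (by simp)]
    · simp
    · rwa [head?_append_cons]
  by_cases hy : (y ++ [u]).head? = some o
  swap
  · rw [cyl_head_zero hs (by simp) hy, cyl_head_zero (b := y ++ [u, v]) hs (by simp)]
    · simp
    · rwa [head?_append_cons]
  rw [ret hr (x ++ [u, v]), ret hr (y ++ [u]), ret hr (y ++ [u, v]), ret hr (x ++ [u])]
  rw [← ENNReal.tsum_mul_right, ← ENNReal.tsum_mul_right]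
  refine tsum_congr (fun c => ?_)
  rw [← ENNReal.tsum_mul_left, ← ENNReal.tsum_mul_left]
  refine tsum_congr (fun d => ?_)
  have key : ∀ x y : List S, (x ++ [u]).head? = some o → (y ++ [u]).head? = some o →
      μ (cyl (x ++ [u, v] ++ c.1 ++ [o])) * μ (cyl (y ++ [u] ++ d.1 ++ [o])) =
      μ (cyl (x ++ [u, v] ++ c.1 ++ (y ++ [u] ++ d.1 ++ [o]))) := by
    intro x y hx hy
    obtain ⟨x', hx'⟩ : ∃ x', x ++ [u] = o :: x' := by
      cases x <;> simp at hx <;> simp [hx]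
    obtain ⟨y', hy'⟩ : ∃ y', y ++ [u] = o :: y' := by
      cases y <;> simp at hy <;> simp [hy]
    have e := loop_prod h hr (x' ++ [v] ++ c.1) (y' ++ d.1 ++ [o])
    have e1 : x ++ [u, v] = o :: x' ++ [v] := by rw [← hx']; simp
    rw [e1, hy']
    simp only [List.append_assoc, List.cons_append] at e ⊢
    rw [e]
  rw [key x y hx hy, key y x hy hx]
  apply h.lpe
  refine ⟨?_, ?_⟩
  · have e1 : (x ++ [u, v] ++ c.1 ++ (y ++ [u] ++ d.1 ++ [o])) =
        x ++ u :: (v :: (c.1 ++ (y ++ [u] ++ d.1 ++ [o]))) := by simp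
    have e2 : (y ++ [u, v] ++ c.1 ++ (x ++ [u] ++ d.1 ++ [o])) =
        y ++ u :: (v :: (c.1 ++ (x ++ [u] ++ d.1 ++ [o]))) := by simp
    rw [e1, e2, head?_append_cons, head?_append_cons y, hx, hy]
  · have key : ∀ x y : List S, (y ++ [u]).head? = some o →
        steps (x ++ [u, v] ++ c.1 ++ (y ++ [u] ++ d.1 ++ [o])) =
        steps (x ++ [u]) ++ (steps (u :: v :: (c.1 ++ [o])) ++
          (steps (y ++ [u]) ++ steps (u :: (d.1 ++ [o])))) := by
      intro x y hy
      obtain ⟨y', hy'⟩ : ∃ y', y ++ [u] = o :: y' := by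
        cases y <;> simp at hy <;> simp [hy]
      have e0 : x ++ [u, v] ++ c.1 ++ (y ++ [u] ++ d.1 ++ [o]) =
        x ++ u :: (v :: c.1 ++ (o :: (y' ++ d.1 ++ [o]))) := by simp [hy']
      have f1 : steps (u :: (v :: c.1 ++ (o :: (y' ++ d.1 ++ [o])))) =
          steps (u :: v :: (c.1 ++ [o])) ++ steps (o :: (y' ++ d.1 ++ [o])) :=
        steps_append (u :: v :: c.1) o _
      rw [e0, steps_append, f1]
      have e1 : o :: (y' ++ d.1 ++ [o]) = y ++ u :: (d.1 ++ [o]) := by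
        rw [← List.cons_append, ← List.cons_append, ← hy']; simp
      rw [e1, steps_append y]
    rw [key x y hy, key y x hx]
    generalize steps (x ++ [u]) = A
    generalize steps (u :: v :: (c.1 ++ [o])) = B
    generalize steps (y ++ [u]) = C
    generalize steps (u :: (d.1 ++ [o])) = D
    classical
    rw [List.perm_iff_count]
    intro e
    simp only [List.count_append]
    omega

end rec

end PartP3

section PartP4

/-! ### Recurrent Markov chains -/
section mc
variable [MeasurableSpace S] [DiscreteMeasurableSpace S] [Countable S]

lemma cyl_pre_le (n : ℕ) (y : ℕ → S) : {x : ℕ → S | ∀ i ≤ n, x i = y i} = cyl (pre y (n + 1)) := by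
  ext ω; simp [mem_cyl_pre_iff, Nat.lt_succ_iff]

lemma infinite_iff_rec (o : S) (x : ℕ → S) :
    {i : ℕ | x i = o}.Infinite ↔ ∀ n, ∃ m, n ≤ m ∧ x m = o := by
  constructor
  · intro h n
    obtain ⟨m, hm, hn⟩ := h.exists_gt n
    exact ⟨m, hn.le, hm⟩
  · intro h
    refine Set.infinite_of_not_bddAbove ?_
    rintro ⟨B, hB⟩
    obtain ⟨m, hm, hx⟩ := h (B + 1)
    have := hB (show m ∈ {i : ℕ | x i = o} from hx)
    omega

lemma measurableSet_io (o : S) : MeasurableSet {ω : ℕ → S | ∀ n, ∃ m, n ≤ m ∧ ω m = o} := by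
  have : {ω : ℕ → S | ∀ n, ∃ m, n ≤ m ∧ ω m = o} =
      ⋂ n : ℕ, ⋃ m : ℕ, {ω : ℕ → S | n ≤ m ∧ ω m ∈ ({o} : Set S)} := by
    ext ω; simp
  rw [this]
  refine MeasurableSet.iInter fun n => MeasurableSet.iUnion fun m => ?_
  by_cases h : n ≤ m
  · simpa [h] using measurableSet_coord m ({o} : Set S)
  · simp [h]

lemma RecAt.infinite {o : S} {μ : Measure (ℕ → S)} [IsProbabilityMeasure μ] (h : RecAt o μ) :
    μ {x | {i : ℕ | x i = o}.Infinite} = 1 := by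
  simp_rw [infinite_iff_rec]
  rw [← mem_ae_iff_prob_eq_one (measurableSet_io o)]
  filter_upwards [h] with ω hω using hω.2

/-- An extreme recurrent measure is the law of a Markov chain. -/
theorem ext_rec {o : S} {μ : Measure (ℕ → S)} (h : IsExtremePE μ) (hr : RecAt o μ) :
    ∃ (S' : Set S) (p : S → S → ℝ≥0∞), IsMCLaw S' p o μ ∧
      ∀ u ∈ S', ∃ x, μ (cyl (x ++ [u])) ≠ 0 := by
  classical
  have := h.prob
  set S' : Set S := {u | ∃ x, μ (cyl (x ++ [u])) ≠ 0} with hS'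
  let X : S → List S := fun u => if h : u ∈ S' then Classical.choose h else []
  have hX : ∀ u ∈ S', μ (cyl (X u ++ [u])) ≠ 0 := by
    intro u hu
    simp only [X, dif_pos hu]
    exact Classical.choose_spec hu
  let p : S → S → ℝ≥0∞ := fun u v =>
    if u ∈ S' then μ (cyl (X u ++ [u, v])) / μ (cyl (X u ++ [u])) else 0
  have hp : ∀ u ∈ S', ∀ v, p u v = μ (cyl (X u ++ [u, v])) / μ (cyl (X u ++ [u])) := by
    intro u hu v; simp only [p, if_pos hu]
  have ho : μ (cyl [o]) = 1 := by
    rw [← mem_ae_iff_prob_eq_one (measurableSet_cyl _)]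
    filter_upwards [hr] with ω hω
    exact mem_cyl_single.2 hω.1
  refine ⟨S', p, ⟨h.1.1, ⟨[], by simp [ho]⟩, ?_, ?_, ?_⟩, fun u hu => hu⟩
  · intro u hu
    refine ⟨?_, ?_⟩
    · simp_rw [hp u hu, div_eq_mul_inv]
      rw [ENNReal.tsum_mul_right]
      have := measure_cyl_split μ (X u ++ [u])
      simp only [List.append_assoc, List.cons_append, List.nil_append] at this
      rw [← this]
      exact ENNReal.mul_inv_cancel (hX u hu) (measure_ne_top _ _)
    · intro v hv
      rw [hp u hu] at hv
      refine ⟨X u ++ [u], ?_⟩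
      intro h0
      apply hv
      simp only [List.append_assoc, List.cons_append, List.nil_append] at h0
      rw [h0, ENNReal.zero_div]
  · intro u hu v; simp only [p, if_neg hu]
  · intro n y
    rw [cyl_pre_le]
    induction n with
    | zero =>
      simp only [zero_add, Finset.range_zero, Finset.prod_empty]
      have : pre y 1 = [y 0] := by simp [pre]
      rw [this]
      split_ifs with h0
      · rw [h0, ho]
      · exact cyl_head_zero hr.start (by simp) (by simpa using h0)
    | succ n ih =>
      have e1 : pre y (n + 1) = pre y n ++ [y n] := pre_succ _ _
      have e2 : pre y (n + 1 + 1) = pre y n ++ [y n, y (n + 1)] := by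
        rw [pre_succ, pre_succ]; simp
      by_cases h0 : μ (cyl (pre y (n + 1))) = 0
      · have : μ (cyl (pre y (n + 1 + 1))) = 0 := by
          refine measure_mono_null ?_ h0
          intro ω hω
          rw [pre_succ, mem_cyl_append] at hω
          exact hω.1
        rw [this]
        rw [h0] at ih
        rw [Finset.prod_range_succ]
        split_ifs with h1
        · rw [if_pos h1] at ih; rw [← ih, zero_mul]
        · rfl
      · have hyn : y n ∈ S' := ⟨pre y n, by rwa [← e1]⟩
        have key := markov_prod h hr (pre y n) (X (y n)) (y n) (y (n + 1))
        rw [← e1, ← e2] at key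
        have : μ (cyl (pre y (n + 1 + 1))) = μ (cyl (pre y (n + 1))) * p (y n) (y (n + 1)) := by
          rw [hp _ hyn, ← mul_div_assoc, mul_comm (μ (cyl (pre y (n + 1)))), ← key,
            ENNReal.mul_div_cancel_right (hX _ hyn) (measure_ne_top _ _)]
        rw [this, ih, Finset.prod_range_succ]
        split_ifs with h1
        · rfl
        · rw [zero_mul]

/-- product weight of a word -/
noncomputable def mcw (p : S → S → ℝ≥0∞) (l : List S) : ℝ≥0∞ :=
  ((steps l).map (fun e => p e.1 e.2)).prod

lemma mcw_append (p : S → S → ℝ≥0∞) (a : List S) (s : S) (b : List S) :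
    mcw p (a ++ s :: b) = mcw p (a ++ [s]) * mcw p (s :: b) := by
  rw [mcw, steps_append, List.map_append, List.prod_append]; rfl

lemma mcw_pre (p : S → S → ℝ≥0∞) (y : ℕ → S) (n : ℕ) :
    mcw p (pre y (n + 1)) = ∏ i ∈ Finset.range n, p (y i) (y (i + 1)) := by
  induction n with
  | zero => simp [mcw, pre]
  | succ n ih =>
    have e2 : pre y (n + 1 + 1) = pre y n ++ y n :: [y (n + 1)] := by
      rw [pre_succ, pre_succ]; simp
    rw [e2, mcw_append, ← pre_succ, ih, Finset.prod_range_succ]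
    simp [mcw]

open Classical in
lemma mc_cyl {S' : Set S} {p : S → S → ℝ≥0∞} {s0 : S} {ν : Measure (ℕ → S)}
    (h : IsMCLaw S' p s0 ν) (l : List S) (hl : l ≠ []) :
    ν (cyl l) = if l.head? = some s0 then mcw p l else 0 := by
  obtain ⟨x, hx⟩ := exists_pre l hl
  obtain ⟨n, hn⟩ : ∃ n, l.length = n + 1 :=
    ⟨l.length - 1, (Nat.succ_pred_eq_of_pos (List.length_pos_iff.2 hl)).symm⟩
  rw [hn] at hx
  rw [← hx, ← cyl_pre_le, h.2.2.2.2 n x, mcw_pre]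
  simp [pre_succ']

lemma mc_lpe {S' : Set S} {p : S → S → ℝ≥0∞} {s0 : S} {ν : Measure (ℕ → S)}
    (h : IsMCLaw S' p s0 ν) : LPE ν := by
  intro l l' hl
  by_cases h0 : l = []
  · have := hl.length_eq
    rw [h0, List.length_nil] at this
    rw [h0, List.length_eq_zero_iff.1 this.symm]
  · have h0' : l' ≠ [] := by
      rintro rfl
      have := hl.length_eq
      rw [List.length_nil] at this
      exact h0 (List.length_eq_zero_iff.1 this)
    rw [mc_cyl h l h0, mc_cyl h l' h0', hl.1, mcw, mcw, (hl.2.map _).prod_eq]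

lemma mc_start {S' : Set S} {p : S → S → ℝ≥0∞} {s0 : S} {ν : Measure (ℕ → S)}
    (h : IsMCLaw S' p s0 ν) : ∀ᵐ ω ∂ν, ω 0 = s0 := by
  have : IsProbabilityMeasure ν := ⟨h.1⟩
  have h1 : ν (cyl [s0]) = 1 := by rw [mc_cyl h _ (by simp)]; simp [mcw]
  rw [← mem_ae_iff_prob_eq_one (measurableSet_cyl _)] at h1
  filter_upwards [h1] with ω hω using mem_cyl_single.1 hω

lemma mc_recAt {S' : Set S} {p : S → S → ℝ≥0∞} {s0 : S} {ν : Measure (ℕ → S)}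
    (h : IsMCLaw S' p s0 ν) (hr : ν {x | {i : ℕ | x i = s0}.Infinite} = 1) : RecAt s0 ν := by
  have : IsProbabilityMeasure ν := ⟨h.1⟩
  simp_rw [infinite_iff_rec] at hr
  rw [← mem_ae_iff_prob_eq_one (measurableSet_io _)] at hr
  filter_upwards [hr, mc_start h] with ω h1 h2 using ⟨h2, h1⟩

lemma mc_states {S' : Set S} {p : S → S → ℝ≥0∞} {s0 : S} {ν : Measure (ℕ → S)}
    (h : IsMCLaw S' p s0 ν) : ∀ᵐ ω ∂ν, ∀ i, ω i ∈ S' := by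
  have key : ∀ l : List S, ∀ s : S, s ∉ S' → ν (cyl (l ++ [s])) = 0 := by
    intro l s hs
    rw [mc_cyl h _ (by simp)]
    split_ifs with h0
    · rcases List.eq_nil_or_concat l with rfl | ⟨l, t, rfl⟩
      · simp at h0; exact absurd (h0 ▸ h.2.1) hs
      · rw [List.concat_eq_append, List.append_assoc, List.singleton_append, mcw_append]
        have : p t s = 0 := by
          by_cases ht : t ∈ S'
          · by_contra hp
            exact hs ((h.2.2.1 t ht).2 s hp)
          · exact h.2.2.2.1 t ht s
        simp [mcw, this]
    · rfl
  rw [ae_all_iff]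
  intro i
  have : {ω : ℕ → S | ¬ ω i ∈ S'} ⊆ ⋃ x : {q : List S × S // q.2 ∉ S'}, cyl (x.1.1 ++ [x.1.2]) := by
    intro ω hω
    rw [mem_iUnion]
    refine ⟨⟨(pre ω i, ω i), hω⟩, ?_⟩
    rw [← pre_succ]; exact mem_cyl_pre _ _
  refine measure_mono_null this ?_
  rw [measure_iUnion_null_iff]
  intro x
  exact key _ _ x.2

/-- Regeneration for Markov chains. -/
lemma mc_aftr {S' : Set S} {p : S → S → ℝ≥0∞} {o : S} {ν : Measure (ℕ → S)}
    (h : IsMCLaw S' p o ν) (a : List S) :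
    aftr ν (o :: a) o = ν (cyl (o :: a ++ [o])) • ν := by
  have : IsProbabilityMeasure ν := ⟨h.1⟩
  apply ext_cyl
  intro b hb
  by_cases hbo : b.head? = some o
  · obtain ⟨b, rfl⟩ : ∃ b', b = o :: b' := by
      cases b with
      | nil => simp at hbo
      | cons x b => simp at hbo; exact ⟨b, by rw [hbo]⟩
    rw [aftr_cyl, Measure.smul_apply, smul_eq_mul, mc_cyl h _ (by simp), mc_cyl h _ (by simp),
      mc_cyl h _ (by simp)]
    simp only [List.cons_append, List.head?_cons, if_true]
    rw [← List.cons_append, mcw_append]; rfl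
  · rw [cyl_head_zero (aftr_start _ _ _) hb hbo, Measure.smul_apply,
      cyl_head_zero (mc_start h) hb hbo, smul_zero]

/-! ### The first return map -/

open Classical in
/-- first return time -/
noncomputable def tau (o : S) (ω : ℕ → S) : ℕ :=
  if h : ∃ n, ω (n + 1) = o then Nat.find h + 1 else 1

/-- first return map -/
noncomputable def TT (o : S) (ω : ℕ → S) : ℕ → S := shift (tau o ω) ω

lemma tau_pos (o : S) (ω : ℕ → S) : 1 ≤ tau o ω := by
  unfold tau; split_ifs <;> omega

lemma tau_cyl {o : S} {a : AW o} {ω : ℕ → S} (h : ω ∈ cyl (o :: a.1 ++ [o])) :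
    tau o ω = (o :: a.1).length := by
  classical
  rw [List.cons_append, mem_cyl_cons, mem_cyl_append, mem_cyl_iff, mem_cyl_single] at h
  obtain ⟨h0, h1, h2⟩ := h
  have hex : ∃ n, ω (n + 1) = o := ⟨a.1.length, by
    have : ω (1 + (a.1.length + 0)) = o := h2
    rwa [add_comm]⟩
  rw [tau, dif_pos hex, List.length_cons]
  congr 1
  rw [Nat.find_eq_iff]
  refine ⟨by
    have : ω (1 + (a.1.length + 0)) = o := h2
    rwa [add_comm], ?_⟩
  intro n hn hno
  have := h1 n hn
  have h3 : a.1[n] = o := by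
    rw [← this, ← hno, add_comm]; rfl
  have h4 := List.getElem_mem hn
  rw [h3] at h4
  exact a.2 h4

lemma measurable_tau (o : S) : Measurable (tau o : (ℕ → S) → ℕ) := by
  classical
  apply measurable_to_countable'
  intro k
  have : tau o ⁻¹' {k} = {ω : ℕ → S | (k = 0 → False) ∧ ((∀ i, i + 1 < k → ω (i + 1) ≠ o) ∧
      ω (k - 1 + 1) = o ∨ k = 1 ∧ ∀ i, ω (i + 1) ≠ o)} := by
    ext ω
    simp only [mem_preimage, mem_singleton_iff, mem_setOf_eq]
    constructor
    · rintro rfl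
      refine ⟨fun h => absurd (tau_pos o ω) (by omega), ?_⟩
      unfold tau
      split_ifs with h
      · left
        refine ⟨fun i hi => Nat.find_min h (by omega), ?_⟩
        exact Nat.find_spec h
      · right; exact ⟨rfl, fun i hi => h ⟨i, hi⟩⟩
    · rintro ⟨h0, ⟨h1, h2⟩ | ⟨h1, h2⟩⟩
      · unfold tau
        have hex : ∃ n, ω (n + 1) = o := ⟨_, h2⟩
        rw [dif_pos hex]
        have : Nat.find hex = k - 1 := by
          rw [Nat.find_eq_iff]
          exact ⟨h2, fun n hn => h1 n (by omega)⟩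
        rw [this]
        exact Nat.sub_add_cancel (Nat.pos_of_ne_zero h0)
      · unfold tau
        rw [dif_neg (by push Not; exact h2), h1]
  rw [this]
  have m1 : ∀ i, MeasurableSet {ω : ℕ → S | ω i ≠ o} := fun i => measurableSet_coord i {o}ᶜ
  have m2 : ∀ i, MeasurableSet {ω : ℕ → S | ω i = o} := fun i => measurableSet_coord i {o}
  refine MeasurableSet.inter (MeasurableSet.const _) (MeasurableSet.union (MeasurableSet.inter ?_
    (m2 _)) (MeasurableSet.inter (MeasurableSet.const _) ?_))
  · have e : {ω : ℕ → S | ∀ i, i + 1 < k → ω (i + 1) ≠ o} =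
        ⋂ i : ℕ, ⋂ _ : i + 1 < k, {ω : ℕ → S | ω (i + 1) ≠ o} := by ext ω; simp
    change MeasurableSet {ω : ℕ → S | ∀ i, i + 1 < k → ω (i + 1) ≠ o}
    rw [e]
    exact MeasurableSet.iInter fun i => MeasurableSet.iInter fun _ => m1 _
  · have e : {ω : ℕ → S | ∀ i, ω (i + 1) ≠ o} = ⋂ i : ℕ, {ω : ℕ → S | ω (i + 1) ≠ o} := by
      ext ω; simp
    change MeasurableSet {ω : ℕ → S | ∀ i, ω (i + 1) ≠ o}
    rw [e]
    exact MeasurableSet.iInter fun i => m1 _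

lemma measurable_TT (o : S) : Measurable (TT o : (ℕ → S) → (ℕ → S)) := by
  have : (TT o : (ℕ → S) → (ℕ → S)) = (fun q : ℕ × (ℕ → S) => shift q.1 q.2) ∘
      (fun ω => (tau o ω, ω)) := rfl
  rw [this]
  refine Measurable.comp ?_ ((measurable_tau o).prodMk measurable_id)
  exact measurable_from_prod_countable_right (fun n => measurable_shift n)

lemma TT_preserving {o : S} {μ : Measure (ℕ → S)} [IsFiniteMeasure μ] (h : LPE μ)
    (hr : RecAt o μ) : MeasurePreserving (TT o) μ μ := by
  refine ⟨measurable_TT o, ?_⟩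
  ext B hB
  rw [Measure.map_apply (measurable_TT o) hB]
  conv_rhs => rw [← stat h hr]
  rw [Measure.sum_apply _ hB]
  have h1 : μ (TT o ⁻¹' B) = μ (cyl [o] ∩ (TT o ⁻¹' B)) := by
    apply measure_congr
    filter_upwards [hr] with ω hω
    apply propext
    exact ⟨fun h => ⟨mem_cyl_single.2 hω.1, h⟩, fun h => h.2⟩
  rw [h1, ret_inter hr _ (measurable_TT o hB)]
  refine tsum_congr (fun a => ?_)
  rw [aftr, Measure.restrict_apply hB, aft_apply _ _ (hB.inter (measurableSet_cyl _))]
  congr 1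
  ext ω
  have e : [o] ++ a.1 ++ [o] = (o :: a.1) ++ [o] := by simp
  rw [e]
  constructor
  · rintro ⟨h1, h2⟩
    have ht := tau_cyl h1
    rw [mem_cyl_append] at h1
    refine ⟨h1.1, ?_, h1.2⟩
    have h3 : shift (tau o ω) ω ∈ B := h2
    rwa [ht] at h3
  · rintro ⟨h1, h2, h3⟩
    have h4 : ω ∈ cyl (o :: a.1 ++ [o]) := mem_cyl_append.2 ⟨h1, h3⟩
    refine ⟨h4, ?_⟩
    change shift (tau o ω) ω ∈ B
    rw [tau_cyl h4]; exact h2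

/-- A set invariant under the return map is invariant under erasing loops. -/
lemma TT_inv_loop {o : S} {A : Set (ℕ → S)} (hA : TT o ⁻¹' A = A) (a : List S) (ω : ℕ → S)
    (h : ω ∈ cyl (o :: a ++ [o])) : ω ∈ A ↔ shift (o :: a).length ω ∈ A := by
  induction hn : a.length using Nat.strong_induction_on generalizing a ω with
  | _ n ih =>
    have h0 : ∀ ω, TT o ω ∈ A ↔ ω ∈ A := fun ω => by
      conv_rhs => rw [← hA]
      rfl
    by_cases ha : o ∈ a
    · obtain ⟨a1, a2, rfl, ha1⟩ : ∃ a1 a2, a = a1 ++ o :: a2 ∧ o ∉ a1 :=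
        List.eq_append_cons_of_mem ha
      have e : o :: (a1 ++ o :: a2) ++ [o] = (o :: a1 ++ [o]) ++ (a2 ++ [o]) := by simp
      have e' : o :: (a1 ++ o :: a2) ++ [o] = (o :: a1) ++ (o :: a2 ++ [o]) := by simp
      have h1 := h
      rw [e, mem_cyl_append] at h1
      have h2 := h
      rw [e', mem_cyl_append] at h2
      have ht := tau_cyl (a := ⟨a1, ha1⟩) h1.1
      rw [← h0 ω, TT, ht, ih a2.length (by rw [← hn]; simp; omega) a2 _ h2.2 rfl, shift_shift]
      have e3 : (o :: a1).length + (o :: a2).length = (o :: (a1 ++ o :: a2)).length := by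
        simp only [List.length_cons, List.length_append]; omega
      rw [e3]
    · rw [← h0 ω, TT, tau_cyl (a := ⟨a, ha⟩) h]

theorem mc_ergodic {S' : Set S} {p : S → S → ℝ≥0∞} {o : S} {ν : Measure (ℕ → S)}
    (h : IsMCLaw S' p o ν) (hr : RecAt o ν) : Ergodic (TT o) ν := by
  have : IsProbabilityMeasure ν := ⟨h.1⟩
  refine { TT_preserving (mc_lpe h) hr with aeconst_set := ?_ }
  intro A hA hinv
  have key : ν.restrict A = ν A • ν := by
    apply ext_cyl
    intro b hb
    rw [Measure.restrict_apply (measurableSet_cyl _), Measure.smul_apply, smul_eq_mul]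
    by_cases hbo : b.head? = some o
    · obtain ⟨b, rfl⟩ : ∃ b', b = o :: b' := by
        cases b with
        | nil => simp at hbo
        | cons x b => simp at hbo; exact ⟨b, by rw [hbo]⟩
      rw [ret_inter hr _ hA, ret hr, ← ENNReal.tsum_mul_left]
      refine tsum_congr fun c => ?_
      have e1 : cyl (o :: b ++ c.1 ++ [o]) ∩ A =
          cyl (o :: (b ++ c.1)) ∩ shift (o :: (b ++ c.1)).length ⁻¹' (A ∩ cyl [o]) := by
        ext ω
        have e : o :: b ++ c.1 ++ [o] = (o :: (b ++ c.1)) ++ [o] := by simp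
        rw [e]
        constructor
        · rintro ⟨h1, h2⟩
          have h3 := (TT_inv_loop hinv _ _ h1).1 h2
          rw [mem_cyl_append] at h1
          exact ⟨h1.1, h3, h1.2⟩
        · rintro ⟨h1, h2, h3⟩
          have h4 := mem_cyl_append.2 ⟨h1, h3⟩
          exact ⟨h4, (TT_inv_loop hinv _ _ h4).2 h2⟩
      rw [e1, ← aft_apply _ _ (hA.inter (measurableSet_cyl _)), ← Measure.restrict_apply hA]
      have := congrArg (fun κ => κ A) (mc_aftr h (b ++ c.1))
      simp only [aftr, Measure.smul_apply, smul_eq_mul] at this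
      rw [this, mul_comm]
      simp
    · rw [cyl_head_zero (mc_start h) hb hbo, mul_zero]
      exact measure_mono_null inter_subset_left (cyl_head_zero (mc_start h) hb hbo)
  have h2 := congrArg (fun κ => κ A) key
  simp only [Measure.restrict_apply hA, inter_self, Measure.smul_apply, smul_eq_mul] at h2
  rw [Filter.eventuallyConst_set']
  by_cases h0 : ν A = 0
  · left; exact ae_eq_empty.2 h0
  · right
    have h3 : ν A * ν A = ν A * 1 := by rw [mul_one]; exact h2.symm
    have h4 := (ENNReal.mul_right_inj h0 (measure_ne_top _ _)).1 h3
    exact ae_eq_univ.2 ((prob_compl_eq_zero_iff hA).2 h4)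

/-- A recurrent Markov chain law is extreme. -/
theorem rec_le {S' : Set S} {p : S → S → ℝ≥0∞} {o : S} {ν : Measure (ℕ → S)}
    (h : IsMCLaw S' p o ν) (hr : RecAt o ν) {ρ : Measure (ℕ → S)} (hρ : LPE ρ)
    [IsFiniteMeasure ρ] (hle : ρ ≪ ν) : ρ = ρ univ • ν := by
  have : IsProbabilityMeasure ν := ⟨h.1⟩
  obtain ⟨c, hc⟩ := (mc_ergodic h hr).eq_smul_of_absolutelyContinuous
    (TT_preserving hρ (hr.ac hle)) hle
  have := congrArg (fun κ => κ univ) hc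
  simp only [Measure.smul_apply, measure_univ, smul_eq_mul, mul_one] at this
  rw [this]; exact hc

theorem recMC_extreme {ν : Measure (ℕ → S)} (h : IsRecMCLaw ν) : IsExtremePE ν := by
  obtain ⟨S', p, o, h, hr⟩ := h
  have hr := mc_recAt h hr
  have : IsProbabilityMeasure ν := ⟨h.1⟩
  refine ext_of_le h.1 (mc_lpe h) ?_
  intro ρ hρ hle
  have : IsFiniteMeasure ρ := isFiniteMeasure_of_le ν hle
  exact rec_le h hr hρ (Measure.absolutelyContinuous_of_le hle)

lemma TT_iter {o : S} (ω : ℕ → S) (k : ℕ) : ∃ m, k ≤ m ∧ (TT o)^[k] ω = shift m ω := by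
  induction k with
  | zero => exact ⟨0, le_rfl, by simp⟩
  | succ k ih =>
    obtain ⟨m, hm, he⟩ := ih
    refine ⟨m + tau o (shift m ω), by have := tau_pos o (shift m ω); omega, ?_⟩
    rw [Function.iterate_succ_apply', he, TT, shift_shift]

lemma visited_io {o : S} {μ : Measure (ℕ → S)} [IsFiniteMeasure μ] (h : LPE μ)
    (hr : RecAt o μ) (v : S) :
    ∀ᵐ ω ∂μ, (∃ i, ω i = v) → ∀ n, ∃ m, n ≤ m ∧ ω m = v := by
  set N : Set (ℕ → S) := {ω | ∀ i, ω i ≠ v} with hN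
  have hNm : MeasurableSet N := by
    simp only [hN, setOf_forall]
    exact MeasurableSet.iInter fun i => measurableSet_coord i {v}ᶜ
  have hT := TT_preserving h hr
  have hk : ∀ k, ((TT o)^[k] ⁻¹' N : Set (ℕ → S)) =ᵐ[μ] N := by
    intro k
    have hsub : N ⊆ (TT o)^[k] ⁻¹' N := by
      intro ω hω
      obtain ⟨m, -, he⟩ := TT_iter (o := o) ω k
      rw [mem_preimage, he]
      intro i; exact hω (m + i)
    exact (ae_eq_of_subset_of_measure_ge hsub
      ((hT.iterate k).measure_preimage hNm.nullMeasurableSet).le hNm.nullMeasurableSet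
      (measure_ne_top _ _)).symm
  have hk' := ae_all_iff.2 hk
  filter_upwards [hk'] with ω hω
  rintro ⟨i, hi⟩
  by_contra hcon
  push Not at hcon
  obtain ⟨n, hn⟩ := hcon
  obtain ⟨m, hm, he⟩ := TT_iter (o := o) ω n
  have h1 : ω ∈ (TT o)^[n] ⁻¹' N := by
    rw [mem_preimage, he]
    intro j; exact hn _ (by omega)
  have h2 : ω ∈ N := (hω n).mp h1
  exact h2 i hi

end mc

end PartP4

section PartP5

/-! ### Stacks (BEST correspondence) -/
section Stacks
variable {V E : Type} (dst : E → V)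

open Classical in
/-- Stacks of outgoing edges of a path started at `o`. -/
noncomputable def stk : V → List E → V → List E
  | _, [] => fun _ => []
  | o, e :: l => Function.update (stk (dst e) l) o (e :: stk (dst e) l o)

/-- End point. -/
def endp : V → List E → V
  | o, [] => o
  | _, e :: l => endp (dst e) l

/-- Following the last elements of stacks leads to `T`. -/
inductive Lead (σ : V → List E) (T : Set V) : V → Prop
  | base {u : V} (h : u ∈ T) : Lead σ T u
  | step {u : V} (e : E) (h : (σ u).getLast? = some e) (h' : Lead σ T (dst e)) : Lead σ T u

variable {dst}

lemma stk_cons_self (o : V) (e : E) (l : List E) :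
    stk dst o (e :: l) o = e :: stk dst (dst e) l o := by simp [stk]

lemma stk_cons_ne {o u : V} (h : u ≠ o) (e : E) (l : List E) :
    stk dst o (e :: l) u = stk dst (dst e) l u := by simp [stk, h]

lemma stk_injective : ∀ (l l' : List E) (o : V), stk dst o l = stk dst o l' → l = l'
  | [], [], _, _ => rfl
  | [], e :: l, o, h => by
    have := congrFun h o
    rw [stk_cons_self] at this; simp [stk] at this
  | e :: l, [], o, h => by
    have := congrFun h o
    rw [stk_cons_self] at this; simp [stk] at this
  | e :: l, e' :: l', o, h => by
    have h0 := congrFun h o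
    rw [stk_cons_self, stk_cons_self] at h0
    obtain ⟨rfl, h1⟩ := List.cons.inj h0
    congr 1
    apply stk_injective l l' (dst e)
    funext u
    by_cases hu : u = o
    · rw [hu]; exact h1
    · have := congrFun h u
      rwa [stk_cons_ne hu, stk_cons_ne hu] at this

lemma Lead.mono_T {σ : V → List E} {T T' : Set V} (hT : T ⊆ T') {u : V} (h : Lead dst σ T u) :
    Lead dst σ T' u := by
  induction h with
  | base h => exact .base (hT h)
  | step e h _ ih => exact .step e h ih

lemma Lead.congr {σ σ' : V → List E} {T : Set V}
    (hs : ∀ u, σ u ≠ [] → (σ' u).getLast? = (σ u).getLast?) {u : V} (h : Lead dst σ T u) :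
    Lead dst σ' T u := by
  induction h with
  | base h => exact .base h
  | @step u e h _ ih =>
    refine .step e ?_ ih
    rw [hs u, h]
    rintro h0; simp [h0] at h

/-- Leading into a set all of which leads to `T'`. -/
lemma Lead.trans {σ : V → List E} {T T' : Set V} {u : V} (h : Lead dst σ T u)
    (hT : ∀ x ∈ T, Lead dst σ T' x) : Lead dst σ T' u := by
  induction h with
  | base h => exact hT _ h
  | step e h _ ih => exact .step e h ih

lemma stk_lead : ∀ (l : List E) (o u : V), u = o ∨ stk dst o l u ≠ [] →
    Lead dst (stk dst o l) {endp dst o l} u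
  | [], o, u, h => by
    rcases h with h | h
    · exact .base (by simp [h, endp])
    · exact absurd rfl h
  | e :: l, o, u, h => by
    have hc : ∀ u, Lead dst (stk dst (dst e) l) {endp dst (dst e) l} u →
        Lead dst (stk dst o (e :: l)) {endp dst (dst e) l} u := by
      intro u hu
      refine hu.congr ?_
      intro v hv
      by_cases hvo : v = o
      · subst hvo
        rw [stk_cons_self]
        cases h : stk dst (dst e) l v with
        | nil => exact absurd h hv
        | cons a b => simp
      · rw [stk_cons_ne hvo]
    change Lead dst _ {endp dst (dst e) l} u
    by_cases h1 : stk dst (dst e) l u = []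
    · by_cases huo : u = o
      · subst huo
        refine .step e ?_ (hc _ (stk_lead l _ _ (Or.inl rfl)))
        rw [stk_cons_self, h1]; rfl
      · rw [stk_cons_ne huo] at h
        rcases h with h | h
        · exact absurd h huo
        · exact absurd h1 h
    · exact hc _ (stk_lead l _ _ (Or.inr h1))

open Classical in
/-- Number of entries pointing at `v`. -/
noncomputable def inN (dst : E → V) (A : Finset V) (σ : V → List E) (v : V) : ℕ :=
  ∑ u ∈ A, (σ u).countP (fun e => decide (dst e = v))

open Classical in
/-- Balance. -/
def Bal (dst : E → V) (A : Finset V) (σ : V → List E) (o z : V) : Prop :=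
  ∀ v, inN dst A σ v + (if v = o then 1 else 0) = (σ v).length + (if v = z then 1 else 0)

open Classical in
lemma inN_push {A : Finset V} {σ : V → List E} {o : V} (ho : o ∈ A) (e : E) (t : List E) (v : V) :
    inN dst A (Function.update σ o (e :: t)) v
      = inN dst A (Function.update σ o t) v + (if v = dst e then 1 else 0) := by
  unfold inN
  rw [← Finset.add_sum_erase _ _ ho, ← Finset.add_sum_erase _ _ ho]
  have h1 : ∀ s : List E, ∑ u ∈ A.erase o,
      (Function.update σ o s u).countP (fun e => decide (dst e = v)) =
      ∑ u ∈ A.erase o, (σ u).countP (fun e => decide (dst e = v)) := by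
    intro s
    refine Finset.sum_congr rfl fun u hu => ?_
    rw [Function.update_of_ne (Finset.ne_of_mem_erase hu)]
  rw [h1, h1]
  simp [List.countP_cons, eq_comm]
  ring

lemma bal_push {A : Finset V} {σ : V → List E} {o z : V} (ho : o ∈ A) (e : E) (t : List E)
    (hσ : σ o = e :: t) :
    Bal dst A σ o z ↔ Bal dst A (by classical exact Function.update σ o t) (dst e) z := by
  classical
  unfold Bal
  refine forall_congr' fun v => ?_
  have h1 : σ = Function.update σ o (e :: t) := by rw [← hσ]; simp
  have h2 := inN_push (dst := dst) (σ := σ) ho e t v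
  rw [← h1] at h2
  rw [h2]
  by_cases hv : v = o
  · subst hv
    simp [hσ]; omega
  · simp [hv]

lemma stk_bal (A : Finset V) : ∀ (l : List E) (o : V), (∀ u ∉ A, stk dst o l u = []) →
    Bal dst A (stk dst o l) o (endp dst o l)
  | [], o, _ => by
    intro v; simp only [stk, endp, inN, List.countP_nil, Finset.sum_const_zero, List.length_nil]
    congr
  | e :: l, o, h => by
    classical
    have ho : o ∈ A := by
      by_contra ho
      have := h o ho
      rw [stk_cons_self] at this; simp at this
    change Bal dst A (stk dst o (e :: l)) o (endp dst (dst e) l)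
    rw [bal_push ho e _ (stk_cons_self o e l)]
    have : (Function.update (stk dst o (e :: l)) o (stk dst (dst e) l o)) = stk dst (dst e) l := by
      funext u
      by_cases hu : u = o
      · subst hu; simp
      · simp [hu, stk_cons_ne hu]
    have h3 := stk_bal A l (dst e) (by
      intro u hu
      have h4 := h u hu
      have huo : u ≠ o := by rintro rfl; exact hu ho
      rwa [stk_cons_ne huo] at h4)
    convert h3 using 1

lemma inN_zero {A : Finset V} {σ : V → List E} {v u : V} (h : inN dst A σ v = 0) (hu : u ∈ A)
    {e : E} (he : e ∈ σ u) : dst e ≠ v := by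
  intro hv
  unfold inN at h
  rw [Finset.sum_eq_zero_iff] at h
  have := h u hu
  rw [List.countP_eq_zero] at this
  exact this e he (by simpa using hv)

lemma stk_surj (A : Finset V) (z : V) : ∀ (n : ℕ) (σ : V → List E) (o : V),
    (∑ u ∈ A, (σ u).length = n) → (∀ u ∉ A, σ u = []) → Bal dst A σ o z →
    (∀ u, σ u ≠ [] → Lead dst σ {z} u) → ∃ l, stk dst o l = σ ∧ endp dst o l = z := by
  classical
  intro n
  induction n with
  | zero =>
    intro σ o hn hA hb hl
    have hσ : ∀ u, σ u = [] := by
      intro u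
      by_cases hu : u ∈ A
      · rw [Finset.sum_eq_zero_iff] at hn
        exact List.length_eq_zero_iff.1 (hn u hu)
      · exact hA u hu
    refine ⟨[], by funext u; simp [stk, hσ], ?_⟩
    have := hb o
    by_contra hne
    have hne' : o ≠ z := hne
    simp [hσ, hne'] at this
  | succ n ih =>
    intro σ o hn hA hb hl
    cases hso : σ o with
    | nil =>
      exfalso
      have hbo := hb o
      have hoz : o = z := by
        by_contra hne
        simp [hso, hne] at hbo
      subst hoz
      simp [hso] at hbo
      have hall : ∀ u, Lead dst σ {o} u → u = o := by
        intro u hu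
        induction hu with
        | base h => exact h
        | @step u e h _ ih =>
          have hne : σ u ≠ [] := by rintro h0; simp [h0] at h
          have huA : u ∈ A := by by_contra hh; exact hne (hA u hh)
          exact absurd ih (inN_zero hbo huA (List.mem_of_getLast? h))
      have : ∑ u ∈ A, (σ u).length = 0 := by
        refine Finset.sum_eq_zero fun u _ => ?_
        by_contra hne
        have h1 : σ u ≠ [] := by rintro h0; simp [h0] at hne
        have := hall u (hl u h1)
        subst this; exact h1 hso
      omega
    | cons e t =>
      have hoA : o ∈ A := by
        by_contra hh
        have := hA o hh
        simp [hso] at this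
      set σ' := Function.update σ o t with hσ'
      have hb' : Bal dst A σ' (dst e) z := (bal_push hoA e t hso).1 hb
      have hσ'o : σ' o = t := by simp [hσ']
      have hσ'ne : ∀ u, u ≠ o → σ' u = σ u := fun u hu => by simp [hσ', hu]
      have hlen : ∑ u ∈ A, (σ' u).length = n := by
        rw [← Finset.add_sum_erase _ _ hoA] at hn ⊢
        have : ∑ u ∈ A.erase o, (σ' u).length = ∑ u ∈ A.erase o, (σ u).length :=
          Finset.sum_congr rfl fun u hu => by rw [hσ'ne u (Finset.ne_of_mem_erase hu)]
        rw [this, hσ'o]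
        rw [hso] at hn
        simp at hn; omega
      have hA' : ∀ u ∉ A, σ' u = [] := by
        intro u hu
        rw [hσ'ne u (by rintro rfl; exact hu hoA)]
        exact hA u hu
      have hl' : ∀ u, σ' u ≠ [] → Lead dst σ' {z} u := by
        by_cases ht : t = []
        · by_cases hoz : o = z
          · have : ∀ u, Lead dst σ {z} u → Lead dst σ' {z} u := by
              intro u hu
              induction hu with
              | base h => exact .base h
              | @step u e' h _ ih =>
                by_cases huz : u = z
                · exact .base (by simp [huz])
                · refine .step e' ?_ ih
                  rw [hσ'ne u (by rw [hoz]; exact huz)]; exact h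
            intro u hu
            by_cases huo : u = o
            · exact .base (by simp [huo, hoz])
            · rw [hσ'ne u huo] at hu
              exact this u (hl u hu)
          · have hin : inN dst A σ' o = 0 := by
              have := hb' o
              simp [hσ'o, ht, hoz] at this
              exact this.1
            have : ∀ u, Lead dst σ {z} u → u ≠ o → Lead dst σ' {z} u := by
              intro u hu
              induction hu with
              | base h => intro _; exact .base h
              | @step u e' h _ ih =>
                intro huo
                have hne : σ u ≠ [] := by rintro h0; simp [h0] at h
                have huA : u ∈ A := by by_contra hh; exact hne (hA u hh)
                rw [← hσ'ne u huo] at h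
                exact .step e' h (ih (inN_zero hin huA (List.mem_of_getLast? h)))
            intro u hu
            have huo : u ≠ o := by
              rintro rfl
              rw [hσ'o] at hu; exact hu ht
            rw [hσ'ne u huo] at hu
            exact this u (hl u hu) huo
        · intro u hu
          have hu' : σ u ≠ [] := by
            by_cases huo : u = o
            · subst huo; simp [hso]
            · rwa [← hσ'ne u huo]
          refine (hl u hu').congr ?_
          intro v _
          by_cases hvo : v = o
          · subst hvo
            rw [hσ'o, hso]
            cases t with
            | nil => exact absurd rfl ht
            | cons a b => simp
          · rw [hσ'ne v hvo]
      obtain ⟨l, h1, h2⟩ := ih σ' (dst e) hlen hA' hb' hl'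
      refine ⟨e :: l, ?_, h2⟩
      funext u
      by_cases huo : u = o
      · subst huo
        rw [stk_cons_self, h1, hσ'o, hso]
      · rw [stk_cons_ne huo, h1, hσ'ne u huo]

lemma inN_perm {A : Finset V} {σ σ' : V → List E} (h : ∀ u, (σ u).Perm (σ' u)) (v : V) :
    inN dst A σ v = inN dst A σ' v :=
  Finset.sum_congr rfl fun u _ => (h u).countP_eq _

lemma Bal.perm {A : Finset V} {σ σ' : V → List E} (h : ∀ u, (σ u).Perm (σ' u)) {o z : V}
    (hb : Bal dst A σ o z) : Bal dst A σ' o z := by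
  intro v
  rw [← inN_perm h v, ← (h v).length_eq]
  exact hb v

lemma stk_supp (l : List E) (o : V) : ∃ A : Finset V, ∀ u ∉ A, stk dst o l u = [] := by
  classical
  induction l generalizing o with
  | nil => exact ⟨∅, fun u _ => rfl⟩
  | cons e l ih =>
    obtain ⟨A, hA⟩ := ih (dst e)
    refine ⟨insert o A, fun u hu => ?_⟩
    simp at hu
    rw [stk_cons_ne hu.1]
    exact hA u hu.2

/-- Rearrangements of stacks of a path come from paths as soon as bottoms lead to the end. -/
lemma stk_rearr (l : List E) (o : V) (σ : V → List E) (h : ∀ u, (σ u).Perm (stk dst o l u))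
    (hl : ∀ u, σ u ≠ [] → Lead dst σ {endp dst o l} u) :
    ∃ l', stk dst o l' = σ ∧ endp dst o l' = endp dst o l := by
  obtain ⟨A, hA⟩ := stk_supp (dst := dst) l o
  refine stk_surj A _ _ σ o rfl ?_ ((stk_bal A l o hA).perm fun u => (h u).symm) hl
  intro u hu
  have := h u
  rw [hA u hu] at this
  exact List.perm_nil.1 this

/-- Targets of edges have non-empty stacks or are the end. -/
lemma stk_mem (l : List E) (o : V) {u : V} {e : E} (he : e ∈ stk dst o l u) :
    dst e = endp dst o l ∨ stk dst o l (dst e) ≠ [] := by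
  induction l generalizing o with
  | nil => simp [stk] at he
  | cons e' l ih =>
    have hmono : ∀ v, stk dst (dst e') l v ≠ [] → stk dst o (e' :: l) v ≠ [] := by
      intro v hv
      by_cases hvo : v = o
      · subst hvo; rw [stk_cons_self]; simp
      · rwa [stk_cons_ne hvo]
    have key : e ∈ stk dst (dst e') l u → dst e = endp dst o (e' :: l) ∨
        stk dst o (e' :: l) (dst e) ≠ [] := fun h => (ih _ h).imp id (hmono _)
    by_cases huo : u = o
    · subst huo
      rw [stk_cons_self] at he
      rcases List.mem_cons.1 he with rfl | he
      · cases l with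
        | nil => left; rfl
        | cons a b => right; apply hmono; rw [stk_cons_self]; simp
      · exact key he
    · rw [stk_cons_ne huo] at he; exact key he

end Stacks

/-! ### Words -/

/-- Successor stacks of the word `o :: l`. -/
noncomputable abbrev wst (o : S) (l : List S) : S → List S := stk (id : S → S) o l

lemma wst_self (o e : S) (l : List S) : wst o (e :: l) o = e :: wst e l o := stk_cons_self o e l
lemma wst_ne {o u : S} (h : u ≠ o) (e : S) (l : List S) : wst o (e :: l) u = wst e l u :=
  stk_cons_ne h e l

open Classical in
lemma count_wst (o : S) (l : List S) (u v : S) :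
    (wst o l u).count v = (steps (o :: l)).count (u, v) := by
  induction l generalizing o with
  | nil => simp [stk]
  | cons e l ih =>
    rw [steps_cons_cons, List.count_cons, ← ih]
    by_cases huo : u = o
    · subst huo
      rw [wst_self, List.count_cons]; simp
    · rw [wst_ne huo]
      have : ¬ o = u := fun h => huo h.symm
      simp [this]

lemma leqv_iff_wst (o : S) (l l' : List S) :
    LEqv (o :: l) (o :: l') ↔ ∀ u, (wst o l u).Perm (wst o l' u) := by
  classical
  constructor
  · intro h u
    rw [List.perm_iff_count]
    intro v
    rw [count_wst, count_wst]
    exact h.2.count_eq _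
  · intro h
    refine ⟨rfl, ?_⟩
    rw [List.perm_iff_count]
    rintro ⟨u, v⟩
    rw [← count_wst, ← count_wst]
    exact (h u).count_eq _

lemma endp_id (o : S) (l : List S) : (o :: l).getLast? = some (endp (id : S → S) o l) := by
  induction l generalizing o with
  | nil => rfl
  | cons e l ih => rw [List.getLast?_cons_cons, ih]; rfl

lemma endp_leqv {o : S} {l l' : List S} (h : LEqv (o :: l) (o :: l')) :
    endp (id : S → S) o l = endp (id : S → S) o l' := by
  rcases List.eq_nil_or_concat (o :: l) with h1 | ⟨a, s, h1⟩
  · simp at h1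
  rcases List.eq_nil_or_concat (o :: l') with h2 | ⟨a', s', h2⟩
  · simp at h2
  have e1 := endp_id o l
  have e2 := endp_id o l'
  rw [h1, List.concat_eq_append] at e1
  rw [h2, List.concat_eq_append] at e2
  rw [h1, h2, List.concat_eq_append, List.concat_eq_append] at h
  have := h.last_eq
  simp at e1 e2
  rw [← e1, ← e2, this]

/-- Sum along a word grouped by the stacks. -/
lemma sum_wst (A : Finset S) (f : S → S → ℝ) : ∀ (l : List S) (o : S), (∀ u ∉ A, wst o l u = []) →
    ((steps (o :: l)).map (fun p => f p.1 p.2)).sum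
      = ∑ u ∈ A, ((wst o l u).map (f u)).sum
  | [], o, _ => by simp [stk]
  | e :: l, o, h => by
    classical
    have ho : o ∈ A := by
      by_contra ho
      have := h o ho
      rw [wst_self] at this; simp at this
    have h3 := sum_wst A f l e (by
      intro u hu
      have h4 := h u hu
      have huo : u ≠ o := by rintro rfl; exact hu ho
      rwa [wst_ne huo] at h4)
    rw [steps_cons_cons, List.map_cons, List.sum_cons, h3, ← Finset.add_sum_erase _ _ ho,
      ← Finset.add_sum_erase A (fun u => ((wst o (e :: l) u).map (f u)).sum) ho, wst_self]
    simp only [List.map_cons, List.sum_cons, id]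
    rw [← add_assoc]
    congr 1
    refine Finset.sum_congr rfl fun u hu => ?_
    rw [wst_ne (Finset.ne_of_mem_erase hu)]

lemma sum_tele (f : S → ℝ) : ∀ (l : List S) (o : S),
    ((steps (o :: l)).map (fun p => f p.2 - f p.1)).sum = f (endp (id : S → S) o l) - f o
  | [], o => by simp [endp]
  | e :: l, o => by
    rw [steps_cons_cons, List.map_cons, List.sum_cons, sum_tele f l e]
    simp [endp]

end PartP5

section PartP6a

/-! ### Decomposition of stack configurations -/

/-- Word version of `Lead`. -/
abbrev WLead (σ : S → List S) (T : Set S) (u : S) : Prop := Lead (id : S → S) σ T u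

open Classical in
/-- Stacks killed at `z`. -/
noncomputable def kill (σ : S → List S) (z : S) : S → List S := Function.update σ z []

lemma kill_self (σ : S → List S) (z : S) : kill σ z z = [] := by simp [kill]
lemma kill_ne (σ : S → List S) {z u : S} (h : u ≠ z) : kill σ z u = σ u := by simp [kill, h]

lemma kill_last {σ : S → List S} {z u e : S} (h : (kill σ z u).getLast? = some e) :
    u ≠ z ∧ (σ u).getLast? = some e := by
  have : u ≠ z := by rintro rfl; simp [kill_self] at h
  rw [kill_ne σ this] at h
  exact ⟨this, h⟩

open Classical in
/-- Those vertices of `K` whose whole past is in `K`. -/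
noncomputable def PK (K : Finset S) (z : S) (σ : S → List S) : Finset S :=
  K.filter (fun v => ∀ u, WLead (kill σ z) {v} u → u ∈ K)

lemma mem_PK {K : Finset S} {z : S} {σ : S → List S} {v : S} :
    v ∈ PK K z σ ↔ v ∈ K ∧ ∀ u, WLead (kill σ z) {v} u → u ∈ K := by simp [PK]

/-- Configurations on a finite set. -/
def Cf (m : S → List S) (A : Finset S) : Set (S → List S) :=
  {σ | (∀ u ∈ A, (σ u).Perm (m u)) ∧ ∀ u ∉ A, σ u = []}

lemma perms_finite (l : List S) : {p : List S | p.Perm l}.Finite := by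
  classical
  refine (l.permutations.toFinset.finite_toSet).subset ?_
  intro p hp
  simp only [Finset.mem_coe, List.mem_toFinset, List.mem_permutations]
  exact hp

lemma Cf_finite (m : S → List S) (A : Finset S) : (Cf m A).Finite := by
  have h1 : (Set.univ.pi (fun u : A => {p : List S | p.Perm (m u)})).Finite :=
    Set.Finite.pi fun u => perms_finite _
  refine Set.Finite.of_finite_image (f := fun σ (u : A) => σ u) (h1.subset ?_) ?_
  · rintro _ ⟨σ, hσ, rfl⟩ u _
    exact hσ.1 u u.2
  · intro σ hσ σ' hσ' h
    funext u
    by_cases hu : u ∈ A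
    · exact congrFun h ⟨u, hu⟩
    · rw [hσ.2 u hu, hσ'.2 u hu]

/-- Configurations on `P` all of which lead out of `P`. -/
def Arb (m : S → List S) (P : Finset S) : Set (S → List S) :=
  {τ | τ ∈ Cf m P ∧ ∀ u ∈ P, WLead τ {x | x ∉ P} u}

lemma Arb_finite (m : S → List S) (P : Finset S) : (Arb m P).Finite :=
  (Cf_finite m P).subset fun _ h => h.1

lemma head_wst (o : S) (l : List S) : (wst o l o).head? = l.head? := by
  cases l with
  | nil => rfl
  | cons e l => rw [wst_self]; rfl

lemma mix {o z : S} {l : List S} {K P : Finset S} {m : S → List S}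
    (hz : endp (id : S → S) o l = z) (hzK : z ∉ K) (hm : ∀ u ∈ K, (wst o l u).Perm (m u))
    (hP : PK K z (wst o l) = P) {τ : S → List S} (hτ : τ ∈ Arb m P) :
    ∃ l', LEqv (o :: l) (o :: l') ∧ PK K z (wst o l') = P ∧ (∀ u ∈ P, wst o l' u = τ u) ∧
      ∀ u ∉ P, wst o l' u = wst o l u := by
  classical
  have hPK : P ⊆ K := by rw [← hP]; exact Finset.filter_subset _ _
  have hzP : z ∉ P := fun h => hzK (hPK h)
  set σ := wst o l with hσ
  set σ' : S → List S := fun u => if u ∈ P then τ u else σ u with hσ'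
  have hin : ∀ u ∈ P, σ' u = τ u := fun u hu => by simp [hσ', hu]
  have hout : ∀ u ∉ P, σ' u = σ u := fun u hu => by simp [hσ', hu]
  have closed : ∀ u, u ∉ P → u ≠ z → ∀ e, (σ u).getLast? = some e → e ∉ P := by
    intro u hu huz e he heP
    rw [← hP, mem_PK] at heP
    have hst : WLead (kill σ z) {e} u := .step e (by rw [kill_ne σ huz]; exact he) (.base rfl)
    have huK := heP.2 u hst
    rw [← hP, mem_PK] at hu
    push Not at hu
    obtain ⟨x, hx, hxK⟩ := hu huK
    exact hxK (heP.2 x (hx.trans fun y hy => by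
      rw [mem_singleton_iff.1 hy]; exact hst))
  have hA : ∀ u, Lead id σ {z} u → u ∉ P → Lead id σ' {z} u := by
    intro u hu
    induction hu with
    | base h => intro _; exact .base h
    | @step u e h _ ih =>
      intro huP
      by_cases huz : u = z
      · exact .base huz
      · exact .step e (by rw [hout u huP]; exact h) (ih (closed u huP huz e h))
  have hperm : ∀ u, (σ' u).Perm (σ u) := by
    intro u
    by_cases hu : u ∈ P
    · rw [hin u hu]
      exact (hτ.1.1 u hu).trans (hm u (hPK hu)).symm
    · rw [hout u hu]
  have hval : ∀ u, σ u ≠ [] → Lead id σ {z} u := fun u hu => by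
    rw [← hz]; exact stk_lead l o u (Or.inr hu)
  have hB : ∀ u, Lead id τ {x | x ∉ P} u → (u = z ∨ σ u ≠ []) → Lead id σ' {z} u := by
    intro u hu
    induction hu with
    | @base u h =>
      intro hx
      rcases hx with rfl | hx
      · exact .base rfl
      · exact hA u (hval u hx) h
    | @step u e h _ ih =>
      intro _
      have huP : u ∈ P := by
        by_contra hh
        rw [hτ.1.2 u hh] at h; simp at h
      refine .step e (by rw [hin u huP]; exact h) (ih ?_)
      have : e ∈ σ u := (hperm u).subset (by rw [hin u huP]; exact List.mem_of_getLast? h)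
      have := stk_mem l o this
      rw [hz] at this
      exact this
  have hval' : ∀ u, σ' u ≠ [] → Lead id σ' {z} u := by
    intro u hu
    have hu' : σ u ≠ [] := by
      intro h0; have := hperm u; rw [h0] at this; exact hu (List.perm_nil.1 this)
    by_cases huP : u ∈ P
    · exact hB u (hτ.2 u huP) (Or.inr hu')
    · exact hA u (hval u hu') huP
  obtain ⟨l', h1, h2⟩ := stk_rearr l o σ' hperm (by rw [hz]; exact hval')
  refine ⟨l', ?_, ?_, ?_, ?_⟩
  · rw [leqv_iff_wst]; intro u
    rw [wst, wst, h1]; exact (hperm u).symm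
  · change PK K z (stk id o l') = P
    rw [h1]
    ext v
    rw [mem_PK]
    constructor
    · rintro ⟨hvK, hv⟩
      by_contra hvP
      have hv' := hvP
      rw [← hP, mem_PK] at hv'
      push Not at hv'
      obtain ⟨x, hx, hxK⟩ := hv' hvK
      refine hxK (hv x ?_)
      have : ∀ y, Lead id (kill σ z) {v} y → y ∉ P → Lead id (kill σ' z) {v} y := by
        intro y hy
        induction hy with
        | base h => intro _; exact .base h
        | @step u e h _ ih =>
          intro huP
          obtain ⟨huz, h'⟩ := kill_last h
          refine .step e (by rw [kill_ne σ' huz, hout u huP]; exact h') (ih (closed u huP huz e h'))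
      exact this x hx (fun hh => hxK (hPK hh))
    · intro hv
      refine ⟨hPK hv, ?_⟩
      have : ∀ y, Lead id (kill σ' z) {v} y → y ∈ P := by
        intro y hy
        induction hy with
        | base h => rw [mem_singleton_iff.1 h]; exact hv
        | @step u e h _ ih =>
          by_contra huP
          obtain ⟨huz, h'⟩ := kill_last h
          rw [hout u huP] at h'
          exact closed u huP huz e h' ih
      intro u hu
      exact hPK (this u hu)
  · intro u hu; rw [wst, h1]; exact hin u hu
  · intro u hu; rw [wst, h1]; exact hout u hu

/-- Words of a class with given `PK` and first letter condition. -/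
def WC (o : S) (l : List S) (K : Finset S) (z : S) (P : Finset S) (Q : Option S → Prop) :
    Set (List S) :=
  {l' | LEqv (o :: l) (o :: l') ∧ PK K z (wst o l') = P ∧ Q l'.head?}

lemma LEqv.perm_tail {o : S} {l l' : List S} (h : LEqv (o :: l) (o :: l')) : l.Perm l' := by
  have := h.2.map Prod.snd
  rwa [steps_snd, steps_snd] at this

lemma WC_finite (o : S) (l : List S) (K : Finset S) (z : S) (P : Finset S) (Q : Option S → Prop) :
    (WC o l K z P Q).Finite :=
  (perms_finite l).subset fun _ h => h.1.perm_tail.symm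

lemma WC_le {o z : S} {l : List S} {K P : Finset S} {m : S → List S}
    (hz : endp (id : S → S) o l = z) (hzK : z ∉ K) (hm : ∀ u ∈ K, (wst o l u).Perm (m u))
    (ho : o ∈ P) (Q Q' : Option S → Prop) :
    (WC o l K z P Q).ncard * {τ ∈ Arb m P | Q' (τ o).head?}.ncard ≤
      (WC o l K z P Q').ncard * {τ ∈ Arb m P | Q (τ o).head?}.ncard := by
  classical
  rw [← Set.ncard_prod, ← Set.ncard_prod]
  have hex : ∀ x : List S × (S → List S), ∃ y : List S,
      x ∈ (WC o l K z P Q) ×ˢ {τ ∈ Arb m P | Q' (τ o).head?} →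
      (LEqv (o :: x.1) (o :: y) ∧ PK K z (wst o y) = P ∧ (∀ u ∈ P, wst o y u = x.2 u) ∧
      ∀ u ∉ P, wst o y u = wst o x.1 u) := by
    rintro ⟨l', τ⟩
    by_cases hx : (l', τ) ∈ (WC o l K z P Q) ×ˢ {τ ∈ Arb m P | Q' (τ o).head?}
    · obtain ⟨⟨h1, h2, h3⟩, h4, h5⟩ := hx
      obtain ⟨y, hy⟩ := mix (o := o) (z := z) (l := l') (K := K) (P := P) (m := m)
        ((endp_leqv h1).symm.trans hz) hzK
        (fun u hu => (((leqv_iff_wst o l l').1 h1 u).symm.trans (hm u hu))) h2 h4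
      exact ⟨y, fun _ => hy⟩
    · exact ⟨[], fun h => absurd h hx⟩
  choose f hf using hex
  refine Set.ncard_le_ncard_of_injOn
    (fun x => (f x, fun u => if u ∈ P then wst o x.1 u else [])) ?_ ?_ ?_
  · rintro ⟨l', τ⟩ hx
    obtain ⟨h1, h2, h3, h4⟩ := hf _ hx
    obtain ⟨⟨g1, g2, g3⟩, g4, g5⟩ := hx
    simp only [] at h1 h2 h3 h4
    have hPK : P ⊆ K := by rw [← h2]; exact Finset.filter_subset _ _
    refine ⟨⟨g1.trans h1, h2, ?_⟩, ⟨⟨?_, ?_⟩, ?_⟩, ?_⟩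
    · rw [← head_wst o, h3 o ho]; exact g5
    · intro u hu
      simp only [hu, if_true]
      exact ((leqv_iff_wst o l l').1 g1 u).symm.trans (hm u (hPK hu))
    · intro u hu
      simp [hu]
    · intro u hu
      have hne : wst o l' u ≠ [] ∨ wst o l' u = [] := (em _).symm
      have hL : Lead id (wst o l') {endp id o l'} u := by
        refine stk_lead l' o u (Or.inr ?_)
        intro h0
        have : (τ u) = [] := by
          have := (g4.1.1 u hu).trans ((hm u (hPK hu)).symm.trans ((leqv_iff_wst o l l').1 g1 u))
          rw [wst, h0] at this
          exact List.perm_nil.1 this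
        have h5 := g4.2 u hu
        cases h5 with
        | base h => exact h hu
        | step e h _ => change (τ u).getLast? = some e at h; rw [this] at h; simp at h
      have he : endp id o l' = z := (endp_leqv g1).symm.trans hz
      rw [he] at hL
      have hzP : z ∉ P := fun h => hzK (hPK h)
      have : ∀ y, Lead id (wst o l') {z} y →
          Lead id (fun u => if u ∈ P then wst o l' u else []) {x | x ∉ P} y := by
        intro y hy
        induction hy with
        | base h => exact .base (by rw [mem_singleton_iff.1 h]; exact hzP)
        | @step u e h _ ih =>
          by_cases huP : u ∈ P
          · exact .step e (by simp only [huP, if_true]; exact h) ih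
          · exact .base huP
      exact this u hL
    · simp only [ho, if_true]
      rw [head_wst]; exact g3
  · rintro ⟨l1, τ1⟩ hx1 ⟨l2, τ2⟩ hx2 heq
    obtain ⟨-, -, h3, h4⟩ := hf _ hx1
    obtain ⟨-, -, h3', h4'⟩ := hf _ hx2
    simp only [Prod.mk.injEq] at heq
    obtain ⟨e1, e2⟩ := heq
    rw [e1] at h3 h4
    have hτ : τ1 = τ2 := by
      funext u
      by_cases hu : u ∈ P
      · exact (h3 u hu).symm.trans (h3' u hu)
      · exact (hx1.2.1.1.2 u hu).trans (hx2.2.1.1.2 u hu).symm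
    have hl : l1 = l2 := by
      apply stk_injective (dst := id) l1 l2 o
      funext u
      by_cases hu : u ∈ P
      · have := congrFun e2 u
        simpa [hu] using this
      · exact (h4 u hu).symm.trans (h4' u hu)
    rw [hτ, hl]
  · exact (WC_finite _ _ _ _ _ _).prod ((Arb_finite m P).subset fun _ h => h.1)

lemma WC_eq {o z : S} {l : List S} {K P : Finset S} {m : S → List S}
    (hz : endp (id : S → S) o l = z) (hzK : z ∉ K) (hm : ∀ u ∈ K, (wst o l u).Perm (m u))
    (ho : o ∈ P) (v : S) :
    (WC o l K z P (fun a => a = some v)).ncard * (Arb m P).ncard =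
      (WC o l K z P (fun _ => True)).ncard * {τ ∈ Arb m P | (τ o).head? = some v}.ncard := by
  have h1 := WC_le hz hzK hm ho (fun a => a = some v) (fun _ => True)
  have h2 := WC_le hz hzK hm ho (fun _ => True) (fun a => a = some v)
  have h3 : {τ ∈ Arb m P | (fun _ : Option S => True) (τ o).head?} = Arb m P := by
    ext; simp
  rw [h3] at h1 h2
  exact le_antisymm h1 h2

end PartP6a

section PartP6b

/-! ### Harmonic functions and first step probabilities -/

/-- Finset of rearrangements. -/
noncomputable def pf (l : List S) : Finset (List S) := (perms_finite l).toFinset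
lemma mem_pf {l p : List S} : p ∈ pf l ↔ p.Perm l := by simp [pf]

/-- `f` of the last element. -/
noncomputable def lastf (f : S → ℝ) (p : List S) : ℝ := p.getLast?.elim 0 f

lemma sum_getElem (f : S → ℝ) (l : List S) :
    ∑ i ∈ Finset.range l.length, (l[i]?).elim 0 f = (l.map f).sum := by
  induction l with
  | nil => simp
  | cons a l ih =>
    rw [List.length_cons, Finset.sum_range_succ']
    simp [ih]; ring

lemma sum_head_rot (f : S → ℝ) (l : List S) (i : ℕ) (hi : i < l.length) :
    ∑ p ∈ pf l, (p[i]?).elim 0 f = ∑ p ∈ pf l, (p.head?).elim 0 f := by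
  refine Finset.sum_bij (fun p _ => p.rotate i) ?_ ?_ ?_ ?_
  · intro p hp
    rw [mem_pf] at hp ⊢
    exact (List.rotate_perm p i).trans hp
  · intro p _ q _ h
    exact List.rotate_injective i h
  · intro q hq
    rw [mem_pf] at hq
    refine ⟨q.rotate (q.length - i), ?_, ?_⟩
    · rw [mem_pf]; exact (List.rotate_perm q _).trans hq
    · rw [List.rotate_rotate, Nat.sub_add_cancel (by rw [hq.length_eq]; omega), List.rotate_length]
  · intro p hp
    rw [mem_pf] at hp
    rw [List.head?_rotate (by rw [hp.length_eq]; exact hi)]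

lemma sum_last_head (f : S → ℝ) (l : List S) :
    ∑ p ∈ pf l, lastf f p = ∑ p ∈ pf l, (p.head?).elim 0 f := by
  refine Finset.sum_bij (fun p _ => p.reverse) ?_ ?_ ?_ ?_
  · intro p hp
    rw [mem_pf] at hp ⊢
    exact (List.reverse_perm p).trans hp
  · intro p _ q _ h
    exact List.reverse_injective h
  · intro q hq
    rw [mem_pf] at hq
    exact ⟨q.reverse, by rw [mem_pf]; exact (List.reverse_perm q).trans hq, by simp⟩
  · intro p hp
    simp [lastf, List.head?_reverse]

lemma sum_last (f : S → ℝ) (l : List S) :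
    (∑ p ∈ pf l, lastf f p) * l.length = (pf l).card * (l.map f).sum := by
  have h1 : ∑ p ∈ pf l, (p.map f).sum = (pf l).card * (l.map f).sum := by
    rw [Finset.sum_congr rfl (fun p hp => ((mem_pf.1 hp).map f).sum_eq)]
    simp
  rw [← h1, sum_last_head]
  have h2 : ∀ p ∈ pf l, (p.map f).sum = ∑ i ∈ Finset.range l.length, (p[i]?).elim 0 f := by
    intro p hp
    rw [← (mem_pf.1 hp).length_eq, sum_getElem]
  rw [Finset.sum_congr rfl h2, Finset.sum_comm,
    Finset.sum_congr rfl (fun i hi => sum_head_rot f l i (Finset.mem_range.1 hi))]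
  simp [mul_comm]

lemma pf_card_pos (l : List S) : 0 < (pf l).card :=
  Finset.card_pos.2 ⟨l, mem_pf.2 (List.Perm.refl _)⟩

/-! Basic facts on `WLead` -/
lemma lead_det {g : S → List S} {T : Set S} (hT : ∀ x ∈ T, g x = []) {w x : S}
    (h : WLead g {w} x) (h' : WLead g T x) : WLead g T w := by
  induction h with
  | base h => rwa [← mem_singleton_iff.1 h]
  | step e h _ ih =>
    cases h' with
    | base h1 => rw [hT _ h1] at h; simp at h
    | step e' h1 h2 =>
      rw [h] at h1
      cases h1
      exact ih h2

lemma lead_acyc {g : S → List S} {T : Set S} (hT : ∀ x ∈ T, g x = []) {w : S}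
    (h : WLead g T w) : ∀ e, (g w).getLast? = some e → ¬ WLead g {w} e := by
  induction h with
  | base h => intro e he; rw [hT _ h] at he; simp at he
  | @step u e h _ ih =>
    intro e1 he1 hl
    rw [h] at he1; cases he1
    cases hl with
    | base h2 => 
      rw [mem_singleton_iff] at h2
      subst h2
      exact ih e h (.base rfl)
    | step e' h2 h3 =>
      refine ih e' h2 (h3.trans ?_)
      intro y hy
      rw [mem_singleton_iff.1 hy]
      exact .step e h (.base rfl)

open Classical in
lemma lead_upd_w {g : S → List S} {w : S} (q : List S) {x : S} (h : WLead g {w} x) :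
    WLead (Function.update g w q) {w} x := by
  induction h with
  | base h => exact .base h
  | @step u e h _ ih =>
    by_cases hu : u = w
    · exact .base hu
    · exact .step e (by rw [Function.update_of_ne hu]; exact h) ih

open Classical in
lemma lead_upd_avoid {g : S → List S} {T : Set S} {w : S} (q : List S) {x : S} (h : WLead g T x)
    (h' : ¬ WLead g {w} x) : WLead (Function.update g w q) T x := by
  induction h with
  | base h => exact .base h
  | @step u e h _ ih =>
    have hu : u ≠ w := by rintro rfl; exact h' (.base rfl)
    refine .step e (by rw [Function.update_of_ne hu]; exact h) (ih ?_)
    intro h2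
    exact h' (.step e h h2)

open Classical in
/-- Swapping in a new stack at `w` which does not lead back to `w`. -/
lemma arb_swap {m : S → List S} {A : Finset S} {w : S} (hw : w ∈ A) {g : S → List S}
    (hg : g ∈ Arb m A) {p : List S} (hp : p.Perm (m w))
    (hC : ∀ e, p.getLast? = some e → ¬ WLead g {w} e) : Function.update g w p ∈ Arb m A := by
  refine ⟨⟨?_, ?_⟩, ?_⟩
  · intro u hu
    by_cases huw : u = w
    · subst huw; simpa using hp
    · rw [Function.update_of_ne huw]; exact hg.1.1 u hu
  · intro u hu
    rw [Function.update_of_ne (by rintro rfl; exact hu hw)]; exact hg.1.2 u hu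
  · have hall : ∀ x, WLead g {x | x ∉ A} x := fun x => by
      by_cases hx : x ∈ A
      · exact hg.2 x hx
      · exact .base hx
    have hwl : WLead (Function.update g w p) {x | x ∉ A} w := by
      have hne : g w ≠ [] := by
        intro h0
        have := hg.2 w hw
        cases this with
        | base h => exact h hw
        | step e h _ => rw [h0] at h; simp at h
      have hpne : p ≠ [] := by
        intro h0
        have := hp.trans (hg.1.1 w hw).symm
        rw [h0] at this
        exact hne (List.nil_perm.1 this)
      have he := List.getLast?_eq_some_getLast hpne
      exact .step _ (by rw [Function.update_self]; exact he) (lead_upd_avoid p (hall _) (hC _ he))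
    intro u hu
    have : ∀ x, WLead g {x | x ∉ A} x → WLead (Function.update g w p) {x | x ∉ A} x := by
      intro x hx
      induction hx with
      | base h => exact .base h
      | @step u e h _ ih =>
        by_cases huw : u = w
        · rw [huw]; exact hwl
        · exact .step e (by rw [Function.update_of_ne huw]; exact h) ih
    exact this u (hg.2 u hu)

/-- Arborescences as a finset. -/
noncomputable def arb (m : S → List S) (A : Finset S) : Finset (S → List S) :=
  (Arb_finite m A).toFinset
lemma mem_arb {m : S → List S} {A : Finset S} {g : S → List S} : g ∈ arb m A ↔ g ∈ Arb m A := by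
  simp [arb]

open Classical in
/-- Number of configurations off `o` for which `x` escapes from `P`. -/
noncomputable def FP (m : S → List S) (o : S) (P : Finset S) (x : S) : ℕ :=
  ((arb m (P.erase o)).filter (fun g => WLead g {x | x ∉ P} x)).card

open Classical in
/-- Escape probability. -/
noncomputable def hP (m : S → List S) (o : S) (P : Finset S) (x : S) : ℝ :=
  FP m o P x / (arb m (P.erase o)).card

open Classical in
/-- The last letter of `p` escapes. -/
def LastL (g : S → List S) (T : Set S) (p : List S) : Prop :=
  ∃ e, p.getLast? = some e ∧ WLead g T e

open Classical in
lemma sum_FP (m : S → List S) (o : S) (P : Finset S) (D : Finset (List S)) :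
    ∑ p ∈ D, lastf (fun x => (FP m o P x : ℝ)) p =
      (((D ×ˢ arb m (P.erase o)).filter (fun q => LastL q.2 {x | x ∉ P} q.1)).card : ℝ) := by
  rw [Finset.card_filter, Finset.sum_product]
  push_cast
  refine Finset.sum_congr rfl fun p _ => ?_
  unfold lastf LastL
  cases h : p.getLast? with
  | none => simp
  | some e =>
    simp only [Option.elim, FP, Finset.card_filter]
    push_cast
    refine Finset.sum_congr rfl fun g _ => ?_
    simp

open Classical in
lemma FP_harm (m : S → List S) (o : S) (P : Finset S) {w : S} (hw : w ∈ P.erase o) :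
    ∑ p ∈ pf (m w), lastf (fun x => (FP m o P x : ℝ)) p = (pf (m w)).card * FP m o P w := by
  rw [sum_FP]
  have hwP : w ∈ P := Finset.mem_of_mem_erase hw
  have h1 : ((pf (m w)).card * FP m o P w : ℝ) =
      (((pf (m w) ×ˢ arb m (P.erase o)).filter (fun q => WLead q.2 {x | x ∉ P} w)).card : ℝ) := by
    rw [Finset.card_filter, Finset.sum_product]
    simp only [FP, Finset.card_filter, Finset.sum_const]
    simp
  rw [h1]
  norm_cast
  set i : List S × (S → List S) → List S × (S → List S) := fun q =>
    if LastL q.2 {w} q.1 then q else (q.2 w, Function.update q.2 w q.1) with hi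
  have hb : ∀ g ∈ Arb m (P.erase o), ∀ x ∈ {x | x ∉ P}, g x = [] := by
    intro g hg x hx
    exact hg.1.2 x (fun h => hx (Finset.mem_of_mem_erase h))
  have hb' : ∀ g ∈ Arb m (P.erase o), ∀ x ∈ {x | x ∉ P.erase o}, g x = [] := by
    intro g hg x hx
    exact hg.1.2 x hx
  -- after a swap, the condition fails again
  have hno : ∀ g ∈ Arb m (P.erase o), ∀ p, ¬ LastL (Function.update g w p) {w} (g w) := by
    rintro g hg p ⟨e, he, hl⟩
    have := lead_upd_w (g w) hl
    rw [Function.update_idem, Function.update_eq_self] at this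
    exact lead_acyc (hb' g hg) (hg.2 w hw) e he this
  have hinv : ∀ p g, g ∈ Arb m (P.erase o) → i (i (p, g)) = (p, g) := by
    intro p g hg
    by_cases hC : LastL g {w} p
    · simp [hi, hC]
    · have e1 : i (p, g) = (g w, Function.update g w p) := by simp [hi, hC]
      rw [e1]
      have h3 := hno g hg p
      simp [hi, h3]
  have hmem : ∀ p g, p ∈ pf (m w) → g ∈ Arb m (P.erase o) → ¬ LastL g {w} p →
      g w ∈ pf (m w) ∧ Function.update g w p ∈ Arb m (P.erase o) := by
    intro p g hp hg hC
    refine ⟨mem_pf.2 (hg.1.1 w hw), arb_swap hw hg (mem_pf.1 hp) ?_⟩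
    intro e he h
    exact hC ⟨e, he, h⟩
  refine Finset.card_bij' (fun q _ => i q) (fun q _ => i q) ?_ ?_ ?_ ?_
  · rintro ⟨p, g⟩ hq
    simp only [Finset.mem_filter, Finset.mem_product, mem_arb] at hq ⊢
    obtain ⟨⟨hp, hg⟩, e, he, hl⟩ := hq
    by_cases hC : LastL g {w} p
    · obtain ⟨e', he', hl'⟩ := id hC
      rw [he] at he'; cases he'
      have e1 : i (p, g) = (p, g) := by simp [hi, hC]
      rw [e1]
      exact ⟨⟨hp, hg⟩, lead_det (hb g hg) hl' hl⟩
    · have e1 : i (p, g) = (g w, Function.update g w p) := by simp [hi, hC]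
      rw [e1]
      refine ⟨hmem p g hp hg hC, ?_⟩
      refine .step e (by simpa using he) ?_
      exact lead_upd_avoid p hl (fun h => hC ⟨e, he, h⟩)
  · rintro ⟨p, g⟩ hq
    simp only [Finset.mem_filter, Finset.mem_product, mem_arb] at hq ⊢
    obtain ⟨⟨hp, hg⟩, hl⟩ := hq
    by_cases hC : LastL g {w} p
    · have e1 : i (p, g) = (p, g) := by simp [hi, hC]
      rw [e1]
      obtain ⟨e, he, hl'⟩ := hC
      refine ⟨⟨hp, hg⟩, e, he, hl'.trans ?_⟩
      intro y hy; rw [mem_singleton_iff.1 hy]; exact hl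
    · have e1 : i (p, g) = (g w, Function.update g w p) := by simp [hi, hC]
      rw [e1]
      refine ⟨hmem p g hp hg hC, ?_⟩
      cases hl with
      | base h => exact absurd hwP h
      | step e h h' =>
        exact ⟨e, h, lead_upd_avoid p h' (lead_acyc (hb' g hg) (hg.2 w hw) e h)⟩
  · rintro ⟨p, g⟩ hq
    simp only [Finset.mem_filter, Finset.mem_product, mem_arb] at hq
    exact hinv p g hq.1.2
  · rintro ⟨p, g⟩ hq
    simp only [Finset.mem_filter, Finset.mem_product, mem_arb] at hq
    exact hinv p g hq.1.2

end PartP6b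

section PartP6c

lemma list_sum_zero : ∀ (l : List ℝ), (∀ a ∈ l, 0 ≤ a) → l.sum = 0 → ∀ a ∈ l, a = 0
  | [], _, _, a, ha => by simp at ha
  | b :: l, h, hs, a, ha => by
    have h1 : 0 ≤ l.sum := List.sum_nonneg fun x hx => h x (List.mem_cons_of_mem _ hx)
    have h2 := h b List.mem_cons_self
    rw [List.sum_cons] at hs
    rcases List.mem_cons.1 ha with rfl | ha
    · linarith
    · exact list_sum_zero l (fun x hx => h x (List.mem_cons_of_mem _ hx)) (by linarith) a ha

lemma FP_le (m : S → List S) (o : S) (P : Finset S) (x : S) :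
    FP m o P x ≤ (by classical exact (arb m (P.erase o)).card) := by
  classical
  exact Finset.card_filter_le _ _

lemma hP_nonneg (m : S → List S) (o : S) (P : Finset S) (x : S) : 0 ≤ hP m o P x := by
  unfold hP; positivity

lemma hP_le_one (m : S → List S) (o : S) (P : Finset S) (x : S) : hP m o P x ≤ 1 := by
  unfold hP
  apply div_le_one_of_le₀ _ (by positivity)
  exact_mod_cast FP_le m o P x

open Classical in
lemma hP_out {m : S → List S} {o : S} {P : Finset S} (hne : (arb m (P.erase o)).Nonempty) {x : S}
    (hx : x ∉ P) : hP m o P x = 1 := by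
  unfold hP FP
  rw [Finset.filter_true_of_mem (fun g _ => Lead.base hx)]
  have : ((arb m (P.erase o)).card : ℝ) ≠ 0 := by
    have := Finset.card_pos.2 hne
    positivity
  exact div_self this

open Classical in
lemma hP_o {m : S → List S} {o : S} {P : Finset S} (ho : o ∈ P) : hP m o P o = 0 := by
  unfold hP FP
  rw [Finset.filter_false_of_mem]
  · simp
  · intro g hg h
    rw [mem_arb] at hg
    cases h with
    | base h => exact h ho
    | step e h _ => rw [hg.1.2 o (by simp)] at h; simp at h

lemma lastf_div (f : S → ℝ) (c : ℝ) (p : List S) :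
    lastf (fun x => f x / c) p = lastf f p / c := by
  unfold lastf; cases p.getLast? <;> simp

open Classical in
lemma hP_harm {m : S → List S} {o : S} {P : Finset S} {w : S} (hw : w ∈ P.erase o) :
    ∑ p ∈ pf (m w), lastf (hP m o P) p = (pf (m w)).card * hP m o P w := by
  have h1 : hP m o P = fun x => (FP m o P x : ℝ) / (arb m (P.erase o)).card := rfl
  rw [h1, Finset.sum_congr rfl (fun p _ => lastf_div _ _ p), ← Finset.sum_div, FP_harm m o P hw]
  ring

open Classical in
lemma hP_avg {m : S → List S} {o : S} {P : Finset S} {w : S} (hw : w ∈ P.erase o) :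
    ((m w).map (hP m o P)).sum = (m w).length * hP m o P w := by
  have h1 := sum_last (hP m o P) (m w)
  rw [hP_harm hw] at h1
  have : ((pf (m w)).card : ℝ) ≠ 0 := by
    have := pf_card_pos (m w)
    positivity
  apply mul_left_cancel₀ this
  rw [← h1]; ring

open Classical in
lemma hP_anti {m : S → List S} {o : S} {P P' : Finset S} (ho : o ∈ P) (hPP : P ⊆ P')
    (hne : (arb m (P.erase o)).Nonempty) (x : S) : hP m o P' x ≤ hP m o P x := by
  by_contra hcon
  push Not at hcon
  set d : S → ℝ := fun x => hP m o P x - hP m o P' x with hd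
  have hout : ∀ y, y ∉ P → 0 ≤ d y := by
    intro y hy
    simp only [hd]
    rw [hP_out hne hy]
    have := hP_le_one m o P' y
    linarith
  have hdo : d o = 0 := by
    simp only [hd]; rw [hP_o ho, hP_o (hPP ho)]; ring
  have hxP : x ∈ P := by
    by_contra hx
    have := hout x hx
    simp only [hd] at this; linarith
  obtain ⟨w, hwP, hwmin⟩ := Finset.exists_min_image P d ⟨x, hxP⟩
  have hwneg : d w < 0 := lt_of_le_of_lt (hwmin x hxP) (by simp only [hd]; linarith)
  have hmin : ∀ y, d w ≤ d y := by
    intro y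
    by_cases hy : y ∈ P
    · exact hwmin y hy
    · exact le_trans hwneg.le (hout y hy)
  obtain ⟨g, hg⟩ := hne
  rw [mem_arb] at hg
  have key : ∀ y, WLead g {x | x ∉ P.erase o} y → d y ≠ d w := by
    intro y hy
    induction hy with
    | @base y h =>
      intro he
      have h0 : 0 ≤ d y := by
        by_cases hyo : y = o
        · rw [hyo, hdo]
        · exact hout y (fun hh => h (Finset.mem_erase.2 ⟨hyo, hh⟩))
      linarith
    | @step u e h _ ih =>
      intro he
      apply ih
      have huA : u ∈ P.erase o := by
        by_contra hh
        rw [hg.1.2 u hh] at h; simp at h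
      have huA' : u ∈ P'.erase o := Finset.erase_subset_erase _ hPP huA
      have hsum : ((m u).map (fun y => d y - d w)).sum = 0 := by
        have h1 := hP_avg (m := m) huA
        have h2 := hP_avg (m := m) huA'
        have h3 : ((m u).map (fun y => d y - d w)).sum = ((m u).map (hP m o P)).sum
            - ((m u).map (hP m o P')).sum - (m u).length * d w := by
          simp only [hd]
          generalize m u = L
          induction L with
          | nil => simp
          | cons a L ih => simp only [List.map_cons, List.sum_cons, ih, List.length_cons]; push_cast; ring
        rw [h3, h1, h2, ← he]
        simp only [hd]; ring
      have heM : e ∈ m u := (hg.1.1 u huA).subset (List.mem_of_getLast? h)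
      have hz := list_sum_zero ((m u).map (fun y => d y - d w)) (by
        intro a ha
        simp only [List.mem_map] at ha
        obtain ⟨y, _, rfl⟩ := ha
        have := hmin y
        linarith)
      have := hz hsum (d e - d w) (List.mem_map.2 ⟨e, heM, rfl⟩)
      change d e = d w
      linarith
  refine key w ?_ rfl
  by_cases hwo : w = o
  · exact .base (by simp [hwo])
  · exact hg.2 w (Finset.mem_erase.2 ⟨hwo, hwP⟩)

/-- Feasible finite sets. -/
def Feas (m : S → List S) (o : S) (P : Finset S) : Prop :=
  o ∈ P ∧ (∀ u ∈ P, m u ≠ []) ∧ ∃ l, endp (id : S → S) o l ∉ P ∧ ∀ u ∈ P, (wst o l u).Perm (m u)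

lemma Feas.arb_ne {m : S → List S} {o : S} {P : Finset S} (h : Feas m o P) {A : Finset S}
    (hA : A ⊆ P) : (arb m A).Nonempty := by
  classical
  obtain ⟨ho, hne, l, hl, hp⟩ := h
  refine ⟨fun u => if u ∈ A then wst o l u else [], mem_arb.2 ⟨⟨?_, ?_⟩, ?_⟩⟩
  · intro u hu
    simp only [hu, if_true]; exact hp u (hA hu)
  · intro u hu; simp [hu]
  · intro u hu
    have hL : Lead id (wst o l) {endp id o l} u := by
      refine stk_lead l o u (Or.inr ?_)
      intro h0
      have := hp u (hA hu)
      rw [wst, h0] at this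
      exact hne u (hA hu) (List.nil_perm.1 this)
    have : ∀ y, Lead id (wst o l) {endp id o l} y →
        Lead id (fun u => if u ∈ A then wst o l u else []) {x | x ∉ A} y := by
      intro y hy
      induction hy with
      | base h => exact .base (by rw [mem_singleton_iff.1 h]; exact fun hh => hl (hA hh))
      | @step u e h _ ih =>
        by_cases huA : u ∈ A
        · exact .step e (by simp only [huA, if_true]; exact h) ih
        · exact .base huA
    exact this u hL

open Classical in
lemma Feas.flow {m : S → List S} {o : S} {P : Finset S} (h : Feas m o P) :
    1 ≤ ((m o).map (hP m o P)).sum := by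
  have hne := h.arb_ne (Finset.erase_subset o P)
  obtain ⟨ho, hmne, l, hl, hp⟩ := h
  obtain ⟨A0, hA0⟩ := stk_supp (dst := (id : S → S)) l o
  set A := A0 ∪ P
  have hA : ∀ u ∉ A, wst o l u = [] := fun u hu => hA0 u (fun hh => hu (Finset.mem_union_left _ hh))
  have h1 := sum_wst A (fun u x => hP m o P x - hP m o P u) l o hA
  rw [sum_tele (hP m o P) l o, hP_out hne hl, hP_o ho] at h1
  have hoA : o ∈ A := Finset.mem_union_right _ ho
  have hsub : ∀ (u : S) (L : List S), (L.map (fun x => hP m o P x - hP m o P u)).sum =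
      (L.map (hP m o P)).sum - L.length * hP m o P u := by
    intro u L
    induction L with
    | nil => simp
    | cons a L ih => simp only [List.map_cons, List.sum_cons, ih, List.length_cons]; push_cast; ring
  rw [← Finset.add_sum_erase _ _ hoA, hsub, hP_o ho, ((hp o ho).map _).sum_eq] at h1
  have h2 : ∑ u ∈ A.erase o, ((wst o l u).map (fun x => hP m o P x - hP m o P u)).sum ≤ 0 := by
    refine Finset.sum_nonpos fun u hu => ?_
    rw [hsub]
    by_cases huP : u ∈ P
    · have huE : u ∈ P.erase o := Finset.mem_erase.2 ⟨Finset.ne_of_mem_erase hu, huP⟩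
      rw [((hp u huP).map _).sum_eq, (hp u huP).length_eq, hP_avg huE]
      simp
    · rw [hP_out hne huP]
      have : ((wst o l u).map (hP m o P)).sum ≤ (wst o l u).length • (1 : ℝ) := by
        have := List.sum_le_card_nsmul ((wst o l u).map (hP m o P)) 1 (by
          intro x hx
          obtain ⟨y, _, rfl⟩ := List.mem_map.1 hx
          exact hP_le_one m o P y)
        simpa using this
      simp at this ⊢
      exact this
  linarith

open Classical in
lemma arb_card {m : S → List S} {o : S} {P : Finset S} (ho : o ∈ P) (Q : Option S → Prop) :
    ((arb m P).filter (fun τ => Q (τ o).head?)).card =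
      ((((pf (m o)).filter (fun p => Q p.head?)) ×ˢ arb m (P.erase o)).filter
        (fun q => LastL q.2 {x | x ∉ P} q.1)).card := by
  have hcong : ∀ (τ : S → List S) (p : List S) (x : S), WLead (Function.update τ o p) {x | x ∉ P.erase o} x →
      WLead τ {x | x ∉ P.erase o} x := by
    intro τ p x h
    induction h with
    | base h => exact .base h
    | @step u e h _ ih =>
      by_cases huo : u = o
      · exact .base (by simp [huo])
      · exact .step e (by rwa [Function.update_of_ne huo] at h) ih
  refine Finset.card_bij' (fun τ _ => (τ o, Function.update τ o []))
    (fun q _ => Function.update q.2 o q.1) ?_ ?_ ?_ ?_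
  · intro τ hτ
    simp only [Finset.mem_filter, Finset.mem_product, mem_arb] at hτ ⊢
    obtain ⟨hτ, hQ⟩ := hτ
    refine ⟨⟨⟨mem_pf.2 (hτ.1.1 o ho), hQ⟩, ⟨?_, ?_⟩, ?_⟩, ?_⟩
    · intro u hu
      rw [Function.update_of_ne (Finset.ne_of_mem_erase hu)]
      exact hτ.1.1 u (Finset.mem_of_mem_erase hu)
    · intro u hu
      by_cases huo : u = o
      · subst huo; simp
      · rw [Function.update_of_ne huo]
        exact hτ.1.2 u (fun hh => hu (Finset.mem_erase.2 ⟨huo, hh⟩))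
    · intro u hu
      refine hcong _ (τ o) u ?_
      rw [Function.update_idem, Function.update_eq_self]
      exact (hτ.2 u (Finset.mem_of_mem_erase hu)).mono_T
        (fun x (hx : x ∉ P) hh => hx (Finset.mem_of_mem_erase hh))
    · have h1 := hτ.2 o ho
      have hterm : ∀ x ∈ {x | x ∉ P}, τ x = [] := fun x hx => hτ.1.2 x hx
      cases h1 with
      | base h => exact absurd ho h
      | step e h h' =>
        refine ⟨e, h, lead_upd_avoid [] h' (lead_acyc hterm (hτ.2 o ho) e h)⟩
  · rintro ⟨p, g⟩ hq
    simp only [Finset.mem_filter, Finset.mem_product, mem_arb] at hq ⊢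
    obtain ⟨⟨⟨hp, hQ⟩, hg⟩, e, he, hl⟩ := hq
    have hgo : g o = [] := hg.1.2 o (by simp)
    have hup : ∀ x, WLead g {x | x ∉ P} x → WLead (Function.update g o p) {x | x ∉ P} x := by
      intro x hx
      refine hx.congr ?_
      intro u hu
      rw [Function.update_of_ne (by rintro rfl; exact hu hgo)]
    have hol : WLead (Function.update g o p) {x | x ∉ P} o :=
      .step e (by simpa using he) (hup e hl)
    refine ⟨⟨⟨?_, ?_⟩, ?_⟩, by simpa using hQ⟩
    · intro u hu
      by_cases huo : u = o
      · subst huo; simpa using mem_pf.1 hp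
      · rw [Function.update_of_ne huo]; exact hg.1.1 u (Finset.mem_erase.2 ⟨huo, hu⟩)
    · intro u hu
      rw [Function.update_of_ne (by rintro rfl; exact hu ho)]
      exact hg.1.2 u (fun hh => hu (Finset.mem_of_mem_erase hh))
    · intro u hu
      by_cases huo : u = o
      · rw [huo]; exact hol
      · have h1 : WLead (Function.update g o p) {x | x ∉ P.erase o} u := by
          refine (hg.2 u (Finset.mem_erase.2 ⟨huo, hu⟩)).congr ?_
          intro u hu
          rw [Function.update_of_ne (by rintro rfl; exact hu hgo)]
        refine h1.trans ?_
        intro x hx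
        by_cases hxo : x = o
        · rw [hxo]; exact hol
        · exact .base (fun hh => hx (Finset.mem_erase.2 ⟨hxo, hh⟩))
  · intro τ hτ; simp
  · rintro ⟨p, g⟩ hq
    simp only [Finset.mem_filter, Finset.mem_product, mem_arb] at hq
    have hgo : g o = [] := hq.1.2.1.2 o (by simp)
    simp only [Function.update_idem, Function.update_self, Prod.mk.injEq, true_and]
    rw [← hgo, Function.update_eq_self]

open Classical in
/-- First step ratio. -/
noncomputable def rP (m : S → List S) (o : S) (P : Finset S) (v : S) : ℝ :=
  (((arb m P).filter (fun τ => (τ o).head? = some v)).card : ℝ) / (arb m P).card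

open Classical in
lemma rP_eq {m : S → List S} {o : S} {P : Finset S} (h : Feas m o P) (v : S) :
    rP m o P v = (∑ p ∈ (pf (m o)).filter (fun p => p.head? = some v), lastf (hP m o P) p) /
      ∑ p ∈ pf (m o), lastf (hP m o P) p := by
  have hne := h.arb_ne (Finset.erase_subset o P)
  have hc : ((arb m (P.erase o)).card : ℝ) ≠ 0 := by
    have := Finset.card_pos.2 hne
    positivity
  have h1 : hP m o P = fun x => (FP m o P x : ℝ) / (arb m (P.erase o)).card := rfl
  have h2 := arb_card (m := m) h.1 (fun a => a = some v)
  have h3 := arb_card (m := m) h.1 (fun _ => True)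
  simp only [Finset.filter_true] at h3
  have h2' : ((arb m P).filter (fun τ => (τ o).head? = some v)).card =
      ((((pf (m o)).filter (fun p => p.head? = some v)) ×ˢ arb m (P.erase o)).filter
        (fun q => LastL q.2 {x | x ∉ P} q.1)).card := by convert h2
  rw [rP, h2', h3, ← sum_FP, ← sum_FP, h1, Finset.sum_congr rfl (fun p _ => lastf_div _ _ p),
    Finset.sum_congr (s₁ := pf (m o)) rfl (fun p _ => lastf_div _ _ p), ← Finset.sum_div,
    ← Finset.sum_div, div_div_div_cancel_right₀ hc]

lemma Feas.mono {m : S → List S} {o : S} {P P' : Finset S} (h : Feas m o P') (ho : o ∈ P)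
    (hPP : P ⊆ P') : Feas m o P := by
  obtain ⟨-, h2, l, h3, h4⟩ := h
  exact ⟨ho, fun u hu => h2 u (hPP hu), l, fun hh => h3 (hPP hh), fun u hu => h4 u (hPP hu)⟩

lemma rP_conv {m : S → List S} {o : S}
    (H : ∀ P : Finset S, o ∈ P → (∀ u ∈ P, m u ≠ []) → Feas m o P) (hmo : m o ≠ []) (v : S) :
    ∃ r : ℝ, ∀ ε > 0, ∃ Q : Finset S, o ∈ Q ∧ (∀ u ∈ Q, m u ≠ []) ∧
      ∀ P : Finset S, Q ⊆ P → (∀ u ∈ P, m u ≠ []) → |rP m o P v - r| ≤ ε := by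
  classical
  set V := {u : S // m u ≠ []}
  set o' : V := ⟨o, hmo⟩
  set PF : Finset V → Finset S := fun F => insert o (F.map (Function.Embedding.subtype _)) with hPF
  have hPFo : ∀ F, o ∈ PF F := fun F => Finset.mem_insert_self _ _
  have hPFm : ∀ F, ∀ u ∈ PF F, m u ≠ [] := by
    intro F u hu
    rcases Finset.mem_insert.1 hu with rfl | hu
    · exact hmo
    · obtain ⟨x, _, rfl⟩ := Finset.mem_map.1 hu
      exact x.2
  have hF : ∀ F, Feas m o (PF F) := fun F => H _ (hPFo F) (hPFm F)
  have hmono : Monotone PF := fun F F' h => Finset.insert_subset_insert _ (Finset.map_subset_map.2 h)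
  have hlim : ∀ x, ∃ c, Tendsto (fun F => hP m o (PF F) x) atTop (nhds c) := by
    intro x
    refine ⟨_, tendsto_atTop_ciInf (f := fun F => hP m o (PF F) x) ?_ ?_⟩
    · intro F F' h
      exact hP_anti (hPFo F) (hmono h) ((hF F).arb_ne (Finset.erase_subset _ _)) x
    · exact ⟨0, by rintro _ ⟨F, rfl⟩; exact hP_nonneg _ _ _ _⟩
  choose c hc using hlim
  have hlast : ∀ p : List S, Tendsto (fun F => lastf (hP m o (PF F)) p) atTop (nhds (lastf c p)) := by
    intro p
    unfold lastf
    cases p.getLast? with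
    | none => exact tendsto_const_nhds
    | some e => exact hc e
  have hden : ∀ F, (1 : ℝ) / (m o).length ≤ ∑ p ∈ pf (m o), lastf (hP m o (PF F)) p := by
    intro F
    have h1 := sum_last (hP m o (PF F)) (m o)
    have h2 := (hF F).flow
    have h3 : (1 : ℝ) ≤ (pf (m o)).card := by exact_mod_cast pf_card_pos (m o)
    have h4 : (0 : ℝ) < (m o).length := by exact_mod_cast List.length_pos_iff.2 hmo
    rw [div_le_iff₀ h4, h1]
    nlinarith
  have hdl : (0 : ℝ) < ∑ p ∈ pf (m o), lastf c p := by
    have h4 : (0 : ℝ) < (m o).length := by exact_mod_cast List.length_pos_iff.2 hmo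
    refine lt_of_lt_of_le (by positivity) (ge_of_tendsto (tendsto_finset_sum _ fun p _ => hlast p)
      (Eventually.of_forall hden))
  have hr : Tendsto (fun F => rP m o (PF F) v) atTop (nhds
      ((∑ p ∈ (pf (m o)).filter (fun p => p.head? = some v), lastf c p) /
      ∑ p ∈ pf (m o), lastf c p)) := by
    have : (fun F => rP m o (PF F) v) = fun F =>
      (∑ p ∈ (pf (m o)).filter (fun p => p.head? = some v), lastf (hP m o (PF F)) p) /
      ∑ p ∈ pf (m o), lastf (hP m o (PF F)) p := by
      funext F; exact rP_eq (hF F) v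
    rw [this]
    exact (tendsto_finset_sum _ fun p _ => hlast p).div (tendsto_finset_sum _ fun p _ => hlast p)
      hdl.ne'
  refine ⟨(∑ p ∈ (pf (m o)).filter (fun p => p.head? = some v), lastf c p) /
      ∑ p ∈ pf (m o), lastf c p, fun ε hε => ?_⟩
  obtain ⟨F0, hF0⟩ := eventually_atTop.1 (Metric.tendsto_nhds.1 hr ε hε)
  refine ⟨PF F0, hPFo F0, hPFm F0, fun P hQP hP => ?_⟩
  have hPe : P = PF (P.subtype (fun u => m u ≠ [])) := by
    ext u
    simp only [hPF, Finset.mem_insert, Finset.mem_map, Finset.mem_subtype]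
    constructor
    · intro hu; exact Or.inr ⟨⟨u, hP u hu⟩, hu, rfl⟩
    · rintro (rfl | ⟨x, hx, rfl⟩)
      · exact hQP (hPFo F0)
      · exact hx
  rw [hPe]
  refine (hF0 _ ?_).le
  intro x hx
  rw [Finset.mem_subtype]
  exact hQP (Finset.mem_insert_of_mem (Finset.mem_map.2 ⟨x, hx, rfl⟩))

end PartP6c

section PartP6d

/-! ### Typed trajectories -/

/-- Stacks of the first `n` steps of a trajectory. -/
noncomputable def tr (ω : ℕ → S) (n : ℕ) : S → List S := wst (ω 0) (pre (shift 1 ω) n)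

lemma tr_zero (ω : ℕ → S) (u : S) : tr ω 0 u = [] := by simp [tr, stk]

lemma tr_succ_self (ω : ℕ → S) (n : ℕ) :
    tr ω (n + 1) (ω 0) = ω 1 :: tr (shift 1 ω) n (ω 0) := by
  rw [tr, pre_succ', wst_self]; rfl

lemma tr_succ_ne (ω : ℕ → S) (n : ℕ) {u : S} (h : u ≠ ω 0) :
    tr ω (n + 1) u = tr (shift 1 ω) n u := by
  rw [tr, pre_succ', wst_ne h]; rfl

lemma endp_tr (ω : ℕ → S) (n : ℕ) : endp (id : S → S) (ω 0) (pre (shift 1 ω) n) = ω n := by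
  have h := endp_id (ω 0) (pre (shift 1 ω) n)
  rw [← pre_succ', pre_succ] at h
  simpa using h.symm

/-- Splitting the stacks at time `L`. -/
lemma tr_split (L n : ℕ) : ∀ (ω : ℕ → S) (u : S), tr ω (L + n) u = tr ω L u ++ tr (shift L ω) n u := by
  induction L with
  | zero => intro ω u; simp [tr_zero]
  | succ L ih =>
    intro ω u
    rw [show L + 1 + n = (L + n) + 1 by omega]
    by_cases hu : u = ω 0
    · subst hu
      rw [tr_succ_self, tr_succ_self, ih, shift_shift, add_comm 1 L]; rfl
    · rw [tr_succ_ne _ _ hu, tr_succ_ne _ _ hu, ih, shift_shift, add_comm 1 L]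

lemma tr_one (ω : ℕ → S) : tr ω 1 (ω 0) = [ω 1] := by
  rw [show (1 : ℕ) = 0 + 1 from rfl, tr_succ_self, tr_zero]

lemma tr_ne_nil {ω : ℕ → S} {i n : ℕ} (h : i < n) : tr ω n (ω i) ≠ [] := by
  obtain ⟨k, rfl⟩ := Nat.exists_eq_add_of_lt h
  rw [show i + k + 1 = i + (1 + k) by omega, tr_split, tr_split]
  have : shift i ω 0 = ω i := by simp [shift]
  rw [← this, tr_one]
  simp

lemma tr_mem {n : ℕ} : ∀ {ω : ℕ → S} {u e : S}, e ∈ tr ω n u → ∃ i < n, ω i = u ∧ ω (i + 1) = e := by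
  induction n with
  | zero => intro ω u e h; simp [tr_zero] at h
  | succ n ih =>
    intro ω u e h
    have key : e ∈ tr (shift 1 ω) n u → ∃ i < n + 1, ω i = u ∧ ω (i + 1) = e := by
      intro h
      obtain ⟨i, hi, h1, h2⟩ := ih h
      refine ⟨1 + i, by omega, h1, ?_⟩
      rw [← h2]; simp [shift, add_assoc]
    by_cases hu : u = ω 0
    · subst hu
      rw [tr_succ_self] at h
      rcases List.mem_cons.1 h with rfl | h
      · exact ⟨0, by omega, rfl, rfl⟩
      · exact key h
    · rw [tr_succ_ne _ _ hu] at h; exact key h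

/-- The trajectory starts at `o` and uses exactly the transitions in `m`. -/
def Typed (m : S → List S) (o : S) (ω : ℕ → S) : Prop :=
  ω 0 = o ∧ ∀ u, ∃ N, ∀ n, N ≤ n → (tr ω n u).Perm (m u)

lemma Typed.ne {m : S → List S} {o : S} {ω : ℕ → S} (h : Typed m o ω) (i : ℕ) : m (ω i) ≠ [] := by
  obtain ⟨N, hN⟩ := h.2 (ω i)
  intro h0
  have := hN (max N (i + 1)) (le_max_left _ _)
  rw [h0, List.perm_nil] at this
  exact tr_ne_nil (lt_of_lt_of_le (Nat.lt_succ_self i) (le_max_right _ _)) this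

lemma Typed.leave {m : S → List S} {o : S} {ω : ℕ → S} (h : Typed m o ω) (u : S) :
    ∃ N, ∀ n, N ≤ n → (tr ω n u).Perm (m u) ∧ ω n ≠ u := by
  obtain ⟨N, hN⟩ := h.2 u
  refine ⟨N, fun n hn => ⟨hN n hn, fun hu => ?_⟩⟩
  have h1 := (hN n hn).length_eq
  have h2 := (hN (n + 1) (by omega)).length_eq
  rw [tr_split, List.length_append, h1] at h2
  have : tr (shift n ω) 1 u ≠ [] := by
    have := tr_ne_nil (ω := shift n ω) (i := 0) (n := 1) (by omega)
    rwa [show shift n ω 0 = u by simp [shift, hu]] at this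
  have := List.length_pos_of_ne_nil this
  omega

lemma Typed.leave_fin {m : S → List S} {o : S} {ω : ℕ → S} (h : Typed m o ω) (K : Finset S) :
    ∃ N, ∀ n, N ≤ n → (∀ u ∈ K, (tr ω n u).Perm (m u)) ∧ ω n ∉ K := by
  choose N hN using h.leave
  refine ⟨K.sup N, fun n hn => ⟨fun u hu => (hN u n ((Finset.le_sup hu).trans hn)).1, fun hK => ?_⟩⟩
  exact (hN _ n ((Finset.le_sup hK).trans hn)).2 rfl

lemma Typed.feas {m : S → List S} {o : S} {ω : ℕ → S} (h : Typed m o ω) (P : Finset S)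
    (ho : o ∈ P) (hP : ∀ u ∈ P, m u ≠ []) : Feas m o P := by
  obtain ⟨N, hN⟩ := h.leave_fin P
  refine ⟨ho, hP, pre (shift 1 ω) N, ?_, ?_⟩
  · rw [← h.1, endp_tr]; exact (hN N le_rfl).2
  · intro u hu
    rw [← h.1]; exact (hN N le_rfl).1 u hu

lemma Typed.tail {m : S → List S} {o v : S} {ω : ℕ → S} (h : Typed m o ω) (hv : ω 1 = v) :
    Typed (by classical exact Function.update m o ((m o).erase v)) v (shift 1 ω) := by
  classical
  refine ⟨by simp [shift, hv], fun u => ?_⟩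
  obtain ⟨N, hN⟩ := h.2 u
  refine ⟨N, fun n hn => ?_⟩
  have := hN (n + 1) (by omega)
  by_cases hu : u = o
  · subst hu
    have h0 := h.1
    rw [← h0] at this ⊢
    rw [tr_succ_self, hv] at this
    have := this.erase v
    simp only [List.erase_cons_head] at this
    simpa using this
  · rw [tr_succ_ne _ _ (by rw [h.1]; exact hu)] at this
    convert this using 1
    simp [hu]

lemma late {ω : ℕ → S} {L N : ℕ} (hLN : L ≤ N) {q : S} (hq : ∀ n, L ≤ n → ω n ≠ q) {u : S}
    (h : WLead (kill (tr ω N) (ω N)) {q} u) : ∀ i, L ≤ i → i ≤ N → ω i ≠ u := by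
  induction h with
  | base h => intro i hi _; rw [mem_singleton_iff.1 h]; exact hq i hi
  | step e h h' ih =>
    rename_i u
    rintro i hi hiN rfl
    obtain ⟨hz, hlast⟩ := kill_last h
    have hlt : i < N := by
      rcases Nat.lt_or_eq_of_le hiN with h | h
      · exact h
      · rw [h] at hz; exact absurd rfl hz
    obtain ⟨k, rfl⟩ := Nat.exists_eq_add_of_le hLN
    rw [tr_split] at hlast
    have hne : tr (shift L ω) k (ω i) ≠ [] := by
      have := tr_ne_nil (ω := shift L ω) (i := i - L) (n := k) (by omega)
      rwa [show shift L ω (i - L) = ω i by simp [shift, Nat.add_sub_cancel' hi]] at this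
    rw [List.getLast?_append_of_ne_nil _ hne] at hlast
    obtain ⟨j, hj, -, hj2⟩ := tr_mem (List.mem_of_getLast? hlast)
    exact ih (L + (j + 1)) (by omega) (by omega) hj2

lemma late_PK {ω : ℕ → S} {L N : ℕ} (hLN : L ≤ N) {Q K : Finset S} (hQK : Q ⊆ K)
    (hq : ∀ n, L ≤ n → ω n ∉ Q) (hK : ∀ i, i < L → ω i ∈ K) :
    Q ⊆ PK K (ω N) (tr ω N) := by
  intro q hqQ
  rw [mem_PK]
  refine ⟨hQK hqQ, fun u hu => ?_⟩
  have hl := late (ω := ω) hLN (q := q) (fun n hn h => hq n hn (by rw [h]; exact hqQ)) hu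
  cases hu with
  | base h => rw [mem_singleton_iff.1 h]; exact hQK hqQ
  | step e h h' =>
    obtain ⟨hz, hlast⟩ := kill_last h
    obtain ⟨j, hj, hj1, -⟩ := tr_mem (List.mem_of_getLast? hlast)
    by_cases hjL : j < L
    · rw [← hj1]; exact hK j hjL
    · exact absurd hj1 (hl j (by omega) hj.le)

end PartP6d

section PartP6e

/-! ### Uniqueness of the law of a typed trajectory -/
lemma fiber_le {α β : Type} {f g : α → ℝ≥0∞} (G : α → β)
    (h : ∀ x, ∑' b : G ⁻¹' {x}, f b ≤ ∑' b : G ⁻¹' {x}, g b) : ∑' a, f a ≤ ∑' a, g a := by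
  rw [← ENNReal.tsum_fiberwise f G, ← ENNReal.tsum_fiberwise g G]
  exact ENNReal.tsum_le_tsum h

lemma rP_arb (m : S → List S) (o : S) (P : Finset S) (v : S) :
    rP m o P v = ({τ ∈ Arb m P | (τ o).head? = some v}.ncard : ℝ) / (Arb m P).ncard := by
  classical
  have h1 : (Arb m P) = ((arb m P : Finset _) : Set (S → List S)) := by
    ext τ; simp [mem_arb]
  have h2 : {τ ∈ Arb m P | (τ o).head? = some v} =
      (((arb m P).filter (fun τ => (τ o).head? = some v) : Finset _) : Set (S → List S)) := by
    ext τ; simp [mem_arb]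
  rw [h2, h1, Set.ncard_coe_finset, Set.ncard_coe_finset, rP]

section uniq
variable [MeasurableSpace S] [DiscreteMeasurableSpace S] [Countable S]

lemma measurableSet_pre (n : ℕ) (D : Set (List S)) : MeasurableSet {ω : ℕ → S | pre ω n ∈ D} := by
  have : {ω : ℕ → S | pre ω n ∈ D} = ⋃ l ∈ {l | l ∈ D ∧ l.length = n}, cyl l := by
    ext ω
    simp only [mem_setOf_eq, mem_iUnion, exists_prop]
    constructor
    · intro h; exact ⟨_, ⟨h, by simp⟩, mem_cyl_pre ω n⟩
    · rintro ⟨l, ⟨h, rfl⟩, h2⟩; rw [mem_cyl.1 h2]; exact h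
  rw [this]
  exact MeasurableSet.biUnion (to_countable _) fun l _ => measurableSet_cyl l

lemma ev_small {μ : Measure (ℕ → S)} [IsFiniteMeasure μ] {G : ℕ → Set (ℕ → S)}
    (hG : ∀ n, MeasurableSet (G n)) (h : ∀ᵐ ω ∂μ, ∃ n, ∀ k, n ≤ k → ω ∈ G k) {ε : ℝ≥0∞}
    (hε : 0 < ε) (n0 : ℕ) : ∃ n, n0 ≤ n ∧ μ (G n)ᶜ ≤ ε := by
  let H : ℕ → Set (ℕ → S) := fun n => ⋃ k ∈ {k | n ≤ k}, (G k)ᶜ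
  have hH : ∀ n, MeasurableSet (H n) := fun n =>
    MeasurableSet.biUnion (to_countable _) fun k _ => (hG k).compl
  have hanti : Antitone H := by
    intro a b hab
    exact biUnion_subset_biUnion_left fun k (hk : b ≤ k) => le_trans hab hk
  have h0 : μ (⋂ n, H n) = 0 := by
    rw [measure_eq_zero_iff_ae_notMem]
    filter_upwards [h] with ω hω hm
    obtain ⟨n, hn⟩ := hω
    have := mem_iInter.1 hm n
    simp only [H, mem_iUnion, mem_setOf_eq, exists_prop] at this
    obtain ⟨k, hk, h2⟩ := this
    exact h2 (hn k hk)
  have ht := tendsto_measure_iInter_atTop (μ := μ) (fun n => (hH n).nullMeasurableSet) hanti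
    ⟨0, measure_ne_top _ _⟩
  rw [h0] at ht
  obtain ⟨n, hn, hn0⟩ := ((ht.eventually (ge_mem_nhds hε)).and (eventually_ge_atTop n0)).exists
  refine ⟨n, hn0, le_trans (measure_mono ?_) hn⟩
  intro ω hω
  simp only [H, mem_iUnion, mem_setOf_eq, exists_prop]
  exact ⟨n, le_rfl, hω⟩

/-- The key comparison on a good set of words. -/
lemma good_words {μ : Measure (ℕ → S)} [IsFiniteMeasure μ] (hpe : LPE μ) {m : S → List S}
    {o v : S} {N : ℕ} {K Q : Finset S} (ho : o ∈ Q) {r ε : ℝ}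
    (hfeas : ∀ P, o ∈ P → P ⊆ K → Feas m o P)
    (hr : ∀ P, Q ⊆ P → P ⊆ K → |rP m o P v - r| ≤ ε) (D : Set (List S))
    (hD : D = {l | l.length = N ∧ endp (id : S → S) o l ∉ K ∧ (∀ u ∈ K, (wst o l u).Perm (m u)) ∧
      Q ⊆ PK K (endp (id : S → S) o l) (wst o l)}) :
    ∑' l, (D ∩ {l | l.head? = some v}).indicator (fun l => μ (cyl (o :: l))) l ≤
      ENNReal.ofReal (r + ε) * ∑' l, D.indicator (fun l => μ (cyl (o :: l))) l ∧
    ENNReal.ofReal (r - ε) * ∑' l, D.indicator (fun l => μ (cyl (o :: l))) l ≤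
      ∑' l, (D ∩ {l | l.head? = some v}).indicator (fun l => μ (cyl (o :: l))) l := by
  classical
  let g : List S → Set (List S) := fun l =>
    WC o l K (endp (id : S → S) o l) (PK K (endp (id : S → S) o l) (wst o l)) (fun _ => True)
  let G : List S → Set (List S) := fun l => if l ∈ D then g l else ∅
  set f1 := D.indicator (fun l => μ (cyl (o :: l))) with hf1
  set f2 := (D ∩ {l | l.head? = some v}).indicator (fun l => μ (cyl (o :: l))) with hf2
  have hmemg : ∀ l, l ∈ g l := fun l => ⟨LEqv.refl _, rfl, trivial⟩
  have hsubD : ∀ l ∈ D, ∀ l' ∈ g l, l' ∈ D ∧ g l' = g l := by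
    intro l hl l' hl'
    obtain ⟨h1, h2, -⟩ := hl'
    have he := endp_leqv h1
    have hw := (leqv_iff_wst _ _ _).1 h1
    rw [hD] at hl ⊢
    obtain ⟨a1, a2, a3, a4⟩ := hl
    refine ⟨⟨?_, ?_, ?_, ?_⟩, ?_⟩
    · have := h1.length_eq; simp at this; omega
    · rw [← he]; exact a2
    · intro u hu; exact (hw u).symm.trans (a3 u hu)
    · rw [← he, h2]; exact a4
    · ext l''
      simp only [g, WC, mem_setOf_eq]
      rw [← he, h2]
      constructor
      · rintro ⟨b1, b2, -⟩; exact ⟨h1.trans b1, b2, trivial⟩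
      · rintro ⟨b1, b2, -⟩; exact ⟨h1.symm.trans b1, b2, trivial⟩
  have hfib : ∀ x, (∑' b : G ⁻¹' {x}, f1 b = 0 ∧ ∑' b : G ⁻¹' {x}, f2 b = 0) ∨
      ∃ P, Q ⊆ P ∧ P ⊆ K ∧
        ∑' b : G ⁻¹' {x}, f2 b = ENNReal.ofReal (rP m o P v) * ∑' b : G ⁻¹' {x}, f1 b := by
    intro x
    by_cases hx : ∃ l ∈ D, x = g l
    · right
      obtain ⟨l, hl, rfl⟩ := hx
      have hl0 := hl
      rw [hD] at hl
      obtain ⟨a1, a2, a3, a4⟩ := hl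
      set z := endp (id : S → S) o l with hz
      set P := PK K z (wst o l) with hP
      have hPK : P ⊆ K := Finset.filter_subset _ _
      refine ⟨P, a4, hPK, ?_⟩
      have hG : G ⁻¹' {g l} = g l := by
        ext l'
        simp only [mem_preimage, mem_singleton_iff, G]
        by_cases hl' : l' ∈ D
        · simp only [hl', if_true]
          constructor
          · intro h; rw [← h]; exact hmemg l'
          · intro h; exact (hsubD l hl0 l' h).2
        · simp only [hl', if_false]
          constructor
          · intro h; have := hmemg l; rw [← h] at this; exact absurd this (by simp)
          · intro h; exact absurd (hsubD l hl0 l' h).1 hl'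
      rw [hG]
      have e1 : ∑' b : g l, f1 b = (g l).encard * μ (cyl (o :: l)) := by
        rw [← ENNReal.tsum_set_const]
        refine tsum_congr fun b => ?_
        rw [hf1, indicator_of_mem (hsubD l hl0 b b.2).1]
        exact hpe _ _ b.2.1.symm
      set Wv := WC o l K z P (fun a => a = some v) with hWv
      have e2 : ∑' b : g l, f2 b = Wv.encard * μ (cyl (o :: l)) := by
        rw [← ENNReal.tsum_set_const, tsum_subtype (g l) f2, tsum_subtype Wv (fun _ => μ (cyl (o :: l)))]
        refine tsum_congr fun b => ?_
        by_cases hb : b ∈ Wv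
        · have hbg : b ∈ g l := ⟨hb.1, hb.2.1, trivial⟩
          rw [indicator_of_mem hb, indicator_of_mem hbg, hf2,
            indicator_of_mem (show b ∈ D ∩ {l | l.head? = some v} from
              ⟨(hsubD l hl0 b hbg).1, hb.2.2⟩)]
          exact hpe _ _ hb.1.symm
        · rw [indicator_of_notMem hb]
          by_cases hbg : b ∈ g l
          · rw [indicator_of_mem hbg, hf2, indicator_of_notMem]
            rintro ⟨-, h⟩
            exact hb ⟨hbg.1, hbg.2.1, h⟩
          · rw [indicator_of_notMem hbg]
      have hwc := WC_eq (P := P) (m := m) hz.symm a2 a3 (a4 ho) v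
      have hne : (Arb m P).ncard ≠ 0 := by
        obtain ⟨τ, hτ⟩ := (hfeas P (a4 ho) hPK).arb_ne (Finset.Subset.refl P)
        rw [Ne, Set.ncard_eq_zero (Arb_finite m P)]
        intro h0
        rw [mem_arb, h0] at hτ; exact hτ
      rw [e1, e2, ← mul_assoc]
      congr 1
      have hg : g l = WC o l K z P (fun _ => True) := rfl
      rw [hg, ← (WC_finite o l K z P _).cast_ncard_eq, ← (WC_finite o l K z P _).cast_ncard_eq]
      simp only [ENat.toENNReal_coe]
      rw [rP_arb]
      have : (((WC o l K z P (fun a => a = some v)).ncard : ℕ) : ℝ) =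
          ({τ ∈ Arb m P | (τ o).head? = some v}.ncard : ℝ) / (Arb m P).ncard *
            ((WC o l K z P (fun _ => True)).ncard : ℝ) := by
        have h3 : ((Arb m P).ncard : ℝ) ≠ 0 := by exact_mod_cast hne
        field_simp
        have h4 := congrArg (Nat.cast (R := ℝ)) hwc
        push_cast at h4
        linarith
      rw [← ENNReal.ofReal_natCast, this, ENNReal.ofReal_mul (by positivity), ENNReal.ofReal_natCast]
    · left
      have h0 : ∀ b : G ⁻¹' {x}, (b : List S) ∉ D := by
        rintro ⟨b, hb⟩ hbD
        apply hx
        refine ⟨b, hbD, ?_⟩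
        simp only [mem_preimage, mem_singleton_iff, G, hbD, if_true] at hb
        exact hb.symm
      constructor
      · rw [ENNReal.tsum_eq_zero]
        intro b; rw [hf1, indicator_of_notMem (h0 b)]
      · rw [ENNReal.tsum_eq_zero]
        intro b; rw [hf2, indicator_of_notMem (fun h => h0 b h.1)]
  constructor
  · rw [← ENNReal.tsum_mul_left]
    apply fiber_le G
    intro x
    rw [ENNReal.tsum_mul_left]
    rcases hfib x with ⟨h1, h2⟩ | ⟨P, h1, h2, h3⟩
    · rw [h2]; exact bot_le
    · rw [h3]
      gcongr
      have := abs_le.1 (hr P h1 h2); linarith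
  · rw [← ENNReal.tsum_mul_left]
    apply fiber_le G
    intro x
    rw [ENNReal.tsum_mul_left]
    rcases hfib x with ⟨h1, h2⟩ | ⟨P, h1, h2, h3⟩
    · rw [h1]; simp
    · rw [h3]
      gcongr
      have := abs_le.1 (hr P h1 h2); linarith

lemma words_measure (μ : Measure (ℕ → S)) (o : S) (N : ℕ) (D : Set (List S))
    (hD : ∀ l ∈ D, l.length = N) :
    μ {ω | ω 0 = o ∧ pre (shift 1 ω) N ∈ D} = ∑' l, D.indicator (fun l => μ (cyl (o :: l))) l := by
  rw [← tsum_subtype, ← measure_biUnion (f := fun l => cyl (o :: l)) (to_countable D)]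
  · congr 1
    ext ω
    simp only [mem_setOf_eq, mem_iUnion, exists_prop, mem_cyl_cons]
    constructor
    · rintro ⟨h1, h2⟩; exact ⟨_, h2, h1, mem_cyl_pre _ _⟩
    · rintro ⟨l, h1, h2, h3⟩
      refine ⟨h2, ?_⟩
      rw [← hD l h1, mem_cyl.1 h3]; exact h1
  · intro l hl l' hl' hne
    rw [Function.onFun, Set.disjoint_left]
    intro ω h h'
    apply hne
    rw [mem_cyl_cons] at h h'
    rw [← mem_cyl.1 h.2, ← mem_cyl.1 h'.2, hD l hl, hD l' hl']
  · intro l _; exact measurableSet_cyl _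

lemma first_step_eps {μ : Measure (ℕ → S)} [IsFiniteMeasure μ] (hpe : LPE μ) {m : S → List S}
    {o v : S} (ht : ∀ᵐ ω ∂μ, Typed m o ω) (hne : ∃ ω, Typed m o ω) {r : ℝ} {ε : ℝ} (hε : 0 < ε)
    {Q : Finset S} (ho : o ∈ Q) (hQ : ∀ u ∈ Q, m u ≠ [])
    (hr : ∀ P, Q ⊆ P → (∀ u ∈ P, m u ≠ []) → |rP m o P v - r| ≤ ε) :
    |μ.real (cyl [o, v]) - r * μ.real univ| ≤ ε * (3 + μ.real univ + 3 * |r|) := by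
  classical
  obtain ⟨ω₀, hω₀⟩ := hne
  have hE : 0 < ENNReal.ofReal ε := ENNReal.ofReal_pos.2 hε
  -- time after which `Q` is not visited
  have m1 : ∀ L, MeasurableSet {ω : ℕ → S | ∀ n, L ≤ n → ω n ∉ Q} := by
    intro L
    have : {ω : ℕ → S | ∀ n, L ≤ n → ω n ∉ Q} = ⋂ n ∈ {n | L ≤ n}, {ω | ω n ∈ {u | u ∉ Q}} := by
      ext ω; simp
    rw [this]
    exact MeasurableSet.biInter (to_countable _) fun n _ => measurableSet_coord n _
  obtain ⟨L, -, hL⟩ := ev_small (μ := μ) m1 (by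
    filter_upwards [ht] with ω hω
    obtain ⟨N, hN⟩ := hω.leave_fin Q
    exact ⟨N, fun k hk n hn => (hN n (hk.trans hn)).2⟩) hE 0
  -- the finite set `K`
  have enc : Encodable S := Encodable.ofCountable S
  have hfin : ∀ k : ℕ, {u : S | Encodable.encode u ≤ k ∧ m u ≠ []}.Finite := fun k =>
    ((finite_le_nat k).preimage (Encodable.encode_injective.injOn)).subset fun u hu => hu.1
  let Kk : ℕ → Finset S := fun k => Q ∪ (hfin k).toFinset
  have m2 : ∀ k, MeasurableSet {ω : ℕ → S | ∀ i, i < L → ω i ∈ Kk k} := by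
    intro k
    have : {ω : ℕ → S | ∀ i, i < L → ω i ∈ Kk k} =
        ⋂ n ∈ {n | n < L}, {ω | ω n ∈ {u | u ∈ Kk k}} := by
      ext ω; simp
    rw [this]
    exact MeasurableSet.biInter (to_countable _) fun n _ => measurableSet_coord n _
  obtain ⟨k, -, hk⟩ := ev_small (μ := μ) m2 (by
    filter_upwards [ht] with ω hω
    refine ⟨(Finset.range L).sup (fun i => Encodable.encode (ω i)), fun k hk i hi => ?_⟩
    apply Finset.mem_union_right
    rw [Set.Finite.mem_toFinset]
    refine ⟨le_trans ?_ hk, hω.ne i⟩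
    exact Finset.le_sup (f := fun i => Encodable.encode (ω i)) (Finset.mem_range.2 hi)) hE 0
  set K := Kk k with hK
  have hKne : ∀ u ∈ K, m u ≠ [] := by
    intro u hu
    rcases Finset.mem_union.1 hu with h | h
    · exact hQ u h
    · rw [Set.Finite.mem_toFinset] at h; exact h.2
  have hQK : Q ⊆ K := Finset.subset_union_left
  -- the time `N`
  let RN : ℕ → Set (List S) := fun n => {l | ∃ a t, l = a :: t ∧ 
    (∀ u ∈ K, (wst a t u).Perm (m u)) ∧ endp (id : S → S) a t ∉ K}
  obtain ⟨N, hN1, hN⟩ := ev_small (μ := μ) (G := fun n => {ω | pre ω (n + 1) ∈ RN n})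
    (fun n => measurableSet_pre _ _) (by
    filter_upwards [ht] with ω hω
    obtain ⟨N, hN⟩ := hω.leave_fin K
    refine ⟨N, fun k hk => ⟨_, _, pre_succ' ω k, ?_⟩⟩
    rw [endp_tr]
    exact hN k hk) hE (max L 1)
  have hLN : L ≤ N := (le_max_left _ _).trans hN1
  have h1N : 1 ≤ N := (le_max_right _ _).trans hN1
  set D : Set (List S) := {l | l.length = N ∧ endp (id : S → S) o l ∉ K ∧
    (∀ u ∈ K, (wst o l u).Perm (m u)) ∧ Q ⊆ PK K (endp (id : S → S) o l) (wst o l)} with hD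
  obtain ⟨g1, g2⟩ := good_words hpe (v := v) (N := N) ho (r := r) (ε := ε)
    (fun P h1 h2 => hω₀.feas P h1 fun u hu => hKne u (h2 hu))
    (fun P h1 h2 => hr P h1 fun u hu => hKne u (h2 hu)) D hD
  rw [← words_measure μ o N D (fun l hl => hl.1),
    ← words_measure μ o N _ (fun l hl => hl.1.1)] at g1 g2
  set A := {ω : ℕ → S | ω 0 = o ∧ pre (shift 1 ω) N ∈ D} with hA
  have hAv : {ω : ℕ → S | ω 0 = o ∧ pre (shift 1 ω) N ∈ D ∩ {l | l.head? = some v}} =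
      A ∩ cyl [o, v] := by
    ext ω
    obtain ⟨n, rfl⟩ : ∃ n, N = n + 1 := ⟨N - 1, by omega⟩
    have : (pre (shift 1 ω) (n + 1)).head? = some (ω 1) := by rw [pre_succ']; rfl
    have h2 : shift 1 ω 0 = ω 1 := rfl
    simp only [mem_setOf_eq, mem_inter_iff, this, hA, mem_cyl_cons, mem_cyl_single, h2,
      Option.some.injEq, cyl_nil, mem_univ, and_true]
    tauto
  rw [hAv] at g1 g2
  have hAm : MeasurableSet A := by
    have : A = {ω | pre ω (N + 1) ∈ (List.cons o) '' D} := by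
      ext ω
      simp only [hA, mem_setOf_eq, pre_succ', mem_image, List.cons.injEq]
      constructor
      · rintro ⟨h1, h2⟩; exact ⟨_, h2, h1.symm, rfl⟩
      · rintro ⟨l, h1, h2, rfl⟩; exact ⟨h2.symm, h1⟩
    rw [this]; exact measurableSet_pre _ _
  have hAc : μ.real Aᶜ ≤ 3 * ε := by
    have h1 : μ Aᶜ ≤ ENNReal.ofReal ε + ENNReal.ofReal ε + ENNReal.ofReal ε := by
      have hsub : μ Aᶜ ≤ μ ({ω : ℕ → S | ∀ n, L ≤ n → ω n ∉ Q}ᶜ ∪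
          {ω : ℕ → S | ∀ i, i < L → ω i ∈ Kk k}ᶜ ∪ {ω | pre ω (N + 1) ∈ RN N}ᶜ) := by
        apply measure_mono_ae
        filter_upwards [ht] with ω hω hωA
        by_contra hcon
        have hcon : ω ∉ ({ω : ℕ → S | ∀ n, L ≤ n → ω n ∉ Q}ᶜ ∪
          {ω : ℕ → S | ∀ i, i < L → ω i ∈ Kk k}ᶜ ∪ {ω | pre ω (N + 1) ∈ RN N}ᶜ) := hcon
        simp only [mem_union, mem_compl_iff, not_or, not_not] at hcon
        obtain ⟨⟨b1, b2⟩, b3⟩ := hcon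
        apply hωA
        obtain ⟨a, t, b4, b5, b6⟩ := b3
        rw [pre_succ'] at b4
        obtain ⟨rfl, rfl⟩ := List.cons.inj b4
        refine ⟨hω.1, by simp, ?_, ?_, ?_⟩
        · rw [← hω.1]; exact b6
        · rw [← hω.1]; exact b5
        · have := late_PK hLN hQK b1 b2
          rw [← hω.1, endp_tr]; exact this
      refine hsub.trans ((measure_union_le _ _).trans (add_le_add ((measure_union_le _ _).trans
        (add_le_add hL hk)) hN))
    rw [← ENNReal.ofReal_add hε.le hε.le, ← ENNReal.ofReal_add (by linarith) hε.le] at h1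
    have := ENNReal.toReal_mono ENNReal.ofReal_ne_top h1
    rw [ENNReal.toReal_ofReal (by linarith)] at this
    change (μ Aᶜ).toReal ≤ _
    linarith
  have hrε : 0 ≤ r + ε := by
    have h1 := abs_le.1 (hr Q (Finset.Subset.refl _) hQ)
    have h2 : 0 ≤ rP m o Q v := by rw [rP_arb]; positivity
    linarith
  have k1 : μ.real (A ∩ cyl [o, v]) ≤ (r + ε) * μ.real A := by
    have := ENNReal.toReal_mono (ENNReal.mul_ne_top ENNReal.ofReal_ne_top (measure_ne_top _ _)) g1
    rwa [ENNReal.toReal_mul, ENNReal.toReal_ofReal hrε] at this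
  have k2 : (r - ε) * μ.real A ≤ μ.real (A ∩ cyl [o, v]) := by
    have := ENNReal.toReal_mono (measure_ne_top _ _) g2
    rw [ENNReal.toReal_mul] at this
    refine le_trans ?_ this
    apply mul_le_mul_of_nonneg_right _ ENNReal.toReal_nonneg
    rw [ENNReal.toReal_ofReal']; exact le_max_left _ _
  have k3 : μ.real A + μ.real Aᶜ = μ.real univ := measureReal_add_measureReal_compl hAm
  have k4 : μ.real (A ∩ cyl [o, v]) ≤ μ.real (cyl [o, v]) := measureReal_mono inter_subset_right
  have k5 : μ.real (cyl [o, v]) ≤ μ.real (A ∩ cyl [o, v]) + μ.real Aᶜ := by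
    refine le_trans (measureReal_mono ?_) (measureReal_union_le _ _)
    intro ω hω
    by_cases h : ω ∈ A
    · exact Or.inl ⟨h, hω⟩
    · exact Or.inr h
  have k6 : 0 ≤ μ.real A := measureReal_nonneg
  have k7 : 0 ≤ μ.real Aᶜ := measureReal_nonneg
  have k8 : |r * μ.real Aᶜ| ≤ 3 * |r| * ε := by
    rw [abs_mul, abs_of_nonneg k7]
    nlinarith [abs_nonneg r]
  have k9 := abs_le.1 k8
  rw [abs_le, ← k3]
  constructor
  · nlinarith
  · nlinarith

lemma first_step (m : S → List S) (o v : S) : ∃ r : ℝ, ∀ μ : Measure (ℕ → S), IsFiniteMeasure μ →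
    LPE μ → (∀ᵐ ω ∂μ, Typed m o ω) → μ.real (cyl [o, v]) = r * μ.real univ := by
  by_cases hne : ∃ ω, Typed m o ω
  · obtain ⟨ω₀, hω₀⟩ := id hne
    obtain ⟨r, hr⟩ := rP_conv (m := m) (o := o) (fun P h1 h2 => hω₀.feas P h1 h2)
      (by have := hω₀.ne 0; rwa [hω₀.1] at this) v
    refine ⟨r, fun μ _ hpe ht => ?_⟩
    have key : ∀ ε : ℝ, 0 < ε →
        |μ.real (cyl [o, v]) - r * μ.real univ| ≤ ε * (3 + μ.real univ + 3 * |r|) := by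
      intro ε hε
      obtain ⟨Q, h1, h2, h3⟩ := hr ε hε
      exact first_step_eps hpe ht hne hε h1 h2 h3
    have hC : 0 < 3 + μ.real univ + 3 * |r| := by
      have : 0 ≤ μ.real (univ : Set (ℕ → S)) := measureReal_nonneg
      positivity
    have : |μ.real (cyl [o, v]) - r * μ.real univ| ≤ 0 := by
      apply le_of_forall_pos_le_add
      intro δ hδ
      have := key (δ / (3 + μ.real univ + 3 * |r|)) (by positivity)
      rw [div_mul_cancel₀ _ hC.ne'] at this
      linarith
    have := abs_eq_zero.1 (le_antisymm this (abs_nonneg _))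
    linarith
  · refine ⟨0, fun μ _ hpe ht => ?_⟩
    have : μ = 0 := by
      rw [← Measure.measure_univ_eq_zero, measure_eq_zero_iff_ae_notMem]
      filter_upwards [ht] with ω hω
      exact absurd ⟨ω, hω⟩ hne
    simp [this]

lemma aftr_ae {μ : Measure (ℕ → S)} {a : List S} {o : S} {P : (ℕ → S) → Prop}
    (hP : MeasurableSet {ω | P ω})
    (h : ∀ᵐ ω ∂μ, ω ∈ cyl (a ++ [o]) → P (shift a.length ω)) : ∀ᵐ ω ∂(aftr μ a o), P ω := by
  rw [aftr, ae_restrict_iff' (measurableSet_cyl _), ae_iff]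
  have hm : MeasurableSet {ω : ℕ → S | ¬(ω ∈ cyl [o] → P ω)} := by
    have : {ω : ℕ → S | ¬(ω ∈ cyl [o] → P ω)} = cyl [o] ∩ {ω | P ω}ᶜ := by
      ext ω; simp
    rw [this]; exact (measurableSet_cyl _).inter hP.compl
  rw [aft_apply _ _ hm, measure_eq_zero_iff_ae_notMem]
  filter_upwards [h] with ω hω
  rintro ⟨h1, h2⟩
  apply h2
  intro h3
  exact hω (mem_cyl_append.2 ⟨h1, h3⟩)

lemma measurableSet_typed (m : S → List S) (o : S) : MeasurableSet {ω : ℕ → S | Typed m o ω} := by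
  have : {ω : ℕ → S | Typed m o ω} = cyl [o] ∩ ⋂ u : S, ⋃ N : ℕ, ⋂ n : ℕ, ⋂ _ : N ≤ n,
      {ω : ℕ → S | pre ω (n + 1) ∈ {l | ∃ a t, l = a :: t ∧ (wst a t u).Perm (m u)}} := by
    ext ω
    simp only [Typed, mem_setOf_eq, mem_inter_iff, mem_cyl_single, mem_iInter, mem_iUnion]
    refine and_congr_right fun _ => forall_congr' fun u => exists_congr fun N =>
      forall_congr' fun n => forall_congr' fun _ => ?_
    rw [pre_succ']
    constructor
    · intro h; exact ⟨_, _, rfl, h⟩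
    · rintro ⟨a, t, h1, h2⟩
      obtain ⟨rfl, rfl⟩ := List.cons.inj h1
      exact h2
  rw [this]
  exact (measurableSet_cyl _).inter (MeasurableSet.iInter fun u => MeasurableSet.iUnion fun N =>
    MeasurableSet.iInter fun n => MeasurableSet.iInter fun _ => measurableSet_pre _ _)

lemma typed_unique_cyl (l : List S) : ∀ (m : S → List S) (o : S) (μ μ' : Measure (ℕ → S))
    (_ : IsFiniteMeasure μ) (_ : IsFiniteMeasure μ'), LPE μ → LPE μ' → (∀ᵐ ω ∂μ, Typed m o ω) →
    (∀ᵐ ω ∂μ', Typed m o ω) → μ univ = μ' univ → μ (cyl (o :: l)) = μ' (cyl (o :: l)) := by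
  induction l with
  | nil =>
    intro m o μ μ' _ _ _ _ h1 h2 hu
    have : ∀ κ : Measure (ℕ → S), (∀ᵐ ω ∂κ, Typed m o ω) → κ (cyl [o]) = κ univ := by
      intro κ h
      apply measure_congr
      filter_upwards [h] with ω hω
      apply propext
      exact ⟨fun _ => trivial, fun _ => mem_cyl_single.2 hω.1⟩
    rw [this μ h1, this μ' h2, hu]
  | cons v l ih =>
    intro m o μ μ' hf hf' hpe hpe' h1 h2 hu
    classical
    rw [show o :: v :: l = [o] ++ v :: l from rfl, ← aftr_cyl, ← aftr_cyl]
    have hty : ∀ κ : Measure (ℕ → S), (∀ᵐ ω ∂κ, Typed m o ω) →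
        ∀ᵐ ω ∂(aftr κ [o] v), Typed (Function.update m o ((m o).erase v)) v ω := by
      intro κ h
      apply aftr_ae (measurableSet_typed _ _)
      filter_upwards [h] with ω hω hm
      have hm := mem_cyl_iff.1 hm 1 (by simp)
      change Typed _ v (shift 1 ω)
      convert hω.tail (v := v) (by simpa using hm)
    refine ih _ v (aftr μ [o] v) (aftr μ' [o] v) inferInstance inferInstance (aftr_lpe hpe _ _)
      (aftr_lpe hpe' _ _) (hty μ h1) (hty μ' h2) ?_
    have huniv : ∀ κ : Measure (ℕ → S), aftr κ [o] v univ = κ (cyl [o, v]) := by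
      intro κ
      have h3 := aftr_cyl κ [o] [] v
      rw [show [o] ++ [v] = [o, v] from rfl] at h3
      rw [← h3]
      apply measure_congr
      filter_upwards [aftr_start κ [o] v] with ω hω
      apply propext
      exact ⟨fun _ => mem_cyl_single.2 hω, fun _ => trivial⟩
    rw [huniv, huniv]
    obtain ⟨r, hr⟩ := first_step m o v
    have e1 := hr μ hf hpe h1
    have e2 := hr μ' hf' hpe' h2
    rw [measureReal_def, measureReal_def] at e1 e2
    rw [← hu, ← e1] at e2
    exact ((ENNReal.toReal_eq_toReal_iff' (measure_ne_top _ _) (measure_ne_top _ _)).1 e2).symm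

lemma typed_unique {m : S → List S} {o : S} {μ μ' : Measure (ℕ → S)}
    [IsFiniteMeasure μ] [IsFiniteMeasure μ'] (hpe : LPE μ) (hpe' : LPE μ')
    (h1 : ∀ᵐ ω ∂μ, Typed m o ω) (h2 : ∀ᵐ ω ∂μ', Typed m o ω) (hu : μ univ = μ' univ) : μ = μ' := by
  apply ext_cyl
  intro l hl
  cases l with
  | nil => exact absurd rfl hl
  | cons a l =>
    by_cases ha : a = o
    · subst ha
      exact typed_unique_cyl l m a μ μ' inferInstance inferInstance hpe hpe' h1 h2 hu
    · rw [cyl_head_zero (o := o) (by filter_upwards [h1] with ω h using h.1) hl (by simpa using ha),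
        cyl_head_zero (o := o) (by filter_upwards [h2] with ω h using h.1) hl (by simpa using ha)]
end uniq

end PartP6e

section PartP6f

section
variable [MeasurableSpace S] [DiscreteMeasurableSpace S] [Countable S]
lemma typed_extreme {m : S → List S} {o : S} {μ : Measure (ℕ → S)} (h1 : μ univ = 1)
    (hpe : LPE μ) (ht : ∀ᵐ ω ∂μ, Typed m o ω) : IsExtremePE μ := by
  refine ext_of_le h1 hpe fun ρ hρ hle => ?_
  have : IsFiniteMeasure μ := ⟨by simp [h1]⟩
  have hρu : ρ univ ≤ 1 := by rw [← h1]; exact hle univ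
  have : IsFiniteMeasure ρ := ⟨lt_of_le_of_lt hρu ENNReal.one_lt_top⟩
  have hac : ρ ≪ μ := Measure.absolutelyContinuous_of_le hle
  have : IsFiniteMeasure (ρ univ • μ) := ⟨by
    simp only [Measure.smul_apply, smul_eq_mul, h1, mul_one]; exact measure_lt_top _ _⟩
  refine typed_unique hρ (lpe_smul hpe _) (hac.ae_le ht) ?_ (by simp [h1])
  exact Measure.ae_smul_measure ht _
end

end PartP6f

section PartP7a

/-! ### Gibbs measures give extreme points -/

lemma perm_equiv {α : Type} {n : ℕ} {f g : Fin n → α} (h : (List.ofFn f).Perm (List.ofFn g)) :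
    ∃ σ : Equiv.Perm (Fin n), ∀ i, g i = f (σ i) := by
  classical
  have hc : ∀ (f : Fin n → α) (a : α), Fintype.card {i // f i = a} = (List.ofFn f).count a := by
    intro f a
    rw [Fintype.card_subtype, ← Multiset.coe_count, ← Fin.univ_val_map, Multiset.count_map,
      Finset.card, Finset.filter_val]
    congr 1
    apply Multiset.filter_congr
    intro x _; exact eq_comm
  have e : ∀ a, Nonempty ({i // g i = a} ≃ {i // f i = a}) := by
    intro a
    rw [← Fintype.card_eq, hc, hc]
    exact (h.count_eq a).symm
  refine ⟨Equiv.ofFiberEquiv (f := g) (g := f) (fun a => (e a).some), fun i => ?_⟩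
  exact (Equiv.ofFiberEquiv_map (f := g) (g := f) (fun a => (e a).some) i).symm

lemma steps_pre (x : ℕ → S) (n : ℕ) :
    steps (pre x (n + 1)) = List.ofFn (fun i : Fin n => (x i, x (i + 1))) := by
  induction n with
  | zero => simp [pre]
  | succ n ih =>
    rw [pre_succ, pre_succ, List.append_assoc]
    change steps (pre x n ++ x n :: [x (n + 1)]) = _
    rw [steps_append, ← pre_succ, ih, List.ofFn_succ', List.concat_eq_append]
    simp

lemma exists_perm_of_leqv {x y : ℕ → S} {n : ℕ} (h : LEqv (pre x (n + 1)) (pre y (n + 1))) :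
    x 0 = y 0 ∧ ∃ σ : Equiv.Perm (Fin n), ∀ i : Fin n, y i = x (σ i) ∧ y (i + 1) = x (σ i + 1) := by
  refine ⟨?_, ?_⟩
  · have := h.1
    rw [pre_succ', pre_succ'] at this
    simpa using this
  · have := h.2
    rw [steps_pre, steps_pre] at this
    obtain ⟨σ, hσ⟩ := perm_equiv this
    exact ⟨σ, fun i => Prod.ext_iff.1 (hσ i)⟩

lemma perm_extend {E κ : Type} (key : E → κ) : ∀ (n : ℕ) (w w' : Fin n → E), Function.Injective w →
    Function.Injective w' → (∀ i, key (w i) = key (w' i)) →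
    ∃ φ : Equiv.Perm E, (∀ e, key (φ e) = key e) ∧ ∀ i, φ (w i) = w' i := by
  classical
  intro n
  induction n with
  | zero => intro w w' _ _ _; exact ⟨1, fun e => rfl, fun i => i.elim0⟩
  | succ n ih =>
    intro w w' hw hw' hk
    obtain ⟨φ, h1, h2⟩ := ih (fun i => w i.castSucc) (fun i => w' i.castSucc)
      (fun i j h => Fin.castSucc_injective _ (hw h)) (fun i j h => Fin.castSucc_injective _ (hw' h))
      (fun i => hk _)
    set a := φ (w (Fin.last n)) with ha
    set b := w' (Fin.last n) with hb
    refine ⟨φ.trans (Equiv.swap a b), fun e => ?_, fun i => ?_⟩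
    · have hab : key a = key b := by rw [ha, h1, hk]
      rw [Equiv.trans_apply, ← h1 e]
      by_cases e1 : φ e = a
      · rw [e1, Equiv.swap_apply_left, hab]
      · by_cases e2 : φ e = b
        · rw [e2, Equiv.swap_apply_right, hab]
        · rw [Equiv.swap_apply_of_ne_of_ne e1 e2]
    · rw [Equiv.trans_apply]
      refine Fin.lastCases ?_ (fun i => ?_) i
      · rw [← ha, Equiv.swap_apply_left]
      · rw [Equiv.swap_apply_of_ne_of_ne]
        · exact h2 i
        · rw [ha]; intro h
          have := hw (φ.injective h)
          exact absurd this (Fin.castSucc_lt_last i).ne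
        · rw [h2 i, hb]; intro h
          exact absurd (hw' h) (Fin.castSucc_lt_last i).ne

/-- Measurable type of an edge. -/
def mk1 {E : Type} [MeasurableSpace E] (e : E) : Set (Set E) := {M | MeasurableSet M ∧ e ∈ M}

lemma mk1_meas {E : Type} [MeasurableSpace E] [Countable E] (e0 : E) :
    MeasurableSet {e : E | mk1 e = mk1 e0} := by
  have hsep : ∀ e : E, mk1 e ≠ mk1 e0 → ∃ M : Set E, MeasurableSet M ∧ e0 ∈ M ∧ e ∉ M := by
    intro e he
    by_contra hcon
    push Not at hcon
    apply he
    ext M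
    constructor
    · rintro ⟨hM, heM⟩
      refine ⟨hM, ?_⟩
      by_contra h
      exact hcon Mᶜ hM.compl h heM
    · rintro ⟨hM, heM⟩
      exact ⟨hM, hcon M hM heM⟩
  choose! M hM using hsep
  have : {e : E | mk1 e = mk1 e0} = ⋂ e ∈ {e | mk1 e ≠ mk1 e0}, M e := by
    ext e
    simp only [mem_setOf_eq, mem_iInter]
    constructor
    · intro h e' he'
      have h1 : M e' ∈ mk1 e0 := ⟨(hM e' he').1, (hM e' he').2.1⟩
      rw [← h] at h1; exact h1.2
    · intro h
      by_contra hne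
      exact (hM e hne).2.2 (h e hne)
  rw [this]
  exact MeasurableSet.biInter (to_countable _) fun e he => (hM e he).1

lemma saturated {E : Type} [MeasurableSpace E] {γ γ' : ℕ → E} (h : ∀ i, mk1 (γ i) = mk1 (γ' i))
    {M : Set (ℕ → E)} (hM : MeasurableSet M) : γ ∈ M ↔ γ' ∈ M := by
  let ms : MeasurableSpace (ℕ → E) :=
    { MeasurableSet' := fun M => (γ ∈ M ↔ γ' ∈ M)
      measurableSet_empty := Iff.rfl
      measurableSet_compl := fun s hs => not_congr hs
      measurableSet_iUnion := fun f hf => by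
        simp only [mem_iUnion]; exact exists_congr hf }
  have hle : (MeasurableSpace.pi : MeasurableSpace (ℕ → E)) ≤ ms := by
    refine iSup_le fun i => ?_
    rintro _ ⟨t, ht, rfl⟩
    change (γ i ∈ t ↔ γ' i ∈ t)
    constructor
    · intro h1
      have : t ∈ mk1 (γ i) := ⟨ht, h1⟩
      rw [h i] at this; exact this.2
    · intro h1
      have : t ∈ mk1 (γ' i) := ⟨ht, h1⟩
      rw [← h i] at this; exact this.2
  exact hle M hM

section gibbs
variable [MeasurableSpace S] [DiscreteMeasurableSpace S] [Countable S]
variable {Vs : Set S} {E : Type} [MeasurableSpace E] [Countable E]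
variable {G : DigraphStruct (↥Vs) E} {o : ↥Vs} {μp : Measure (ℕ → E)}

/-- Eulerian paths from `o` to infinity. -/
def EP (G : DigraphStruct (↥Vs) E) (o : ↥Vs) : Set (ℕ → E) :=
  {γ | (∀ i : ℕ, G.dst (γ i) = G.src (γ (i + 1))) ∧ G.src (γ 0) = o ∧ Function.Bijective γ}

/-- Vertex sequence. -/
def vs (G : DigraphStruct (↥Vs) E) (γ : ℕ → E) (i : ℕ) : S := (G.src (γ i) : S)

/-- class cylinder -/
def ccyl (n : ℕ) (w : Fin n → E) : Set (ℕ → E) := {γ | ∀ i : Fin n, mk1 (γ i) = mk1 (w i)}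

/-- vertices cylinder -/
def vcyl (G : DigraphStruct (↥Vs) E) (n : ℕ) (x : ℕ → S) : Set (ℕ → E) :=
  {γ | ∀ i ≤ n, vs G γ i = x i}

/-- Fine cylinder intersected with paths. -/
def fcyl (G : DigraphStruct (↥Vs) E) (o : ↥Vs) (n : ℕ) (w : Fin n → E) : Set (ℕ → E) :=
  {γ | (∀ i : Fin n, γ i = w i) ∧ γ ∈ EP G o}

lemma coarse_eq {n : ℕ} {x : ℕ → S} {w : Fin n → E} (hw : Function.Injective w)
    (hsrc : ∀ i : Fin n, (G.src (w i) : S) = x i) (hdst : ∀ i : Fin n, (G.dst (w i) : S) = x (i + 1))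
    (hx : x 0 = o) :
    μp (ccyl n w ∩ (vcyl G n x ∩ EP G o)) = μp (fcyl G o n w) := by
  apply le_antisymm
  · rw [← measure_toMeasurable (fcyl G o n w)]
    apply measure_mono
    rintro γ ⟨h1, h2, h3⟩
    obtain ⟨φ, hφ1, hφ2⟩ := perm_extend (fun e => (mk1 e, G.src e, G.dst e)) n
      (fun i => γ i) w (fun i j h => Fin.ext (h3.2.2.1 h)) hw (by
        intro i
        refine Prod.ext (h1 i) (Prod.ext ?_ ?_)
        · apply Subtype.ext
          rw [hsrc i]; exact h2 i i.2.le
        · apply Subtype.ext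
          rw [hdst i]
          have := h2 (i + 1) i.2
          rw [← this, vs, ← h3.1])
    have hmem : (fun i => φ (γ i)) ∈ toMeasurable μp (fcyl G o n w) := by
      apply subset_toMeasurable
      have hs : ∀ e, G.src (φ e) = G.src e := fun e => (Prod.ext_iff.1 (Prod.ext_iff.1 (hφ1 e)).2).1
      have hd : ∀ e, G.dst (φ e) = G.dst e := fun e => (Prod.ext_iff.1 (Prod.ext_iff.1 (hφ1 e)).2).2
      refine ⟨hφ2, fun i => ?_, ?_, φ.bijective.comp h3.2.2⟩
      · rw [hs, hd]; exact h3.1 i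
      · rw [hs]; exact h3.2.1
    exact (saturated (fun i => ((Prod.ext_iff.1 (hφ1 (γ i))).1)) (measurableSet_toMeasurable _ _)).1
      hmem
  · apply measure_mono
    rintro γ ⟨h1, h2⟩
    refine ⟨fun i => by rw [h1], ?_, h2⟩
    intro i hi
    rcases i with _ | i
    · rw [hx, vs, h2.2.1]
    · rw [vs, ← h2.1, ← hdst ⟨i, hi⟩, ← h1]

lemma fcyl_eq (hG : ProperGibbs G o μp) {n : ℕ} {w : Fin n → E} (hw : Function.Injective w)
    (σ : Equiv.Perm (Fin n)) (hp : PrefixPath G o w) (hp' : PrefixPath G o (w ∘ σ))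
    (hlast : ∀ h : 0 < n, G.dst (w ⟨n - 1, by omega⟩) = G.dst ((w ∘ σ) ⟨n - 1, by omega⟩)) :
    μp (fcyl G o n w) = μp (fcyl G o n (w ∘ σ)) := by
  let B : Set (ℕ → E) := {t | (∀ i, G.dst (t i) = G.src (t (i + 1))) ∧ Function.Injective t ∧
    range t = (range w)ᶜ ∧ (∀ h : 0 < n, G.dst (w ⟨n - 1, by omega⟩) = G.src (t 0)) ∧
    (n = 0 → G.src (t 0) = o)}
  have key : ∀ w' : Fin n → E, Function.Injective w' → range w' = range w → PrefixPath G o w' →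
      (∀ h : 0 < n, G.dst (w ⟨n - 1, by omega⟩) = G.dst (w' ⟨n - 1, by omega⟩)) →
      fcyl G o n w' = {γ | (∀ i : Fin n, γ (i : ℕ) = w' i) ∧ (fun t : ℕ => γ (n + t)) ∈ B} := by
    intro w' hw' hr hp hl
    ext γ
    constructor
    · rintro ⟨h1, h2, h3, h4⟩
      refine ⟨h1, fun i => h2 (n + i), fun i j h => by have := h4.1 h; omega, ?_, ?_, ?_⟩
      · rw [← hr]
        ext e
        simp only [mem_range, mem_compl_iff, not_exists]
        constructor
        · rintro ⟨t, rfl⟩ i hi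
          rw [← h1 i] at hi
          have := h4.1 hi
          omega
        · intro h
          obtain ⟨j, rfl⟩ := h4.2 e
          by_cases hj : j < n
          · exact absurd (h1 ⟨j, hj⟩).symm (h ⟨j, hj⟩)
          · exact ⟨j - n, by congr 1; omega⟩
      · intro h
        rw [hl h, ← h1]
        have := h2 (n - 1)
        rw [this]; change G.src (γ (n - 1 + 1)) = G.src (γ (n + 0)); rw [show n - 1 + 1 = n + 0 by omega]
      · rintro rfl; simpa using h3
    · rintro ⟨h1, h2, h3, h4, h5, h6⟩
      refine ⟨h1, ?_, ?_, ?_, ?_⟩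
      · intro i
        by_cases hi : i + 1 < n
        · rw [show γ i = w' ⟨i, by omega⟩ from h1 ⟨i, by omega⟩,
            show γ (i + 1) = w' ⟨i + 1, hi⟩ from h1 ⟨i + 1, hi⟩]
          exact hp.2 i hi
        · by_cases hi' : i + 1 = n
          · have h0 : 0 < n := by omega
            have := h5 h0
            rw [hl h0, ← h1] at this
            rw [show i = n - 1 by omega, this]
            change G.src (γ (n + 0)) = G.src (γ (n - 1 + 1))
            rw [show n - 1 + 1 = n + 0 by omega]
          · have : G.dst (γ (n + (i - n))) = G.src (γ (n + (i - n + 1))) := h2 (i - n)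
            rwa [show n + (i - n) = i by omega, show n + (i - n + 1) = i + 1 by omega] at this
      · by_cases hn : 0 < n
        · rw [show γ 0 = w' ⟨0, hn⟩ from h1 ⟨0, hn⟩]; exact hp.1 hn
        · have hn : n = 0 := by omega
          have := h6 hn; subst hn; simpa using this
      · intro i j hij
        have tl : ∀ i j, i < n → ¬ j < n → γ i ≠ γ j := by
          intro i j hi hj h
          have : γ j ∈ range (fun t : ℕ => γ (n + t)) := ⟨j - n, by
            change γ (n + (j - n)) = _; congr 1; omega⟩
          rw [h4, ← hr] at this
          apply this
          exact ⟨⟨i, hi⟩, by rw [← h1, ← h]⟩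
        by_cases hi : i < n <;> by_cases hj : j < n
        · have : w' ⟨i, hi⟩ = w' ⟨j, hj⟩ := by rw [← h1, ← h1]; exact hij
          simpa using hw' this
        · exact absurd hij (tl i j hi hj)
        · exact absurd hij.symm (tl j i hj hi)
        · have := @h3 (i - n) (j - n) (by
            change γ (n + (i - n)) = γ (n + (j - n))
            rwa [show n + (i - n) = i by omega, show n + (j - n) = j by omega])
          omega
      · intro e
        by_cases he : e ∈ range w'
        · obtain ⟨i, rfl⟩ := he; exact ⟨i, h1 i⟩
        · have : e ∈ (range w)ᶜ := by rw [← hr]; exact he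
          rw [← h4] at this
          obtain ⟨t, ht⟩ := this
          exact ⟨n + t, ht⟩
  rw [key w hw rfl hp (fun _ => rfl), key (w ∘ σ) (hw.comp σ.injective)
    (by rw [range_comp, σ.surjective.range_eq, image_univ]) hp' hlast]
  exact hG.2.2 n w (w ∘ σ) hw (hw.comp σ.injective)
    (by rw [range_comp, σ.surjective.range_eq, image_univ]) hp hp' B

end gibbs

end PartP7a

section PartP7b

section gibbs
variable [MeasurableSpace S] [DiscreteMeasurableSpace S] [Countable S]
variable {Vs : Set S} {E : Type} [MeasurableSpace E] [Countable E]
variable {G : DigraphStruct (↥Vs) E} {o : ↥Vs} {μp : Measure (ℕ → E)} {ν : Measure (ℕ → S)}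

lemma gib_full (hG : ProperGibbs G o μp) (hν : ∀ A : Set (ℕ → S), MeasurableSet A → ν A = μp (vs G ⁻¹' A))
    {A : Set (ℕ → S)} (hA : MeasurableSet A) : ν A = μp (vs G ⁻¹' A ∩ EP G o) := by
  rw [hν A hA]
  apply le_antisymm _ (measure_mono inter_subset_left)
  have h1 : (1 : ℝ≥0∞) ≤ μp (vs G ⁻¹' A ∩ EP G o) + μp ((vs G ⁻¹' A)ᶜ ∩ EP G o) := by
    have : μp (EP G o) = 1 := hG.2.1
    rw [← this]
    refine (measure_mono ?_).trans (measure_union_le _ _)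
    intro γ h
    by_cases h' : γ ∈ vs G ⁻¹' A
    · exact Or.inl ⟨h', h⟩
    · exact Or.inr ⟨h', h⟩
  have h2 : μp (vs G ⁻¹' A) + μp ((vs G ⁻¹' A)ᶜ) = 1 := by
    have e1 := hν A hA
    have e2 := hν Aᶜ hA.compl
    rw [preimage_compl] at e2
    rw [← e1, ← e2, measure_add_measure_compl hA, hν univ MeasurableSet.univ, preimage_univ, hG.1]
  have h3 : μp ((vs G ⁻¹' A)ᶜ) ≠ ∞ := by
    intro h; rw [h] at h2; simp at h2
  have h4 : μp (vs G ⁻¹' A) + μp ((vs G ⁻¹' A)ᶜ) ≤ μp (vs G ⁻¹' A ∩ EP G o) + μp ((vs G ⁻¹' A)ᶜ) := by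
    rw [h2]; exact h1.trans (add_le_add le_rfl (measure_mono inter_subset_left))
  exact (ENNReal.add_le_add_iff_right h3).1 h4

/-- class cylinders indexed by classes -/
def kcyl (n : ℕ) (c : Fin n → range (mk1 : E → Set (Set E))) : Set (ℕ → E) :=
  {γ | ∀ i : Fin n, mk1 (γ i) = (c i : Set (Set E))}

lemma kcyl_sum (n : ℕ) (X : Set (ℕ → E)) :
    μp X = ∑' c : Fin n → range (mk1 : E → Set (Set E)), μp (kcyl n c ∩ X) := by
  have hm : ∀ c : Fin n → range (mk1 : E → Set (Set E)), MeasurableSet (kcyl n c) := by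
    intro c
    rw [kcyl, setOf_forall]
    refine MeasurableSet.iInter fun i => ?_
    obtain ⟨e, he⟩ := (c i).2
    have := (measurable_pi_apply (X := fun _ : ℕ => E) (i : ℕ)) (mk1_meas e)
    convert this using 1
    ext γ
    simp [he]
  have hc0 : Countable (range (mk1 : E → Set (Set E))) := (countable_range _).to_subtype
  have hc : Countable (Fin n → range (mk1 : E → Set (Set E))) := inferInstance
  have hu : (⋃ c, kcyl (E := E) n c) = univ := by
    rw [eq_univ_iff_forall]; intro γ
    exact mem_iUnion.2 ⟨fun i => ⟨mk1 (γ i), mem_range_self _⟩, fun i => rfl⟩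
  have hd : Pairwise (Function.onFun Disjoint (kcyl (E := E) n)) := by
    intro c c' h
    rw [Function.onFun, Set.disjoint_left]
    intro γ h1 h2
    apply h
    funext i
    exact Subtype.ext ((h1 i).symm.trans (h2 i))
  have := measure_iUnion (μ := μp.restrict X) hd hm
  rw [hu, Measure.restrict_apply_univ] at this
  rw [this]
  exact tsum_congr fun c => Measure.restrict_apply (hm c)

lemma kcyl_eq (hG : ProperGibbs G o μp) {n : ℕ} {x y : ℕ → S} (h0 : x 0 = y 0) (hn : x n = y n)
    (σ : Equiv.Perm (Fin n)) (hσ : ∀ i : Fin n, y i = x (σ i) ∧ y (i + 1) = x (σ i + 1))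
    (c : Fin n → range (mk1 : E → Set (Set E)))
    (hne : (kcyl n c ∩ (vcyl G n x ∩ EP G o)).Nonempty) :
    μp (kcyl n c ∩ (vcyl G n x ∩ EP G o)) = μp (kcyl n (c ∘ σ) ∩ (vcyl G n y ∩ EP G o)) := by
  obtain ⟨γ, h1, h2, h3⟩ := hne
  set w : Fin n → E := fun i => γ i with hw
  have hwi : Function.Injective w := fun i j h => Fin.ext (h3.2.2.1 h)
  have e1 : kcyl n c = ccyl n w := by
    ext γ'
    simp only [kcyl, ccyl, mem_setOf_eq]
    exact forall_congr' fun i => by rw [← h1 i]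
  have e2 : kcyl n (c ∘ σ) = ccyl n (w ∘ σ) := by
    ext γ'
    simp only [kcyl, ccyl, mem_setOf_eq, Function.comp]
    exact forall_congr' fun i => by rw [← h1 (σ i)]
  have hs : ∀ i : Fin n, (G.src (w i) : S) = x i := fun i => h2 i i.2.le
  have hd : ∀ i : Fin n, (G.dst (w i) : S) = x (i + 1) := fun i => by
    rw [hw]; simp only []; rw [h3.1]; exact h2 (i + 1) i.2
  have hx0 : x 0 = o := by rw [← h2 0 (by omega), vs, h3.2.1]
  have hs' : ∀ i : Fin n, (G.src ((w ∘ σ) i) : S) = y i := fun i => by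
    rw [(hσ i).1]; exact hs _
  have hd' : ∀ i : Fin n, (G.dst ((w ∘ σ) i) : S) = y (i + 1) := fun i => by
    rw [(hσ i).2]; exact hd _
  rw [e1, e2, coarse_eq hwi hs hd hx0, coarse_eq (hwi.comp σ.injective) hs' hd' (h0 ▸ hx0)]
  apply fcyl_eq hG hwi
  · exact ⟨fun h => Subtype.ext (by rw [hs]; exact hx0), fun i h => Subtype.ext (by rw [hs, hd])⟩
  · exact ⟨fun h => Subtype.ext (by rw [hs']; exact h0 ▸ hx0), fun i h => Subtype.ext (by rw [hs', hd'])⟩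
  · intro h
    apply Subtype.ext
    rw [hd, hd']
    change x (n - 1 + 1) = y (n - 1 + 1)
    rw [show n - 1 + 1 = n by omega, hn]

lemma gib_lpe (hG : ProperGibbs G o μp) (hν : ∀ A : Set (ℕ → S), MeasurableSet A → ν A = μp (vs G ⁻¹' A)) :
    LPE ν := by
  intro l l' hl
  by_cases hnil : l = []
  · subst hnil
    have := hl.length_eq
    rw [List.length_nil] at this
    rw [List.eq_nil_of_length_eq_zero this.symm]
  have hlen := hl.length_eq
  have hnil' : l' ≠ [] := by
    rintro rfl; rw [List.length_nil] at hlen; exact hnil (List.eq_nil_of_length_eq_zero hlen)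
  obtain ⟨x, hx⟩ := exists_pre l hnil
  obtain ⟨y, hy⟩ := exists_pre l' hnil'
  obtain ⟨n, hn⟩ : ∃ n, l.length = n + 1 :=
    ⟨l.length - 1, (Nat.succ_pred_eq_of_pos (List.length_pos_iff.2 hnil)).symm⟩
  rw [← hlen] at hy
  rw [hn] at hx hy
  have hl0 := hl
  rw [← hx, ← hy] at hl0
  obtain ⟨h0, σ, hσ⟩ := exists_perm_of_leqv hl0
  have hlast : x n = y n := by
    have := hl0
    rw [pre_succ, pre_succ] at this
    exact this.last_eq
  rw [gib_full hG hν (measurableSet_cyl l), gib_full hG hν (measurableSet_cyl l'), ← hx, ← hy]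
  have ev : ∀ x : ℕ → S, vs G ⁻¹' cyl (pre x (n + 1)) = vcyl G n x := by
    intro x; ext γ
    rw [mem_preimage, mem_cyl_pre_iff]
    simp only [vcyl, mem_setOf_eq, Nat.lt_succ_iff]
  rw [ev, ev, kcyl_sum n, kcyl_sum n (vcyl G n y ∩ EP G o)]
  rw [← (Equiv.arrowCongr σ.symm (Equiv.refl (range (mk1 : E → Set (Set E))))).tsum_eq
    (fun c => μp (kcyl n c ∩ (vcyl G n y ∩ EP G o)))]
  refine tsum_congr fun c => ?_
  have ec : (Equiv.arrowCongr σ.symm (Equiv.refl (range (mk1 : E → Set (Set E))))) c = c ∘ σ := by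
    funext i; simp [Equiv.arrowCongr]
  rw [ec]
  by_cases hne : (kcyl n c ∩ (vcyl G n x ∩ EP G o)).Nonempty
  · exact kcyl_eq hG h0 hlast σ hσ c hne
  · by_cases hne' : (kcyl n (c ∘ σ) ∩ (vcyl G n y ∩ EP G o)).Nonempty
    · have := kcyl_eq hG h0.symm hlast.symm σ.symm (x := y) (y := x) (fun i => by
        have := hσ (σ.symm i)
        rw [Equiv.apply_symm_apply] at this
        exact ⟨this.1.symm, this.2.symm⟩) (c ∘ σ) hne'
      rw [this]
      congr 2
      congr 1
      funext i; simp
    · rw [not_nonempty_iff_eq_empty.1 hne, not_nonempty_iff_eq_empty.1 hne']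

open Classical in
lemma tr_filter (ω : ℕ → S) (u : S) (n : ℕ) :
    tr ω n u = ((List.range n).filter (fun i => decide (ω i = u))).map (fun i => ω (i + 1)) := by
  induction n with
  | zero => simp [tr_zero]
  | succ n ih =>
    rw [tr_split n 1, ih, List.range_succ, List.filter_append, List.map_append]
    congr 1
    by_cases h : ω n = u
    · have : tr (shift n ω) 1 u = [ω (n + 1)] := by
        have := tr_one (shift n ω)
        simp only [shift, add_zero, h] at this
        simpa [add_comm] using this
      rw [this]; simp [h]
    · rw [show (1 : ℕ) = 0 + 1 from rfl, tr_succ_ne, tr_zero]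
      · simp [h]
      · simp only [shift, add_zero]; exact fun e => h e.symm

open Classical in
lemma gib_typed (hE : G.LocallyFinite) : ∃ m : S → List S, ∀ γ ∈ EP G o, Typed m (o : S) (vs G γ) := by
  refine ⟨fun u => if h : u ∈ Vs then (((hE ⟨u, h⟩).1.toFinset.toList).map (fun e => (G.dst e : S)))
    else [], ?_⟩
  intro γ hγ
  refine ⟨by rw [vs, hγ.2.1], fun u => ?_⟩
  by_cases hu : u ∈ Vs
  · simp only [dif_pos hu]
    have hfin : {i | γ i ∈ G.outEdges ⟨u, hu⟩}.Finite :=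
      (hE ⟨u, hu⟩).1.preimage hγ.2.2.1.injOn
    obtain ⟨N, hN⟩ := hfin.bddAbove
    refine ⟨N + 1, fun n hn => ?_⟩
    rw [tr_filter]
    have : (fun i => vs G γ (i + 1)) = (fun e => (G.dst e : S)) ∘ γ := by
      funext i; simp only [Function.comp]; rw [vs, hγ.1]
    rw [this, ← List.map_map]
    refine List.Perm.map _ ?_
    rw [List.perm_ext_iff_of_nodup ((List.nodup_range.filter _).map hγ.2.2.1) (Finset.nodup_toList _)]
    intro e
    simp only [List.mem_map, List.mem_filter, List.mem_range, decide_eq_true_eq, Finset.mem_toList,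
      Finite.mem_toFinset]
    constructor
    · rintro ⟨i, ⟨hi, h⟩, rfl⟩
      exact Subtype.ext h
    · intro he
      obtain ⟨i, rfl⟩ := hγ.2.2.2 e
      have := hN he
      refine ⟨i, ⟨by omega, ?_⟩, rfl⟩
      rw [vs]
      exact congrArg Subtype.val he
  · simp only [dif_neg hu]
    refine ⟨0, fun n _ => ?_⟩
    rw [tr_filter]
    have : (List.range n).filter (fun i => decide (vs G γ i = u)) = [] := by
      rw [List.filter_eq_nil_iff]
      intro i _
      simp only [decide_eq_true_eq]
      rintro rfl
      exact hu (G.src (γ i)).2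
    rw [this]; rfl

end gibbs

lemma gibbs_extreme [MeasurableSpace S] [DiscreteMeasurableSpace S] [Countable S]
    {ν : Measure (ℕ → S)} (h : IsGibbsVertexLaw ν) : IsExtremePE ν := by
  obtain ⟨Vs, E, mE, G, o, hE, hS, μp, hG, hν⟩ := h
  have hν : ∀ A : Set (ℕ → S), MeasurableSet A → ν A = μp (vs G ⁻¹' A) := hν
  have h1 : ν univ = 1 := by rw [hν univ MeasurableSet.univ, preimage_univ, hG.1]
  obtain ⟨m, hm⟩ := gib_typed (o := o) hS.locFin
  refine typed_extreme (m := m) (o := (o : S)) h1 (gib_lpe hG hν) ?_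
  have : IsProbabilityMeasure ν := ⟨h1⟩
  have hmeas := measurableSet_typed m (o : S)
  refine (mem_ae_iff_prob_eq_one hmeas).2 ?_
  apply le_antisymm prob_le_one
  rw [hν _ hmeas, ← hG.2.1]
  exact measure_mono fun γ hγ => hm γ hγ

end PartP7b

section PartP8a

/-! ### Mixed laws -/

lemma steps_mem {l : List S} {p : S × S} (h : p ∈ steps l) : p.1 ∈ l ∧ p.2 ∈ l := by
  induction l with
  | nil => simp at h
  | cons a l ih =>
    cases l with
    | nil => simp at h
    | cons b l =>
      rw [steps_cons_cons, List.mem_cons] at h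
      rcases h with rfl | h
      · simp
      · have := ih h
        exact ⟨List.mem_cons_of_mem _ this.1, List.mem_cons_of_mem _ this.2⟩

lemma steps_mid (a : List S) (z s : S) (d : List S) :
    steps (a ++ [z] ++ s :: d) = steps (a ++ [z]) ++ (z, s) :: steps (s :: d) := by
  rw [List.append_assoc]
  change steps (a ++ z :: (s :: d)) = _
  rw [steps_append, steps_cons_cons]

lemma closed_tail {F : Set S} : ∀ (d : List S) (s : S), s ∉ F →
    (∀ p ∈ steps (s :: d), p.1 ∉ F → p.2 ∉ F) → ∀ x ∈ s :: d, x ∉ F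
  | [], s, hs, _ => by simpa using hs
  | t :: d, s, hs, h => by
    have ht : t ∉ F := h (s, t) (by simp) hs
    intro x hx
    rw [List.mem_cons] at hx
    rcases hx with rfl | hx
    · exact hs
    · exact closed_tail d t ht (fun p hp => h p (by rw [steps_cons_cons]; exact List.mem_cons_of_mem _ hp)) x hx

lemma split_class {F : Set S} {a d l' : List S} (ha0 : a ≠ []) (hd0 : d ≠ []) (ha : ∀ x ∈ a, x ∈ F)
    (hd : ∀ x ∈ d, x ∉ F) (h : LEqv (a ++ d) l') :
    ∃ a' d', l' = a' ++ d' ∧ LEqv a a' ∧ LEqv d d' := by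
  classical
  obtain ⟨a, z, rfl⟩ : ∃ b z, a = b ++ [z] := ⟨_, _, (List.dropLast_append_getLast ha0).symm⟩
  obtain ⟨s, d, rfl⟩ := List.exists_cons_of_ne_nil hd0
  have hst := h.2
  rw [steps_mid] at hst
  have hz : z ∈ F := ha z (by simp)
  have hs : s ∉ F := hd s (by simp)
  have hsa : ∀ p ∈ steps (a ++ [z]), p.1 ∈ F ∧ p.2 ∈ F := fun p hp =>
    ⟨ha _ (steps_mem hp).1, ha _ (steps_mem hp).2⟩
  have hsd : ∀ p ∈ steps (s :: d), p.1 ∉ F ∧ p.2 ∉ F := fun p hp =>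
    ⟨hd _ (steps_mem hp).1, hd _ (steps_mem hp).2⟩
  have hcl : ∀ p ∈ steps l', p.1 ∉ F → p.2 ∉ F := by
    intro p hp h1
    have := hst.mem_iff.2 hp
    rw [List.mem_append, List.mem_cons] at this
    rcases this with h2 | rfl | h2
    · exact absurd (hsa p h2).1 h1
    · exact hs
    · exact (hsd p h2).2
  have hcat := List.takeWhile_append_dropWhile (p := fun x => decide (x ∈ F)) (l := l')
  set a' := l'.takeWhile (fun x => decide (x ∈ F)) with ha'
  set d' := l'.dropWhile (fun x => decide (x ∈ F)) with hd'
  have haF : ∀ x ∈ a', x ∈ F := fun x hx => by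
    simpa using List.mem_takeWhile_imp hx
  have hd'0 : d' ≠ [] := by
    intro h0
    rw [h0, List.append_nil] at hcat
    have : (z, s) ∈ steps l' := hst.mem_iff.1 (by simp)
    rw [← hcat] at this
    exact hs (haF _ (steps_mem this).2)
  obtain ⟨s', d'', hd''⟩ := List.exists_cons_of_ne_nil hd'0
  have hs' : s' ∉ F := by
    have := List.head_dropWhile_not (fun x => decide (x ∈ F)) (l := l') hd'0
    simp only [← hd', hd'', List.head_cons] at this
    simpa using this
  have ha'0 : a' ≠ [] := by
    intro h0
    rw [h0, List.nil_append, hd''] at hcat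
    have := h.1
    rw [← hcat] at this
    cases a with
    | nil => simp at this; exact hs' (this ▸ hz)
    | cons x a => simp at this; exact hs' (this ▸ ha x (by simp))
  obtain ⟨b, z', hb⟩ : ∃ b z, a' = b ++ [z] := ⟨_, _, (List.dropLast_append_getLast ha'0).symm⟩
  rw [hb] at haF
  rw [hb, hd''] at hcat
  have hz' : z' ∈ F := haF z' (by simp)
  rw [← hcat, steps_mid] at hst hcl
  have hdF : ∀ x ∈ s' :: d'', x ∉ F := closed_tail d'' s' hs' fun p hp => hcl p (by simp [hp])
  have hsa' : ∀ p ∈ steps (b ++ [z']), p.1 ∈ F ∧ p.2 ∈ F := fun p hp =>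
    ⟨haF _ (steps_mem hp).1, haF _ (steps_mem hp).2⟩
  have hsd' : ∀ p ∈ steps (s' :: d''), p.1 ∉ F ∧ p.2 ∉ F := fun p hp =>
    ⟨hdF _ (steps_mem hp).1, hdF _ (steps_mem hp).2⟩
  have f1 := hst.filter (fun p => decide (p.2 ∈ F))
  have f2 := hst.filter (fun p => decide (p.1 ∉ F))
  have f3 := hst.filter (fun p => decide (p.1 ∈ F ∧ p.2 ∉ F))
  have k1 : ∀ (x : List (S × S)) {q : S × S → Bool}, (∀ p ∈ x, q p = true) → x.filter q = x :=
    fun _ _ h => List.filter_eq_self.2 h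
  have k2 : ∀ (x : List (S × S)) {q : S × S → Bool}, (∀ p ∈ x, ¬ q p = true) → x.filter q = [] :=
    fun _ _ h => List.filter_eq_nil_iff.2 h
  rw [List.filter_append, List.filter_append, List.filter_cons, List.filter_cons,
    k1 (steps (a ++ [z])) (fun p hp => by simpa using (hsa p hp).2), k1 (steps (b ++ [z'])) (fun p hp => by simpa using (hsa' p hp).2),
    k2 (steps (s :: d)) (fun p hp => by simpa using (hsd p hp).2), k2 (steps (s' :: d'')) (fun p hp => by simpa using (hsd' p hp).2),
    if_neg (by simpa using hs), if_neg (by simpa using hs'), List.append_nil, List.append_nil] at f1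
  rw [List.filter_append, List.filter_append, List.filter_cons, List.filter_cons,
    k2 (steps (a ++ [z])) (fun p hp => by simpa using (hsa p hp).1), k2 (steps (b ++ [z'])) (fun p hp => by simpa using (hsa' p hp).1),
    k1 (steps (s :: d)) (fun p hp => by simpa using (hsd p hp).1), k1 (steps (s' :: d'')) (fun p hp => by simpa using (hsd' p hp).1),
    if_neg (by simpa using hz), if_neg (by simpa using hz'), List.nil_append, List.nil_append] at f2
  rw [List.filter_append, List.filter_append, List.filter_cons, List.filter_cons,
    k2 (steps (a ++ [z])) (fun p hp => by simpa using fun _ => (hsa p hp).2), k2 (steps (b ++ [z'])) (fun p hp => by simpa using fun _ => (hsa' p hp).2),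
    k2 (steps (s :: d)) (fun p hp => by simpa using fun h1 => absurd h1 (hsd p hp).1),
    k2 (steps (s' :: d'')) (fun p hp => by simpa using fun h1 => absurd h1 (hsd' p hp).1),
    if_pos (by simp [hs, hz]), if_pos (by simp [hs', hz']), List.nil_append, List.nil_append] at f3
  have f4 := List.perm_singleton.1 f3
  simp at f4
  refine ⟨b ++ [z'], s' :: d'', hcat.symm, ⟨?_, f1⟩, ⟨by simp [f4.2], f2⟩⟩
  have := h.1
  rw [← hcat] at this
  have e : ∀ (a : List S) (z : S) (r : List S), (a ++ [z] ++ r).head? = (a ++ [z]).head? := by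
    intro a z r; cases a <;> simp
  rw [e, e] at this
  exact this

lemma cl_finite (a0 : List S) : {a : List S | LEqv a0 a}.Finite := by
  classical
  cases a0 with
  | nil =>
    refine (finite_singleton ([] : List S)).subset ?_
    intro a ha
    have := LEqv.length_eq ha
    exact List.eq_nil_of_length_eq_zero this.symm
  | cons s t =>
    refine ((t.permutations.toFinset.finite_toSet).image (fun x => s :: x)).subset ?_
    intro a ha
    cases a with
    | nil => have := LEqv.length_eq ha; simp at this
    | cons s' t' =>
      have h1 := ha.1
      simp at h1
      subst h1
      refine ⟨t', ?_, rfl⟩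
      have := ha.2.map Prod.snd
      rw [steps_snd, steps_snd] at this
      simp [List.mem_permutations, this.symm]

/-- The class of a word. -/
noncomputable def clF (a0 : List S) : Finset (List S) := (cl_finite a0).toFinset

lemma mem_clF {a0 a : List S} : a ∈ clF a0 ↔ LEqv a0 a := by simp [clF]

lemma LEqv.mem_iff {a a' : List S} (h : LEqv a a') (x : S) : x ∈ a ↔ x ∈ a' := by
  have key : ∀ {a a' : List S}, LEqv a a' → x ∈ a → x ∈ a' := by
    intro a a' h hx
    cases a with
    | nil => simp at hx
    | cons s t =>
      cases a' with
      | nil => have := h.length_eq; simp at this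
      | cons s' t' =>
        have h1 := h.1
        simp at h1
        subst h1
        have := h.2.map Prod.snd
        rw [steps_snd, steps_snd] at this
        rw [List.mem_cons] at hx ⊢
        exact hx.imp id this.mem_iff.1
  exact ⟨key h, key h.symm⟩

section meas
variable [MeasurableSpace S] [DiscreteMeasurableSpace S] [Countable S]

/-- Sum over all words of the class, followed by `ρ`. -/
noncomputable def mixm (a0 : List S) (ρ : Measure (ℕ → S)) : Measure (ℕ → S) :=
  ∑ a ∈ clF a0, ρ.map (cat a)

lemma mix_apply (a0 : List S) (ρ : Measure (ℕ → S)) {A : Set (ℕ → S)} (hA : MeasurableSet A) :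
    mixm a0 ρ A = ∑ a ∈ clF a0, ρ (cat a ⁻¹' A) := by
  rw [mixm, Measure.finset_sum_apply]
  exact Finset.sum_congr rfl fun a _ => Measure.map_apply (measurable_cat a) hA

lemma cat_mem_cyl_append {a b d : List S} (hlen : b.length = a.length) (y : ℕ → S) :
    cat b y ∈ cyl (a ++ d) ↔ b = a ∧ y ∈ cyl d := by
  rw [mem_cyl_append]
  constructor
  · rintro ⟨h1, h2⟩
    have h3 := cat_mem_cyl b y
    rw [mem_cyl] at h1 h3
    rw [hlen, h1] at h3
    subst h3
    rw [shift_cat] at h2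
    exact ⟨rfl, h2⟩
  · rintro ⟨rfl, h2⟩
    rw [shift_cat]; exact ⟨cat_mem_cyl _ _, h2⟩

open Classical in
lemma mix_long (a0 : List S) (ρ : Measure (ℕ → S)) {a d : List S} (hlen : a.length = a0.length) :
    mixm a0 ρ (cyl (a ++ d)) = if LEqv a0 a then ρ (cyl d) else 0 := by
  rw [mix_apply _ _ (measurableSet_cyl _)]
  have : ∀ b ∈ clF a0, ρ (cat b ⁻¹' cyl (a ++ d)) = if b = a then ρ (cyl d) else 0 := by
    intro b hb
    have hb' := (mem_clF.1 hb).length_eq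
    split_ifs with h
    · congr 1
      ext y
      rw [mem_preimage, cat_mem_cyl_append (by omega)]; simp [h]
    · convert measure_empty (μ := ρ)
      ext y
      rw [mem_preimage, cat_mem_cyl_append (by omega)]; simp [h]
  rw [Finset.sum_congr rfl this, Finset.sum_ite_eq']
  simp only [mem_clF]

lemma mix_short (a0 : List S) (ρ : Measure (ℕ → S)) {l : List S} (hlen : l.length ≤ a0.length) 
    [DecidablePred fun a : List S => l <+: a] :
    mixm a0 ρ (cyl l) = ((clF a0).filter (fun a => l <+: a)).card * ρ univ := by
  rw [mix_apply _ _ (measurableSet_cyl _)]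
  have : ∀ b ∈ clF a0, ρ (cat b ⁻¹' cyl l) = if l <+: b then ρ univ else 0 := by
    intro b hb
    have hb' := (mem_clF.1 hb).length_eq
    have key : ∀ y, cat b y ∈ cyl l ↔ l <+: b := by
      intro y
      rw [mem_cyl, List.prefix_iff_eq_take, eq_comm]
      have h2 : b.take l.length = pre (cat b y) l.length := by
        apply List.ext_getElem
        · simp; omega
        · intro i h1 h2
          rw [pre_getElem, List.getElem_take, cat_lt]
      rw [h2]
    split_ifs with h
    · congr 1
      ext y; simp [key, h]
    · convert measure_empty (μ := ρ)
      ext y; simp [key, h]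
  rw [Finset.sum_congr rfl this, ← Finset.sum_filter, Finset.sum_const, nsmul_eq_mul]

lemma card_short (a0 : List S) {l l' : List S} (h : LEqv l l') (h0 : l ≠ []) 
    [DecidablePred fun a : List S => l <+: a] [DecidablePred fun a : List S => l' <+: a] :
    ((clF a0).filter (fun a => l <+: a)).card ≤ ((clF a0).filter (fun a => l' <+: a)).card := by
  apply Finset.card_le_card_of_injOn (fun a => l' ++ a.drop l.length)
  · intro a ha
    simp only [Finset.coe_filter, mem_setOf_eq, mem_clF] at ha ⊢
    obtain ⟨h1, r, rfl⟩ := ha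
    refine ⟨?_, _, rfl⟩
    rw [List.drop_left]
    obtain ⟨b, s, rfl⟩ : ∃ b z, l = b ++ [z] := ⟨_, _, (List.dropLast_append_getLast h0).symm⟩
    obtain ⟨b', s', rfl⟩ : ∃ b z, l' = b ++ [z] := ⟨_, _, (List.dropLast_append_getLast (by
      rintro rfl; have := h.length_eq; simp at this)).symm⟩
    have := h.last_eq
    subst this
    have := h.append_right r
    rw [List.append_assoc] at h1 ⊢
    exact h1.trans this
  · intro a ha b hb hab
    simp only [Finset.coe_filter, mem_setOf_eq] at ha hb
    obtain ⟨-, r, rfl⟩ := ha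
    obtain ⟨-, r', rfl⟩ := hb
    simp only [List.drop_left] at hab
    rw [List.append_cancel_left hab]

lemma mix_lpe {a0 : List S} {ρ : Measure (ℕ → S)} {F : Set S} (ha0 : a0 ≠ [])
    (haF : ∀ x ∈ a0, x ∈ F) (hρ : LPE ρ) (hF : ∀ᵐ ω ∂ρ, ∀ i, ω i ∉ F) :
    LPE (mixm a0 ρ) := by
  classical
  intro l l' h
  by_cases h0 : l = []
  · subst h0
    have := h.length_eq
    rw [List.eq_nil_of_length_eq_zero this.symm]
  by_cases hlen : l.length ≤ a0.length
  · rw [mix_short a0 ρ hlen, mix_short a0 ρ (h.length_eq ▸ hlen)]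
    congr 2
    have h0' : l' ≠ [] := by rintro rfl; have := h.length_eq; simp at this; exact h0 this
    exact le_antisymm (card_short a0 h h0) (card_short a0 h.symm h0')
  · push Not at hlen
    have key : ∀ l l' : List S, a0.length < l.length → LEqv l l' → mixm a0 ρ (cyl l) ≠ 0 →
        mixm a0 ρ (cyl l) = mixm a0 ρ (cyl l') := by
      intro l l' hlen h hne
      have hl := List.take_append_drop a0.length l
      set a := l.take a0.length
      set d := l.drop a0.length with hd
      have ha : a.length = a0.length := by simp [a]; omega
      have hd0 : d ≠ [] := by
        intro h0
        have : d.length = 0 := by rw [h0]; rfl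
        rw [hd, List.length_drop] at this; omega
      rw [← hl, mix_long a0 ρ ha] at hne ⊢
      split_ifs at hne ⊢ with hcl
      · have hdF : ∀ x ∈ d, x ∉ F := by
          intro x hx hxF
          apply hne
          refine measure_mono_null ?_ (ae_iff.1 hF)
          intro ω hω
          simp only [mem_setOf_eq, not_forall, not_not]
          obtain ⟨i, hi, rfl⟩ := List.getElem_of_mem hx
          exact ⟨i, by rw [(mem_cyl_iff.1 hω) i hi]; exact hxF⟩
        rw [← hl] at h
        obtain ⟨a', d', rfl, h1, h2⟩ := split_class (F := F) (a := a) (d := d)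
          (by intro h0; rw [h0] at ha; exact ha0 (List.eq_nil_of_length_eq_zero ha.symm)) hd0
          (fun x hx => haF x ((hcl.mem_iff x).2 hx)) hdF h
        rw [mix_long a0 ρ (by rw [← h1.length_eq, ha]), if_pos (hcl.trans h1)]
        exact hρ _ _ h2
      · exact absurd rfl hne
    by_cases hne : mixm a0 ρ (cyl l) = 0
    · by_contra hcon
      exact hcon (key l' l (h.length_eq ▸ hlen) h.symm (fun e => hcon (hne.trans e.symm))).symm
    · exact key l l' hlen h hne

end meas

end PartP8a

section PartP8b

section meas
variable [MeasurableSpace S] [DiscreteMeasurableSpace S] [Countable S]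

lemma mix_decomp {a0 : List S} {ρ ρ' : Measure (ℕ → S)} (h : ∀ a ∈ clF a0, aft ρ a = ρ')
    (hs : ρ (⋃ a ∈ clF a0, cyl a)ᶜ = 0) : ρ = mixm a0 ρ' := by
  ext A hA
  rw [mix_apply _ _ hA]
  have h1 : ρ A = ρ (⋃ a ∈ clF a0, (cyl a ∩ A)) := by
    have hz : ρ (A \ ⋃ a ∈ clF a0, cyl a) = 0 := measure_mono_null (fun ω hω => hω.2) hs
    rw [← measure_inter_add_diff A (Finset.measurableSet_biUnion (clF a0) fun a _ => measurableSet_cyl a),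
      hz, add_zero]
    congr 1
    ext ω; simp only [mem_inter_iff, mem_iUnion]; tauto
  rw [h1, measure_biUnion_finset]
  · refine Finset.sum_congr rfl fun a ha => ?_
    rw [← h a ha, aft_apply _ _ (measurable_cat a hA)]
    congr 1
    ext ω
    simp only [mem_inter_iff, mem_preimage]
    refine and_congr_right fun hω => ?_
    rw [cat_shift hω]
  · intro a ha b hb hab
    rw [Function.onFun, Set.disjoint_left]
    rintro ω ⟨h1, -⟩ ⟨h2, -⟩
    apply hab
    have e1 := (mem_clF.1 ha).length_eq
    have e2 := (mem_clF.1 hb).length_eq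
    rw [mem_cyl, ← e1] at h1
    rw [mem_cyl, ← e2] at h2
    rw [← h1, ← h2]
  · intro a _; exact (measurableSet_cyl a).inter hA

lemma mix_supp (a0 : List S) (ρ : Measure (ℕ → S)) : mixm a0 ρ (⋃ a ∈ clF a0, cyl a)ᶜ = 0 := by
  rw [mix_apply _ _ (Finset.measurableSet_biUnion (clF a0) fun a _ => measurableSet_cyl a).compl]
  refine Finset.sum_eq_zero fun a ha => ?_
  convert measure_empty (μ := ρ)
  ext y
  simp only [mem_preimage, mem_compl_iff, mem_iUnion, not_exists, mem_empty_iff_false, iff_false,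
    not_forall, not_not]
  exact ⟨a, ha, cat_mem_cyl a y⟩

lemma clF_card_ne (a0 : List S) : ((clF a0).card : ℝ≥0∞) ≠ 0 := by
  have : a0 ∈ clF a0 := mem_clF.2 (LEqv.refl _)
  have := Finset.card_pos.2 ⟨_, this⟩
  exact_mod_cast this.ne'

lemma mix_univ (a0 : List S) (ρ : Measure (ℕ → S)) : mixm a0 ρ univ = (clF a0).card * ρ univ := by
  rw [mix_apply _ _ MeasurableSet.univ]
  simp

lemma mix_smul (a0 : List S) (ρ : Measure (ℕ → S)) (t : ℝ≥0∞) : mixm a0 (t • ρ) = t • mixm a0 ρ := by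
  ext A hA
  rw [mix_apply _ _ hA, Measure.smul_apply, mix_apply _ _ hA]
  simp [Finset.mul_sum]

lemma mix_aft (a0 : List S) (ρ : Measure (ℕ → S)) [IsFiniteMeasure ρ] {a : List S} (ha : LEqv a0 a) :
    aft (mixm a0 ρ) a = ρ := by
  symm
  apply ext_cyl
  intro d _
  rw [aft_cyl, mix_long a0 ρ ha.length_eq.symm, if_pos ha]

lemma aft_class {ρ : Measure (ℕ → S)} [IsFiniteMeasure ρ] (hρ : LPE ρ) {a a0 : List S} (h0 : a0 ≠ [])
    (h : LEqv a0 a) : aft ρ a = aft ρ a0 := by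
  apply ext_cyl
  intro d _
  rw [aft_cyl, aft_cyl]
  apply hρ
  obtain ⟨b, s, rfl⟩ : ∃ b z, a0 = b ++ [z] := ⟨_, _, (List.dropLast_append_getLast h0).symm⟩
  obtain ⟨b', s', rfl⟩ : ∃ b z, a = b ++ [z] := ⟨_, _, (List.dropLast_append_getLast (by
    rintro rfl; have := h.length_eq; simp at this)).symm⟩
  have := h.last_eq
  subst this
  have := h.append_right d
  rw [List.append_assoc, List.append_assoc]
  exact this.symm

lemma mix_extreme {a0 : List S} {Vr : Set S} {p : S → S → ℝ≥0∞} {s1 : S} {ν : Measure (ℕ → S)}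
    (hMC : IsMCLaw Vr p s1 ν) (hr : RecAt s1 ν) (h0 : a0 ≠ []) (hd : ∀ x ∈ a0, x ∉ Vr) :
    IsExtremePE (((clF a0).card : ℝ≥0∞)⁻¹ • mixm a0 ν) := by
  have hν1 := hMC.1
  have : IsProbabilityMeasure ν := ⟨hν1⟩
  set c : ℝ≥0∞ := ((clF a0).card : ℝ≥0∞)⁻¹ with hc
  have hc0 : c ≠ 0 := by rw [hc]; exact ENNReal.inv_ne_zero.2 (ENNReal.natCast_ne_top _)
  have hct : c ≠ ∞ := by rw [hc]; exact ENNReal.inv_ne_top.2 (clF_card_ne a0)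
  have hu : (c • mixm a0 ν) univ = 1 := by
    rw [Measure.smul_apply, mix_univ, hν1, mul_one, smul_eq_mul, hc,
      ENNReal.inv_mul_cancel (clF_card_ne a0) (ENNReal.natCast_ne_top _)]
  have hlpe : LPE (mixm a0 ν) := by
    refine mix_lpe (F := {x | x ∈ a0}) h0 (fun x hx => hx) (mc_lpe hMC) ?_
    filter_upwards [mc_states hMC] with ω hω i hi using hd _ hi (hω i)
  refine ext_of_le hu (lpe_smul hlpe c) fun ρ hρ hle => ?_
  have : IsProbabilityMeasure (c • mixm a0 ν) := ⟨hu⟩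
  have : IsFiniteMeasure ρ := isFiniteMeasure_of_le _ hle
  have hac : aft ρ a0 ≪ ν := by
    refine Measure.AbsolutelyContinuous.mk fun A hA h => ?_
    rw [aft_apply _ _ hA]
    refine le_antisymm ((hle _).trans ?_) bot_le
    rw [Measure.smul_apply, ← aft_apply _ _ hA, mix_aft a0 ν (LEqv.refl _), h, smul_zero]
  have h1 := rec_le hMC hr (aft_lpe hρ a0) hac
  have h2 : ρ = mixm a0 (aft ρ a0) := by
    refine mix_decomp (fun a ha => aft_class hρ h0 (mem_clF.1 ha)) ?_
    refine le_antisymm ((hle _).trans ?_) bot_le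
    rw [Measure.smul_apply, mix_supp, smul_zero]
  set t := aft ρ a0 univ
  rw [h1, mix_smul] at h2
  have h3 : ρ = (t * c⁻¹) • (c • mixm a0 ν) := by
    rw [smul_smul, mul_assoc, ENNReal.inv_mul_cancel hc0 hct, mul_one]; exact h2
  have h4 : ρ univ = t * c⁻¹ := by
    rw [h3, Measure.smul_apply, hu, smul_eq_mul, mul_one]
  rw [h4]; exact h3

end meas

end PartP8b

section PartP8c

section euler
variable {V E : Type} {G : DigraphStruct V E}

lemma stk_mem_iff {dst : E → V} (l : List E) (o : V) (e : E) : e ∈ l ↔ ∃ u, e ∈ stk dst o l u := by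
  induction l generalizing o with
  | nil => simp [stk]
  | cons e' l ih =>
    rw [List.mem_cons, ih (dst e')]
    constructor
    · rintro (rfl | ⟨u, hu⟩)
      · exact ⟨o, by rw [stk_cons_self]; simp⟩
      · refine ⟨u, ?_⟩
        by_cases h : u = o
        · subst h; rw [stk_cons_self]; exact List.mem_cons_of_mem _ hu
        · rwa [stk_cons_ne h]
    · rintro ⟨u, hu⟩
      by_cases h : u = o
      · subst h
        rw [stk_cons_self, List.mem_cons] at hu
        exact hu.imp id fun h => ⟨_, h⟩
      · rw [stk_cons_ne h] at hu; exact Or.inr ⟨u, hu⟩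

lemma stk_euler (l : List E) (o : V) (hn : ∀ u, (stk G.dst o l u).Nodup)
    (hs : ∀ u, ∀ e ∈ stk G.dst o l u, G.src e = u) : IsPathList G o (endp G.dst o l) l ∧ l.Nodup := by
  induction l generalizing o with
  | nil => exact ⟨rfl, List.nodup_nil⟩
  | cons e l ih =>
    have hself := stk_cons_self (dst := G.dst) o e l
    have hsub : ∀ u, stk G.dst (G.dst e) l u = stk G.dst o (e :: l) u ∨
        e :: stk G.dst (G.dst e) l u = stk G.dst o (e :: l) u := by
      intro u
      by_cases h : u = o
      · subst h; exact Or.inr hself.symm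
      · exact Or.inl (stk_cons_ne h e l).symm
    have hsrc : G.src e = o := hs o e (by rw [hself]; simp)
    obtain ⟨h1, h2⟩ := ih (G.dst e)
      (fun u => by
        rcases hsub u with h | h
        · rw [h]; exact hn u
        · have := hn u
          rw [← h] at this
          exact (List.nodup_cons.1 this).2)
      (fun u e' he' => by
        rcases hsub u with h | h
        · rw [h] at he'; exact hs u e' he'
        · exact hs u e' (by rw [← h]; exact List.mem_cons_of_mem _ he'))
    refine ⟨⟨hsrc, h1⟩, List.nodup_cons.2 ⟨?_, h2⟩⟩
    intro hmem
    obtain ⟨u, hu⟩ := (stk_mem_iff (dst := G.dst) l (G.dst e) e).1 hmem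
    have hu' : u = o := by
      rw [← hsrc]
      rcases hsub u with h | h
      · rw [h] at hu; exact (hs u e hu).symm
      · exact (hs u e (by rw [← h]; exact List.mem_cons_of_mem _ hu)).symm
    subst hu'
    have := hn u
    rw [hself] at this
    exact (List.nodup_cons.1 this).1 hu

lemma rank_exists {z : V} (h : ∀ v, Relation.ReflTransGen G.dirAdj v z) :
    ∃ d : V → ℕ, ∀ v, v ≠ z → ∃ e, G.src e = v ∧ d (G.dst e) < d v := by
  classical
  let R : ℕ → Set V := fun n => Nat.rec {z} (fun _ P => P ∪ {v | ∃ e, G.src e = v ∧ G.dst e ∈ P}) n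
  have hR : ∀ n, R (n + 1) = R n ∪ {v | ∃ e, G.src e = v ∧ G.dst e ∈ R n} := fun n => rfl
  have hex : ∀ v, ∃ n, v ∈ R n := by
    intro v
    refine Relation.ReflTransGen.head_induction_on (h v) ⟨0, rfl⟩ ?_
    rintro a c ⟨e, h1, h2⟩ _ ⟨n, hn⟩
    refine ⟨n + 1, ?_⟩
    rw [hR]
    exact Or.inr ⟨e, h1, h2 ▸ hn⟩
  refine ⟨fun v => sInf {n | v ∈ R n}, fun v hv => ?_⟩
  have h1 : v ∈ R (sInf {n | v ∈ R n}) := Nat.sInf_mem (hex v)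
  cases hn : sInf {n | v ∈ R n} with
  | zero => rw [hn] at h1; exact absurd h1 hv
  | succ n =>
    rw [hn, hR] at h1
    rcases h1 with h1 | ⟨e, h2, h3⟩
    · have : sInf {n | v ∈ R n} ≤ n := Nat.sInf_le h1
      omega
    · refine ⟨e, h2, ?_⟩
      have h4 : sInf {n | G.dst e ∈ R n} ≤ n := Nat.sInf_le h3
      show sInf {n | G.dst e ∈ R n} < sInf {n | v ∈ R n}
      omega

lemma euler_exists {o z : V} (h : IsFinEulerian G o z) : ∃ L, IsEulerList G o z L := by
  classical
  have := h.finV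
  have := h.finE
  have := Fintype.ofFinite V
  have := Fintype.ofFinite E
  obtain ⟨d, hd⟩ := rank_exists h.reach_to
  choose te hte1 hte2 using hd
  let ol : V → List E := fun v => (Finset.univ.filter (fun e => G.src e = v)).toList
  have hol : ∀ v e, e ∈ ol v ↔ G.src e = v := by intro v e; simp [ol]
  have holn : ∀ v, (ol v).Nodup := fun v => Finset.nodup_toList _
  let σ : V → List E := fun v => if hv : v = z then ol v else (ol v).erase (te v hv) ++ [te v hv]
  have hperm : ∀ v, (σ v).Perm (ol v) := by
    intro v
    simp only [σ]
    split_ifs with hv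
    · exact List.Perm.refl _
    · refine (List.perm_append_singleton _ _).trans ?_
      exact (List.perm_cons_erase ((hol v _).2 (hte1 v hv))).symm
  have hlead : ∀ n v, d v = n → Lead G.dst σ {z} v := by
    intro n
    induction n using Nat.strong_induction_on with
    | _ n ih =>
      intro v hv
      by_cases hz : v = z
      · exact .base hz
      · refine .step (te v hz) ?_ (ih _ (by rw [← hv]; exact hte2 v hz) _ rfl)
        simp [σ, hz]
  have hout : ∀ v, (ol v).length = G.outDeg v := by
    intro v
    rw [Finset.length_toList, DigraphStruct.outDeg, ← Set.ncard_coe_finset]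
    congr 1
    ext e; simp [DigraphStruct.outEdges]
  have hin : ∀ v, inN G.dst Finset.univ ol v = G.inDeg v := by
    intro v
    have e1 : G.inDeg v = (Finset.univ.filter (fun e => G.dst e = v)).card := by
      rw [DigraphStruct.inDeg, ← Set.ncard_coe_finset]
      congr 1
      ext e; simp [DigraphStruct.inEdges]
    rw [e1, inN, Finset.card_eq_sum_card_fiberwise (f := G.src) (t := Finset.univ) (fun _ _ => Finset.mem_coe.2 (Finset.mem_univ _))]
    refine Finset.sum_congr rfl fun u _ => ?_
    rw [List.countP_eq_length_filter, ← Multiset.coe_card, ← Multiset.filter_coe, Finset.coe_toList,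
      Finset.filter_filter, Finset.card, Finset.filter_val, Finset.filter_val, Multiset.filter_filter]
  have hbal : Bal G.dst Finset.univ ol o z := by
    intro v
    rw [hin, hout]
    by_cases hoz : o = z
    · rw [h.bal_eq hoz v, hoz]
    · obtain ⟨b1, b2, b3⟩ := h.bal_ne hoz
      by_cases hvo : v = o
      · subst hvo; simp [hoz, b2]
      · by_cases hvz : v = z
        · subst hvz; simp [hvo, b3]
        · simp [hvo, hvz, b1 v hvo hvz]
  obtain ⟨l, hl, he⟩ := stk_surj Finset.univ z _ σ o rfl (fun u hu => absurd (Finset.mem_univ u) hu)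
    (hbal.perm fun u => (hperm u).symm) (fun u _ => hlead _ u rfl)
  have := stk_euler (G := G) l o (fun u => by rw [hl]; exact (hperm u).nodup_iff.2 (holn u))
    (fun u e he => by rw [hl] at he; exact (hol u e).1 ((hperm u).mem_iff.1 he))
  rw [he] at this
  refine ⟨l, this.1, this.2, fun e => ?_⟩
  rw [stk_mem_iff (dst := G.dst) l o e]
  refine ⟨G.src e, ?_⟩
  rw [hl]
  exact (hperm _).mem_iff.2 ((hol _ _).2 rfl)

end euler

lemma list_perm_lift {E κ : Type} (key : E → κ) {k k' : List κ} (h : k.Perm k') :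
    ∃ φ : List E → List E, (∀ L, L.map key = k → (φ L).map key = k' ∧ (φ L).Perm L) ∧
      ∀ L L', L.map key = k → L'.map key = k → φ L = φ L' → L = L' := by
  induction h with
  | nil => exact ⟨id, fun L h => ⟨h, List.Perm.refl _⟩, fun L L' _ _ h => h⟩
  | cons x _ ih =>
    obtain ⟨φ, h1, h2⟩ := ih
    refine ⟨fun L => match L with | [] => [] | e :: L => e :: φ L, fun L h => ?_, fun L L' h h' he => ?_⟩
    · cases L with
      | nil => simp at h
      | cons e L =>
        rw [List.map_cons] at h
        obtain ⟨e1, e2⟩ := List.cons.inj h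
        have := h1 L e2
        exact ⟨by simp only [List.map_cons]; rw [e1, this.1], this.2.cons _⟩
    · cases L with
      | nil => simp at h
      | cons e L =>
        cases L' with
        | nil => simp at h'
        | cons e' L' =>
          rw [List.map_cons] at h h'
          obtain ⟨e1, e2⟩ := List.cons.inj he
          rw [e1, h2 L L' (List.cons.inj h).2 (List.cons.inj h').2 e2]
  | swap x y l =>
    refine ⟨fun L => match L with | e :: e' :: L => e' :: e :: L | L => L, fun L h => ?_, fun L L' h h' he => ?_⟩
    · match L, h with
      | e :: e' :: L, h =>
        simp only [List.map_cons, List.cons.injEq] at h ⊢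
        exact ⟨⟨h.2.1, h.1, h.2.2⟩, List.Perm.swap _ _ _⟩
    · match L, L', h, h', he with
      | e :: e' :: L, f :: f' :: L', h, h', he =>
        simp only [List.cons.injEq] at he ⊢
        exact ⟨he.2.1, he.1, he.2.2⟩
  | trans _ _ ih1 ih2 =>
    obtain ⟨φ, h1, h2⟩ := ih1
    obtain ⟨ψ, g1, g2⟩ := ih2
    refine ⟨ψ ∘ φ, fun L h => ⟨(g1 _ (h1 L h).1).1, (g1 _ (h1 L h).1).2.trans (h1 L h).2⟩,
      fun L L' h h' he => h2 L L' h h' (g2 _ _ (h1 L h).1 (h1 L' h').1 he)⟩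

section words
variable {V E : Type} (ι : V → S) {G : DigraphStruct V E}

lemma steps_path {o z : V} {L : List E} (h : IsPathList G o z L) :
    steps (ι o :: L.map (fun e => ι (G.dst e))) = L.map (fun e => (ι (G.src e), ι (G.dst e))) := by
  induction L generalizing o with
  | nil => simp
  | cons e L ih =>
    obtain ⟨h1, h2⟩ := h
    rw [List.map_cons, steps_cons_cons, ih h2, List.map_cons, h1]

lemma path_last {o z : V} {L : List E} (h : IsPathList G o z L) :
    ∃ b, ι o :: L.map (fun e => ι (G.dst e)) = b ++ [ι z] := by
  induction L generalizing o with
  | nil => exact ⟨[], by cases h; rfl⟩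
  | cons e L ih =>
    obtain ⟨b, hb⟩ := ih h.2
    exact ⟨ι o :: b, by rw [List.map_cons, hb]; rfl⟩

variable {ι}
lemma path_of_steps (hι : Function.Injective ι) {o : V} {L : List E} {t : List S}
    (h : L.map (fun e => (ι (G.src e), ι (G.dst e))) = steps (ι o :: t)) :
    ∃ z, IsPathList G o z L ∧ L.map (fun e => ι (G.dst e)) = t := by
  induction L generalizing o t with
  | nil =>
    cases t with
    | nil => exact ⟨o, rfl, rfl⟩
    | cons s t => simp at h
  | cons e L ih =>
    cases t with
    | nil => simp at h
    | cons s t =>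
      rw [List.map_cons, steps_cons_cons] at h
      obtain ⟨h1, h2⟩ := List.cons.inj h
      obtain ⟨h3, h4⟩ := Prod.ext_iff.1 h1
      simp only at h3 h4
      subst h4
      obtain ⟨z, hz, ht⟩ := ih h2
      exact ⟨z, ⟨hι h3, hz⟩, by rw [List.map_cons, ht]⟩

lemma euler_fiber (hι : Function.Injective ι) {o z : V} {a a' : List S} {L0 : List E} (h0 : IsEulerList G o z L0)
    (ha : LEqv (ι o :: L0.map (fun e => ι (G.dst e))) a) (ha' : LEqv (ι o :: L0.map (fun e => ι (G.dst e))) a')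
    (𝓔 : Finset (List E)) (h𝓔 : ∀ L, L ∈ 𝓔 ↔ IsEulerList G o z L) [DecidableEq (List S)] :
    (𝓔.filter (fun L => ι o :: L.map (fun e => ι (G.dst e)) = a)).card ≤
    (𝓔.filter (fun L => ι o :: L.map (fun e => ι (G.dst e)) = a')).card := by
  obtain ⟨φ, h1, h2⟩ := list_perm_lift (fun e => (ι (G.src e), ι (G.dst e))) (ha.symm.trans ha').2
  have hk : ∀ L ∈ 𝓔.filter (fun L => ι o :: L.map (fun e => ι (G.dst e)) = a),
      L.map (fun e => (ι (G.src e), ι (G.dst e))) = steps a := by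
    intro L hL
    simp only [Finset.mem_filter, h𝓔] at hL
    rw [← hL.2, steps_path ι hL.1.1]
  refine Finset.card_le_card_of_injOn φ ?_ ?_
  · intro L hL
    have := hk L hL
    obtain ⟨e1, e2⟩ := h1 L this
    simp only [Finset.coe_filter, mem_setOf_eq, h𝓔] at hL ⊢
    obtain ⟨t, rfl⟩ : ∃ t, a' = ι o :: t := by
      have := ha'.1
      cases a' with
      | nil => simp at this
      | cons s t => simp at this; exact ⟨t, by rw [this]⟩
    obtain ⟨z', hz', ht⟩ := path_of_steps hι e1
    obtain ⟨b, hb⟩ := path_last ι hz'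
    obtain ⟨b0, hb0⟩ := path_last ι h0.1
    rw [ht] at hb
    rw [hb0, hb] at ha'
    have := hι ha'.last_eq
    subst this
    exact ⟨⟨hz', e2.nodup_iff.2 hL.1.2.1, fun e => e2.mem_iff.2 (hL.1.2.2 e)⟩, by rw [ht]⟩
  · intro L hL L' hL' he
    exact h2 L L' (hk L hL) (hk L' hL') he

lemma euler_finite [Finite E] {o z : V} : {L : List E | IsEulerList G o z L}.Finite := by
  classical
  have := Fintype.ofFinite E
  refine (((Finset.univ : Finset E).toList.permutations.toFinset).finite_toSet).subset ?_
  intro L hL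
  simp only [List.coe_toFinset, mem_setOf_eq, List.mem_permutations]
  rw [List.perm_ext_iff_of_nodup hL.2.1 (Finset.nodup_toList _)]
  intro e; simp [hL.2.2 e]

/-- Averages over Eulerian paths are averages over words. -/
lemma euler_sum (hι : Function.Injective ι) [Finite E] {o z : V} {L0 : List E} (h0 : IsEulerList G o z L0)
    (g : List S → ℝ≥0∞) :
    (∑' L : {L : List E // IsEulerList G o z L}, g (ι o :: L.1.map (fun e => ι (G.dst e)))) /
      (Nat.card {L : List E // IsEulerList G o z L} : ℝ≥0∞) =
    ((clF (ι o :: L0.map (fun e => ι (G.dst e)))).card : ℝ≥0∞)⁻¹ *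
      ∑ a ∈ clF (ι o :: L0.map (fun e => ι (G.dst e))), g a := by
  classical
  set a0 := ι o :: L0.map (fun e => ι (G.dst e)) with ha0
  let 𝓔 := (euler_finite (G := G) (o := o) (z := z)).toFinset
  have h𝓔 : ∀ L, L ∈ 𝓔 ↔ IsEulerList G o z L := by intro L; simp [𝓔]
  have := Fintype.subtype 𝓔 h𝓔
  rw [tsum_fintype, ← Finset.sum_subtype 𝓔 h𝓔 (fun L => g (ι o :: L.map (fun e => ι (G.dst e)))),
    Nat.subtype_card 𝓔 h𝓔]
  have hmaps : ∀ L ∈ 𝓔, (ι o :: L.map (fun e => ι (G.dst e))) ∈ clF a0 := by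
    intro L hL
    have hL := (h𝓔 L).1 hL
    rw [mem_clF]
    refine ⟨by simp [ha0], ?_⟩
    rw [ha0, steps_path ι h0.1, steps_path ι hL.1]
    refine List.Perm.map _ ?_
    rw [List.perm_ext_iff_of_nodup h0.2.1 hL.2.1]
    intro e; simp [h0.2.2 e, hL.2.2 e]
  set K := (𝓔.filter (fun L => ι o :: L.map (fun e => ι (G.dst e)) = a0)).card with hK
  have hfib : ∀ a ∈ clF a0, (𝓔.filter (fun L => ι o :: L.map (fun e => ι (G.dst e)) = a)).card = K := by
    intro a ha
    rw [mem_clF] at ha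
    exact le_antisymm (euler_fiber hι h0 ha (LEqv.refl _) 𝓔 h𝓔) (euler_fiber hι h0 (LEqv.refl _) ha 𝓔 h𝓔)
  have hK0 : K ≠ 0 := by
    rw [hK, Finset.card_ne_zero]
    exact ⟨L0, by simp [h𝓔, h0, ha0]⟩
  have hcard : 𝓔.card = (clF a0).card * K := by
    rw [Finset.card_eq_sum_card_fiberwise hmaps, Finset.sum_congr rfl hfib, Finset.sum_const, smul_eq_mul]
  have hsum : ∑ L ∈ 𝓔, g (ι o :: L.map (fun e => ι (G.dst e))) = K * ∑ a ∈ clF a0, g a := by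
    rw [← Finset.sum_fiberwise_of_maps_to hmaps, Finset.mul_sum]
    refine Finset.sum_congr rfl fun a ha => ?_
    rw [← hfib a ha, ← nsmul_eq_mul, ← Finset.sum_const]
    refine Finset.sum_congr rfl fun L hL => ?_
    rw [(Finset.mem_filter.1 hL).2]
  rw [hsum, hcard, Nat.cast_mul, ENNReal.div_eq_inv_mul, ENNReal.mul_inv (Or.inr (ENNReal.natCast_ne_top _))
    (Or.inl (ENNReal.natCast_ne_top _)), mul_assoc, ← mul_assoc (K : ℝ≥0∞)⁻¹,
    ENNReal.inv_mul_cancel (by exact_mod_cast hK0) (ENNReal.natCast_ne_top _), one_mul]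

end words

section meas
variable [MeasurableSpace S] [DiscreteMeasurableSpace S] [Countable S]

lemma mixed_eq {V E : Type} [Finite E] {ι : V → S} (hι : Function.Injective ι) {G : DigraphStruct V E} {o z : V}
    {L0 : List E} (h0 : IsEulerList G o z L0) (ν : Measure (ℕ → S)) {A : Set (ℕ → S)} (hA : MeasurableSet A) :
    (∑' L : {L : List E // IsEulerList G o z L},
        ν ((fun y => concatSeq (ι o :: (L : List E).map fun e => ι (G.dst e)) y) ⁻¹' A)) /
          (Nat.card {L : List E // IsEulerList G o z L} : ℝ≥0∞) =
    (((clF (ι o :: L0.map (fun e => ι (G.dst e)))).card : ℝ≥0∞)⁻¹ •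
      mixm (ι o :: L0.map (fun e => ι (G.dst e))) ν) A := by
  rw [Measure.smul_apply, mix_apply _ _ hA, smul_eq_mul, ← euler_sum hι h0 (fun a => ν (cat a ⁻¹' A))]
  rfl

lemma mixed_extreme {μ : Measure (ℕ → S)} (h : IsMixedLaw μ) : IsExtremePE μ := by
  obtain ⟨Vf, Ef, hE, G, o, z, Vr, p, s1, ν, hG, hdis, hMC, hr, hμ⟩ := h
  obtain ⟨L0, h0⟩ := euler_exists hG
  have : μ = ((clF ((o : S) :: L0.map (fun e => (G.dst e : S)))).card : ℝ≥0∞)⁻¹ •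
      mixm ((o : S) :: L0.map (fun e => (G.dst e : S))) ν := by
    ext A hA
    rw [hμ A hA]
    exact mixed_eq (ι := Subtype.val) Subtype.val_injective h0 ν hA
  rw [this]
  refine mix_extreme hMC (mc_recAt hMC hr) (by simp) ?_
  intro x hx
  have hxV : x ∈ Vf := by
    rw [List.mem_cons, List.mem_map] at hx
    rcases hx with rfl | ⟨e, _, rfl⟩
    · exact o.2
    · exact (G.dst e).2
  exact Set.disjoint_left.1 hdis hxV

end meas

end PartP8c

section PartP9a

open Classical in
noncomputable def cnt (x : ℕ → S) (p : S × S) (n : ℕ) : ℕ := (steps (pre x (n + 1))).count p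

open Classical in
lemma cnt_succ (x : ℕ → S) (p : S × S) (n : ℕ) :
    cnt x p (n + 1) = cnt x p n + if (x n, x (n + 1)) = p then 1 else 0 := by
  have h : pre x (n + 1 + 1) = pre x n ++ [x n] ++ x (n + 1) :: [] := by
    rw [pre_succ, pre_succ]
  rw [cnt, h, steps_mid, List.count_append, ← pre_succ, cnt]
  simp [List.count_singleton]

@[simp] lemma cnt_zero (x : ℕ → S) (p : S × S) : cnt x p 0 = 0 := by
  simp [cnt, pre]

lemma cnt_mono (x : ℕ → S) (p : S × S) : Monotone (cnt x p) :=
  monotone_nat_of_le_succ fun n => by rw [cnt_succ]; omega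

def Ev (p : S × S) (k : ℕ) : Set (ℕ → S) := {x | ∃ N, ∀ n, N ≤ n → cnt x p n = k}

lemma cnt_le {x : ℕ → S} {p : S × S} {k : ℕ} (h : x ∈ Ev p k) (n : ℕ) : cnt x p n ≤ k := by
  obtain ⟨N, hN⟩ := h
  rw [← hN (max N n) (le_max_left _ _)]
  exact cnt_mono x p (le_max_right _ _)

section p9a
variable [MeasurableSpace S] [DiscreteMeasurableSpace S] [Countable S]

lemma measurableSet_Ev (p : S × S) (k : ℕ) : MeasurableSet (Ev p k : Set (ℕ → S)) := by
  classical
  have : (Ev p k : Set (ℕ → S)) = ⋃ N, ⋂ n, ⋂ (_ : N ≤ n), {x | cnt x p n = k} := by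
    ext x; simp [Ev]
  rw [this]
  refine MeasurableSet.iUnion fun N => MeasurableSet.iInter fun n => MeasurableSet.iInter fun _ => ?_
  exact measurableSet_pre (n + 1) {l | (steps l).count p = k}

lemma pre_cat (a : List S) (ω : ℕ → S) (n : ℕ) : pre (cat a ω) (a.length + n) = a ++ pre ω n := by
  rw [pre_add, shift_cat]
  congr 1
  exact cat_mem_cyl a ω

lemma pinv_Ev (p : S × S) (k : ℕ) : PInv (Ev p k : Set (ℕ → S)) := by
  classical
  rintro a a' s ω h hs ⟨N, hN⟩
  have key : ∀ m, cnt (cat a' ω) p (a.length + m) = cnt (cat a ω) p (a.length + m) := by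
    intro m
    have e1 : pre (cat a ω) (a.length + m + 1) = a ++ s :: pre (shift 1 ω) m := by
      rw [add_assoc, pre_cat, pre_succ', hs]
    have e2 : pre (cat a' ω) (a.length + m + 1) = a' ++ s :: pre (shift 1 ω) m := by
      rw [h.len, add_assoc, pre_cat, pre_succ', hs]
    rw [cnt, cnt, e1, e2]
    exact ((h.append_right _).2.count_eq p).symm
  refine ⟨N + a.length, fun n hn => ?_⟩
  obtain ⟨m, rfl⟩ := Nat.exists_eq_add_of_le (show a.length ≤ n by omega)
  rw [key]; exact hN _ (by omega)

def Io (v : S) : Set (ℕ → S) := {ω | ∀ n, ∃ m, n ≤ m ∧ ω m = v}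

lemma io_shift (v : S) (n : ℕ) (ω : ℕ → S) : shift n ω ∈ Io v ↔ ω ∈ Io v := by
  constructor
  · intro h k
    obtain ⟨m, h1, h2⟩ := h k
    exact ⟨n + m, by omega, h2⟩
  · intro h k
    obtain ⟨m, h1, h2⟩ := h (n + k)
    exact ⟨m - n, by omega, by rw [shift, show n + (m - n) = m by omega]; exact h2⟩

lemma pinv_Io (v : S) : PInv (Io v) := by
  intro a a' s ω _ _ hm
  rw [← io_shift v a.length, shift_cat] at hm
  rwa [← io_shift v a'.length, shift_cat]

lemma ev_of_not_io {x : ℕ → S} {u : S} (h : x ∉ Io u) (v : S) : ∃ k, x ∈ Ev (u, v) k := by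
  classical
  simp only [Io, mem_setOf_eq] at h
  push Not at h
  obtain ⟨N, hN⟩ := h
  refine ⟨cnt x (u, v) N, N, fun n hn => ?_⟩
  induction n, hn using Nat.le_induction with
  | base => rfl
  | succ n hn ih =>
    rw [cnt_succ, ih, if_neg (fun h => hN n hn (Prod.ext_iff.1 h).1)]; rfl

lemma ext_start {μ : Measure (ℕ → S)} (h : IsExtremePE μ) : ∃ o, ∀ᵐ ω ∂μ, ω 0 = o := by
  have := h.prob
  by_contra hc
  rw [not_exists] at hc
  have : ∀ o, ∀ᵐ ω ∂μ, ω ∉ cyl [o] := by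
    intro o
    rcases ext_ae h (measurableSet_cyl [o]) (pinv_start o) with h1 | h1
    · exact h1
    · exact absurd (h1.mono fun ω hω => mem_cyl_single.1 hω) (hc o)
  obtain ⟨ω, hω⟩ := (ae_all_iff.2 this).exists
  exact hω (ω 0) (mem_cyl_single.2 rfl)

lemma ext_ev {μ : Measure (ℕ → S)} (h : IsExtremePE μ) {u : S} (hu : ∀ᵐ ω ∂μ, ω ∉ Io u) (v : S) :
    ∃ k, ∀ᵐ ω ∂μ, ω ∈ Ev (u, v) k := by
  have := h.prob
  by_contra hc
  rw [not_exists] at hc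
  have : ∀ k, ∀ᵐ ω ∂μ, ω ∉ Ev (u, v) k := by
    intro k
    rcases ext_ae h (measurableSet_Ev (u, v) k) (pinv_Ev (u, v) k) with h1 | h1
    · exact h1
    · exact absurd h1 (hc k)
  obtain ⟨ω, hω, h2⟩ := ((ae_all_iff.2 this).and hu).exists
  obtain ⟨k, hk⟩ := ev_of_not_io h2 v
  exact hω k hk

lemma ext_io {μ : Measure (ℕ → S)} (h : IsExtremePE μ) (u : S) :
    (∀ᵐ ω ∂μ, ω ∉ Io u) ∨ ∀ᵐ ω ∂μ, ω ∈ Io u :=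
  ext_ae h (measurableSet_io u) (pinv_Io u)

lemma ext_caseA {μ : Measure (ℕ → S)} (h : IsExtremePE μ) {o : S} (ho : ∀ᵐ ω ∂μ, ω 0 = o)
    (hr : ∀ᵐ ω ∂μ, ω ∈ Io o) : IsRecMCLaw μ := by
  have := h.prob
  have hrec : RecAt o μ := by filter_upwards [ho, hr] with ω h1 h2 using ⟨h1, h2⟩
  obtain ⟨S', p, h1, _⟩ := ext_rec h hrec
  exact ⟨S', p, o, h1, hrec.infinite⟩

end p9a

end PartP9a

section PartP9b

lemma sourced_of_path {V E : Type} {G : DigraphStruct V E} {o : V} {γ : ℕ → E}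
    (hp : ∀ i, G.dst (γ i) = G.src (γ (i + 1))) (h0 : G.src (γ 0) = o) (hb : Function.Bijective γ)
    (hv : ∀ v, ∃ i, G.src (γ i) = v) (hf : ∀ v, {i | G.src (γ i) = v}.Finite) :
    G.IsSourcedEulerian o := by
  have hout : ∀ v, G.outEdges v = γ '' {i | G.src (γ i) = v} := by
    intro v; ext e
    obtain ⟨i, rfl⟩ := hb.2 e
    simp [DigraphStruct.outEdges, hb.1.eq_iff]
  have hin : ∀ v, G.inEdges v = γ '' {i | G.src (γ (i + 1)) = v} := by
    intro v; ext e
    obtain ⟨i, rfl⟩ := hb.2 e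
    simp [DigraphStruct.inEdges, hb.1.eq_iff, hp]
  have hf' : ∀ v, {i | G.src (γ (i + 1)) = v}.Finite := fun v =>
    (hf v).preimage (f := fun i => i + 1) (fun a _ b _ h => by simpa using h)
  have hsplit : ∀ v, {i | G.src (γ i) = v} =
      (fun i => i + 1) '' {i | G.src (γ (i + 1)) = v} ∪ {i | i = 0 ∧ o = v} := by
    intro v; ext i
    cases i with
    | zero => simp [h0]
    | succ i => simp
  have hinj : Function.Injective (fun i : ℕ => i + 1) := fun a b h => by simpa using h
  have hi : ∀ v, G.inDeg v = {i | G.src (γ (i + 1)) = v}.ncard := fun v => by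
    rw [DigraphStruct.inDeg, hin, Set.ncard_image_of_injective _ hb.1]
  have ho : ∀ v, G.outDeg v = {i | G.src (γ i) = v}.ncard := fun v => by
    rw [DigraphStruct.outDeg, hout, Set.ncard_image_of_injective _ hb.1]
  have hreach : ∀ i, Relation.ReflTransGen G.undirAdj o (G.src (γ i)) ∧
      Relation.ReflTransGen G.undirAdj (G.src (γ i)) o := by
    intro i
    induction i with
    | zero => rw [h0]; exact ⟨.refl, .refl⟩
    | succ i ih =>
      exact ⟨ih.1.tail ⟨γ i, Or.inl ⟨rfl, hp i⟩⟩, Relation.ReflTransGen.head ⟨γ i, Or.inr ⟨rfl, hp i⟩⟩ ih.2⟩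
  refine ⟨?_, ?_, ?_, ?_, ?_⟩
  · by_contra hc
    rw [not_infinite_iff_finite] at hc
    have : (⋃ v, {i | G.src (γ i) = v}).Finite := Set.finite_iUnion hf
    refine Set.infinite_univ (this.subset fun i _ => ?_)
    simp
  · intro v
    rw [hout, hin]
    exact ⟨(hf v).image _, (hf' v).image _⟩
  · intro u v
    obtain ⟨i, rfl⟩ := hv u
    obtain ⟨j, rfl⟩ := hv v
    exact (hreach i).2.trans (hreach j).1
  · intro v hvo
    rw [hi, ho, hsplit v]
    have : {i : ℕ | i = 0 ∧ o = v} = ∅ := by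
      ext i; simp only [mem_setOf_eq, mem_empty_iff_false, iff_false]; exact fun h => hvo h.2.symm
    rw [this, Set.union_empty, Set.ncard_image_of_injective _ hinj]
  · rw [hi, ho, hsplit o]
    have : {i : ℕ | i = 0 ∧ o = o} = {0} := by ext; simp
    rw [this, Set.ncard_union_eq (by simp) ((hf' o).image _) (Set.finite_singleton _),
      Set.ncard_image_of_injective _ hinj, Set.ncard_singleton]

/-- labelled transitions -/
@[ext] structure LE (M : S × S → ℕ) where
  key : S × S
  idx : ℕ
  lt : idx < M key

lemma lab_lt {M : S × S → ℕ} {x : ℕ → S} (h : ∀ p, x ∈ Ev p (M p)) (i : ℕ) :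
    cnt x (x i, x (i + 1)) i < M (x i, x (i + 1)) := by
  have := cnt_le (h (x i, x (i + 1))) (i + 1)
  rw [cnt_succ, if_pos rfl] at this
  omega

noncomputable def lab {M : S × S → ℕ} {x : ℕ → S} (h : ∀ p, x ∈ Ev p (M p)) (i : ℕ) : LE M :=
  ⟨(x i, x (i + 1)), cnt x (x i, x (i + 1)) i, lab_lt h i⟩

lemma lab_bij {M : S × S → ℕ} {x : ℕ → S} (h : ∀ p, x ∈ Ev p (M p)) : Function.Bijective (lab h) := by
  classical
  have key : ∀ i j, i < j → lab h i ≠ lab h j := by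
    intro i j hij he
    have h1 := congrArg (fun q : LE M => q.key) he
    have h2 := congrArg (fun q : LE M => q.idx) he
    simp only [lab] at h1 h2
    rw [← h1] at h2
    have := cnt_mono x (x i, x (i + 1)) (show i + 1 ≤ j from hij)
    rw [cnt_succ, if_pos rfl] at this
    omega
  constructor
  · intro i j he
    rcases lt_trichotomy i j with hl | hl | hl
    · exact absurd he (key i j hl)
    · exact hl
    · exact absurd he.symm (key j i hl)
  · rintro ⟨p, k, hk⟩
    obtain ⟨N, hN⟩ := h p
    have hex : ∃ n, k < cnt x p n := ⟨N, by rw [hN N le_rfl]; exact hk⟩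
    obtain ⟨n, hn⟩ : ∃ n, Nat.find hex = n + 1 := by
      cases hc : Nat.find hex with
      | zero => have := Nat.find_spec hex; rw [hc, cnt_zero] at this; omega
      | succ n => exact ⟨n, rfl⟩
    have h1 := Nat.find_spec hex
    have h2 : ¬ k < cnt x p n := Nat.find_min hex (by omega)
    rw [hn, cnt_succ] at h1
    split_ifs at h1 with hp
    · refine ⟨n, LE.ext hp ?_⟩
      simp only [lab]
      rw [hp]
      omega
    · omega

section outer
variable [MeasurableSpace S] [DiscreteMeasurableSpace S] [Countable S]

lemma tail_eq_outer_le {μ : Measure (ℕ → S)} [IsFiniteMeasure μ] (h : LPE μ) {a a' : List S} {s : S}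
    (ha : LEqv (a ++ [s]) (a' ++ [s])) (C : Set (ℕ → S)) (hCs : C ⊆ cyl [s]) :
    μ (cyl a ∩ shift a.length ⁻¹' C) ≤ μ (cyl a' ∩ shift a'.length ⁻¹' C) := by
  set T := toMeasurable μ (cyl a' ∩ shift a'.length ⁻¹' C) with hT
  have hTm : MeasurableSet T := measurableSet_toMeasurable _ _
  have hDm : MeasurableSet (cat a' ⁻¹' T ∩ cyl [s]) :=
    (measurable_cat a' hTm).inter (measurableSet_cyl _)
  have hCD : C ⊆ cat a' ⁻¹' T ∩ cyl [s] := by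
    intro y hy
    refine ⟨subset_toMeasurable _ _ ⟨cat_mem_cyl _ _, ?_⟩, hCs hy⟩
    rw [mem_preimage, shift_cat]; exact hy
  calc μ (cyl a ∩ shift a.length ⁻¹' C) ≤ μ (cyl a ∩ shift a.length ⁻¹' (cat a' ⁻¹' T ∩ cyl [s])) :=
        measure_mono (inter_subset_inter_right _ (preimage_mono hCD))
    _ = μ (cyl a' ∩ shift a'.length ⁻¹' (cat a' ⁻¹' T ∩ cyl [s])) := tail_eq h ha hDm inter_subset_right
    _ ≤ μ T := by
        refine measure_mono ?_
        rintro x ⟨h1, h2, _⟩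
        rw [mem_preimage, cat_shift h1] at h2
        exact h2
    _ = _ := measure_toMeasurable _

lemma tail_eq_outer {μ : Measure (ℕ → S)} [IsFiniteMeasure μ] (h : LPE μ) {a a' : List S} {s : S}
    (ha : LEqv (a ++ [s]) (a' ++ [s])) (C : Set (ℕ → S)) (hCs : C ⊆ cyl [s]) :
    μ (cyl a ∩ shift a.length ⁻¹' C) = μ (cyl a' ∩ shift a'.length ⁻¹' C) :=
  le_antisymm (tail_eq_outer_le h ha C hCs) (tail_eq_outer_le h ha.symm C hCs)

/-- step sequence -/
def st (x : ℕ → S) : ℕ → S × S := fun i => (x i, x (i + 1))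

lemma st_emb : MeasurableEmbedding (st : (ℕ → S) → (ℕ → S × S)) := by
  have hm : Measurable (st : (ℕ → S) → (ℕ → S × S)) :=
    measurable_pi_lambda _ fun i => (measurable_pi_apply i).prodMk (measurable_pi_apply (i + 1))
  have hg : Measurable (fun (k : ℕ → S × S) (i : ℕ) => (k i).1) :=
    measurable_pi_lambda _ fun i => (measurable_pi_apply i).fst
  refine MeasurableEmbedding.of_measurable_inverse hm ?_ hg (fun x => rfl)
  have : range (st : (ℕ → S) → (ℕ → S × S)) = {k | ∀ i, (k i).2 = (k (i + 1)).1} := by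
    ext k
    constructor
    · rintro ⟨x, rfl⟩ i; rfl
    · intro hk
      refine ⟨fun i => (k i).1, ?_⟩
      funext i
      exact Prod.ext rfl (hk i).symm
  rw [this]
  change MeasurableSet {k : ℕ → S × S | ∀ i, (k i).2 = (k (i + 1)).1}
  rw [setOf_forall]
  refine MeasurableSet.iInter fun i => ?_
  exact measurableSet_eq_fun (measurable_pi_apply i).snd (measurable_pi_apply (i + 1)).fst

/-- the coarse sigma algebra -/
instance mLE (M : S × S → ℕ) : MeasurableSpace (LE M) := MeasurableSpace.comap LE.key inferInstance

end outer

end PartP9b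

section PartP9c

section p9c
variable [MeasurableSpace S] [DiscreteMeasurableSpace S] [Countable S]

/-- keys of an edge sequence -/
def KK {M : S × S → ℕ} (γ : ℕ → LE M) : ℕ → S × S := fun i => (γ i).key

lemma pi_comap (M : S × S → ℕ) :
    (MeasurableSpace.pi : MeasurableSpace (ℕ → LE M)) =
      MeasurableSpace.comap (KK : (ℕ → LE M) → (ℕ → S × S)) MeasurableSpace.pi := by
  simp only [MeasurableSpace.pi, MeasurableSpace.comap_iSup, MeasurableSpace.comap_comp, mLE]
  rfl

open Classical in
noncomputable def sel {M : S × S → ℕ} (q0 : LE M) (p : S × S) : LE M :=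
  if h : 0 < M p then ⟨p, 0, h⟩ else q0

noncomputable def jj {M : S × S → ℕ} (q0 : LE M) (x : ℕ → S) : ℕ → LE M := fun i => sel q0 (st x i)

lemma measurable_KK (M : S × S → ℕ) : Measurable (KK : (ℕ → LE M) → (ℕ → S × S)) := by
  rw [measurable_iff_comap_le, pi_comap]

lemma measurable_jj {M : S × S → ℕ} (q0 : LE M) : Measurable (jj q0 : (ℕ → S) → (ℕ → LE M)) := by
  refine measurable_pi_lambda _ fun i => ?_
  have h1 : Measurable (sel q0 : S × S → LE M) := measurable_of_countable _
  exact h1.comp ((measurable_pi_apply i).comp st_emb.measurable)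

lemma KK_jj {M : S × S → ℕ} (q0 : LE M) {x : ℕ → S} (h : ∀ p, x ∈ Ev p (M p)) : KK (jj q0 x) = st x := by
  funext i
  have : 0 < M (st x i) := lt_of_le_of_lt (Nat.zero_le _) (lab_lt h i)
  simp [KK, jj, sel, this]

lemma outer_map {M : S × S → ℕ} (q0 : LE M) {μ : Measure (ℕ → S)}
    (hM : ∀ᵐ x ∂μ, ∀ p, x ∈ Ev p (M p)) (F : Set (ℕ → LE M)) :
    μ.map (jj q0) F = μ {x | ∃ γ ∈ F, KK γ = st x} := by
  have hj := measurable_jj q0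
  apply le_antisymm
  · set T := toMeasurable μ {x | ∃ γ ∈ F, KK γ = st x} with hT
    have hTm : MeasurableSet T := measurableSet_toMeasurable _ _
    have hC : MeasurableSet (KK ⁻¹' (st '' T ∪ (range st)ᶜ) : Set (ℕ → LE M)) :=
      measurable_KK M ((st_emb.measurableSet_image.2 hTm).union st_emb.measurableSet_range.compl)
    calc μ.map (jj q0) F ≤ μ.map (jj q0) (KK ⁻¹' (st '' T ∪ (range st)ᶜ)) := by
          refine measure_mono fun γ hγ => ?_
          by_cases hr : KK γ ∈ range st
          · obtain ⟨x, hx⟩ := hr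
            exact Or.inl ⟨x, subset_toMeasurable _ _ ⟨γ, hγ, hx.symm⟩, hx⟩
          · exact Or.inr hr
      _ = μ (jj q0 ⁻¹' (KK ⁻¹' (st '' T ∪ (range st)ᶜ))) := Measure.map_apply hj hC
      _ ≤ μ T := by
          refine measure_mono_ae ?_
          filter_upwards [hM] with x hx hm
          have hm' : KK (jj q0 x) ∈ st '' T ∪ (range st)ᶜ := hm
          rw [KK_jj q0 hx] at hm'
          rcases hm' with ⟨y, hy, he⟩ | h
          · have := st_emb.injective he
            subst this; exact hy
          · exact absurd ⟨x, rfl⟩ h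
      _ = _ := measure_toMeasurable _
  · set T := toMeasurable (μ.map (jj q0)) F with hT
    have hTm : MeasurableSet T := measurableSet_toMeasurable _ _
    have hTm' := hTm
    rw [pi_comap] at hTm'
    obtain ⟨D, hD, hDT⟩ := hTm'
    rw [← measure_toMeasurable F, ← hT, Measure.map_apply hj hTm]
    refine measure_mono_ae ?_
    filter_upwards [hM] with x hx hm
    obtain ⟨γ, hγ, he⟩ := hm
    have h1 : γ ∈ T := subset_toMeasurable _ _ hγ
    change jj q0 x ∈ T
    rw [← hDT] at h1 ⊢
    change KK (jj q0 x) ∈ D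
    rw [KK_jj q0 hx, ← he]
    exact h1

lemma gibbs_words {n : ℕ} {M : S × S → ℕ} {o : S} (w : Fin (n + 1) → LE M)
    (h0 : (w 0).key.1 = o)
    (hp : ∀ (i : ℕ) (h : i + 1 < n + 1), (w ⟨i, Nat.lt_of_succ_lt h⟩).key.2 = (w ⟨i + 1, h⟩).key.1) :
    ∃ y : ℕ → S, y 0 = o ∧ ∀ i : Fin (n + 1), st y i = (w i).key := by
  refine ⟨fun i => if h : i < n + 1 then (w ⟨i, h⟩).key.1 else (w (Fin.last n)).key.2, ?_, ?_⟩
  · simpa using h0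
  · rintro ⟨i, hi⟩
    refine Prod.ext ?_ ?_
    · simp [st, hi]
    · by_cases h : i + 1 < n + 1
      · simp only [st, h, dif_pos]; exact (hp i h).symm
      · have : i = n := by omega
        subst this
        simp only [st, h, dif_neg, not_false_eq_true]; rfl

lemma gibbs_set {n : ℕ} {M : S × S → ℕ} (w : Fin (n + 1) → LE M) {y : ℕ → S}
    (hy : ∀ i : Fin (n + 1), st y i = (w i).key) (B : Set (ℕ → LE M)) :
    {x | ∃ γ ∈ {γ : ℕ → LE M | (∀ i : Fin (n + 1), γ (i : ℕ) = w i) ∧ (fun t : ℕ => γ (n + 1 + t)) ∈ B},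
      KK γ = st x} =
    cyl (pre y (n + 1)) ∩ shift (pre y (n + 1)).length ⁻¹' ({z | ∃ γ ∈ B, KK γ = st z} ∩ cyl [y (n + 1)]) := by
  ext x
  rw [pre_length]
  constructor
  · rintro ⟨γ, ⟨h1, h2⟩, h3⟩
    have h4 : ∀ i, i < n + 1 → st x i = st y i := by
      intro i hi
      rw [hy ⟨i, hi⟩, ← h3, ← h1 ⟨i, hi⟩]; rfl
    refine ⟨mem_cyl_pre_iff.2 fun i hi => congrArg Prod.fst (h4 i hi), ⟨_, h2, ?_⟩, mem_cyl_single.2 ?_⟩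
    · funext t
      exact congrFun h3 (n + 1 + t)
    · exact congrArg Prod.snd (h4 n (Nat.lt_succ_self n))
  · rintro ⟨h1, ⟨γ, hγ, he⟩, h2⟩
    rw [mem_cyl_single] at h2
    rw [mem_cyl_pre_iff] at h1
    have h1' : ∀ i, i ≤ n + 1 → x i = y i := by
      intro i hi
      rcases Nat.lt_or_eq_of_le hi with h | h
      · exact h1 i h
      · subst h; exact h2
    refine ⟨fun i => if h : i < n + 1 then w ⟨i, h⟩ else γ (i - (n + 1)), ⟨?_, ?_⟩, ?_⟩
    · intro i; exact dif_pos i.2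
    · convert hγ using 1
      funext t
      beta_reduce
      rw [dif_neg (by omega), Nat.add_sub_cancel_left]
    · funext i
      by_cases h : i < n + 1
      · simp only [KK, h, dif_pos]
        rw [← hy ⟨i, h⟩]
        simp only [st, h1' i (by omega), h1' (i + 1) (by omega)]
      · obtain ⟨t, rfl⟩ := Nat.exists_eq_add_of_le (not_lt.1 h)
        have := congrFun he t
        simp only [KK, h, dif_neg, not_false_eq_true, Nat.add_sub_cancel_left] at this ⊢
        exact this

lemma gibbs_cond {M : S × S → ℕ} (q0 : LE M) {μ : Measure (ℕ → S)} [IsFiniteMeasure μ] (hpe : LPE μ)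
    (hM : ∀ᵐ x ∂μ, ∀ p, x ∈ Ev p (M p)) {o : S} {n : ℕ} (w w' : Fin (n + 1) → LE M)
    (hw : Function.Injective w) (hw' : Function.Injective w') (hr : range w = range w')
    (h0 : (w 0).key.1 = o) (h0' : (w' 0).key.1 = o)
    (hp : ∀ (i : ℕ) (h : i + 1 < n + 1), (w ⟨i, Nat.lt_of_succ_lt h⟩).key.2 = (w ⟨i + 1, h⟩).key.1)
    (hp' : ∀ (i : ℕ) (h : i + 1 < n + 1), (w' ⟨i, Nat.lt_of_succ_lt h⟩).key.2 = (w' ⟨i + 1, h⟩).key.1)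
    (B : Set (ℕ → LE M)) :
    μ.map (jj q0) {γ | (∀ i : Fin (n + 1), γ (i : ℕ) = w i) ∧ (fun t : ℕ => γ (n + 1 + t)) ∈ B} =
    μ.map (jj q0) {γ | (∀ i : Fin (n + 1), γ (i : ℕ) = w' i) ∧ (fun t : ℕ => γ (n + 1 + t)) ∈ B} := by
  obtain ⟨y, hy0, hy⟩ := gibbs_words w h0 hp
  obtain ⟨y', hy0', hy'⟩ := gibbs_words w' h0' hp'
  rw [outer_map q0 hM, outer_map q0 hM, gibbs_set w hy, gibbs_set w' hy']
  have hst : ∀ (w : Fin (n + 1) → LE M) (y : ℕ → S), (∀ i : Fin (n + 1), st y i = (w i).key) →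
      steps (pre y (n + 1 + 1)) = (List.ofFn w).map LE.key := by
    intro w y hy
    rw [steps_pre, List.map_ofFn]
    congr 1
    funext i
    exact hy i
  have hL : LEqv (pre y (n + 1) ++ [y (n + 1)]) (pre y' (n + 1) ++ [y' (n + 1)]) := by
    rw [← pre_succ, ← pre_succ]
    refine ⟨?_, ?_⟩
    · rw [pre_succ' y, pre_succ' y', hy0, hy0']; rfl
    · rw [hst w y hy, hst w' y' hy']
      refine List.Perm.map _ ?_
      refine (List.perm_ext_iff_of_nodup (List.nodup_ofFn.2 hw) (List.nodup_ofFn.2 hw')).2 fun a => ?_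
      rw [List.mem_ofFn, List.mem_ofFn]
      exact Set.ext_iff.1 hr a
  have hl := hL.last_eq
  rw [← hl] at hL ⊢
  exact tail_eq_outer hpe hL _ inter_subset_right

lemma ext_caseB1 {μ : Measure (ℕ → S)} (h : IsExtremePE μ) {o : S} (ho : ∀ᵐ ω ∂μ, ω 0 = o)
    (hr : ∀ v, ∀ᵐ ω ∂μ, ω ∉ Io v) : IsGibbsVertexLaw μ := by
  have := h.prob
  have hev : ∀ p : S × S, ∃ k, ∀ᵐ ω ∂μ, ω ∈ Ev p k := fun p => ext_ev h (hr p.1) p.2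
  choose M hM' using hev
  have hM : ∀ᵐ ω ∂μ, ∀ p, ω ∈ Ev p (M p) := ae_all_iff.2 hM'
  obtain ⟨x, ⟨hx0, hxM⟩, hxr⟩ := ((ho.and hM).and (ae_all_iff.2 hr)).exists
  have hsrc : ∀ q : LE M, ∃ i, lab hxM i = q := fun q => (lab_bij hxM).2 q
  let Vs : Set S := range x
  let G : DigraphStruct Vs (LE M) :=
    { src := fun q => ⟨q.key.1, by obtain ⟨i, rfl⟩ := hsrc q; exact ⟨i, rfl⟩⟩
      dst := fun q => ⟨q.key.2, by obtain ⟨i, rfl⟩ := hsrc q; exact ⟨i + 1, rfl⟩⟩ }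
  have hGs : ∀ q, (G.src q : S) = q.key.1 := fun q => rfl
  have hGd : ∀ q, (G.dst q : S) = q.key.2 := fun q => rfl
  let o' : Vs := ⟨o, 0, hx0⟩
  have hlab : ∀ {y : ℕ → S} (hy : ∀ p, y ∈ Ev p (M p)) (i : ℕ),
      G.dst (lab hy i) = G.src (lab hy (i + 1)) := fun hy i => Subtype.ext rfl
  let q0 : LE M := lab hxM 0
  have hcount : Countable (LE M) := by
    refine Function.Injective.countable (f := fun q : LE M => (q.key, q.idx)) ?_
    intro q q' he
    exact LE.ext (congrArg Prod.fst he) (congrArg Prod.snd he)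
  have hprob : IsProbabilityMeasure (μ.map (jj q0)) :=
    Measure.isProbabilityMeasure_map (measurable_jj q0).aemeasurable
  refine ⟨Vs, LE M, mLE M, G, o', hcount, ?_, μ.map (jj q0), ⟨measure_univ, ?_, ?_⟩, ?_⟩
  · refine sourced_of_path (hlab hxM) (Subtype.ext hx0) (lab_bij hxM) ?_ ?_
    · rintro ⟨_, i, rfl⟩; exact ⟨i, rfl⟩
    · rintro ⟨v, hv⟩
      have h1 : ¬ {i : ℕ | x i = v}.Infinite := fun hc => hxr v ((infinite_iff_rec v x).1 hc)
      refine (Set.not_infinite.1 h1).subset fun i hi => ?_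
      exact congrArg Subtype.val hi
  · rw [outer_map q0 hM, ← measure_univ (μ := μ)]
    refine measure_congr (eventuallyEq_univ.2 ?_)
    filter_upwards [ho, hM] with y h1 h2
    exact ⟨lab h2, ⟨hlab h2, Subtype.ext h1, lab_bij h2⟩, rfl⟩
  · intro n w w' hw hw' hrg hp hp' B
    cases n with
    | zero =>
      have : w = w' := Subsingleton.elim _ _
      rw [this]
    | succ n =>
      refine gibbs_cond q0 h.lpe hM (o := o) w w' hw hw' hrg ?_ ?_ ?_ ?_ B
      · exact congrArg Subtype.val (hp.1 (Nat.succ_pos n))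
      · exact congrArg Subtype.val (hp'.1 (Nat.succ_pos n))
      · intro i hi; exact congrArg Subtype.val (hp.2 i hi)
      · intro i hi; exact congrArg Subtype.val (hp'.2 i hi)
  · intro A hA
    rw [outer_map q0 hM]
    refine measure_congr ?_
    filter_upwards [hM] with y hy
    refine propext ⟨fun hyA => ⟨lab hy, hyA, rfl⟩, ?_⟩
    rintro ⟨γ, h1, h2⟩
    have : (fun i => (G.src (γ i) : S)) = y := by
      funext i
      exact congrArg Prod.fst (congrFun h2 i)
    rw [mem_preimage, this] at h1
    exact h1

end p9c

end PartP9c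

section PartP9d

section p9d

/-- words equal in all counts of transitions out of the transient part -/
lemma word_perm {R : Set S} {a a0 : List S} {r r0 : S} (ha : a ≠ []) (ha0 : a0 ≠ [])
    (h : ∀ x ∈ a, x ∉ R) (h0 : ∀ x ∈ a0, x ∉ R) (hr : r ∈ R) (hr0 : r0 ∈ R)
    (hh : a.head? = a0.head?) (hp : (steps (a ++ [r])).Perm (steps (a0 ++ [r0]))) :
    r = r0 ∧ LEqv a0 a := by
  have hL : LEqv (a ++ [r]) (a0 ++ [r0]) := by
    refine ⟨?_, hp⟩
    rw [List.head?_append_of_ne_nil _ ha, List.head?_append_of_ne_nil _ ha0, hh]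
  have hrr := hL.last_eq
  subst hrr
  refine ⟨rfl, hh.symm, ?_⟩
  obtain ⟨b, z, rfl⟩ : ∃ b z, a = b ++ [z] := ⟨_, _, (List.dropLast_append_getLast ha).symm⟩
  obtain ⟨b0, z0, rfl⟩ : ∃ b z, a0 = b ++ [z] := ⟨_, _, (List.dropLast_append_getLast ha0).symm⟩
  rw [steps_mid, steps_mid, steps_single] at hp
  have hz : (z, r) = (z0, r) := by
    have : (z, r) ∈ steps (b0 ++ [z0]) ++ [(z0, r)] := hp.mem_iff.1 (by simp)
    rw [List.mem_append, List.mem_singleton] at this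
    rcases this with h1 | h1
    · exact absurd hr (h0 r (steps_mem h1).2)
    · exact h1
  rw [hz, List.perm_append_right_iff] at hp
  exact hp.symm

lemma steps_of_tail {R : Set S} {ω : ℕ → S} {k : ℕ} (hk : ∀ i, k ≤ i → ω i ∈ R) {p : S × S} (hp : p.1 ∉ R)
    (n : ℕ) (hn : k ≤ n) : cnt ω p n = cnt ω p k := by
  classical
  induction n, hn using Nat.le_induction with
  | base => rfl
  | succ n hn ih =>
    rw [cnt_succ, ih, if_neg]; · rfl
    intro h
    exact hp (by rw [← h]; exact hk n hn)

/-- The good event in the mixed case. -/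
def Good (R : Set S) (M : S × S → ℕ) (o : S) (ω : ℕ → S) : Prop :=
  ω 0 = o ∧ (∀ p : S × S, p.1 ∉ R → ω ∈ Ev p (M p)) ∧ (∃ i, ω i ∈ R) ∧
    ∀ i j, ω i ∈ R → i ≤ j → ω j ∈ R

lemma Good.split {R : Set S} {M : S × S → ℕ} {o : S} {ω : ℕ → S} (h : Good R M o ω) (ho : o ∉ R) :
    ∃ k, 0 < k ∧ (∀ x ∈ pre ω k, x ∉ R) ∧ ∀ i, k ≤ i → ω i ∈ R := by
  classical
  refine ⟨Nat.find h.2.2.1, ?_, ?_, fun i hi => h.2.2.2 _ i (Nat.find_spec h.2.2.1) hi⟩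
  · rw [Nat.find_pos, h.1]; exact ho
  · intro x hx
    simp only [pre, List.mem_map, List.mem_range] at hx
    obtain ⟨i, hi, rfl⟩ := hx
    exact Nat.find_min _ hi

lemma good_pair {R : Set S} {M : S × S → ℕ} {o : S} {ω ω' : ℕ → S} (h : Good R M o ω)
    (h' : Good R M o ω') {k k' : ℕ} (hk0 : 0 < k) (hk0' : 0 < k')
    (hk : ∀ x ∈ pre ω k, x ∉ R) (hk' : ∀ x ∈ pre ω' k', x ∉ R)
    (ht : ∀ i, k ≤ i → ω i ∈ R) (ht' : ∀ i, k' ≤ i → ω' i ∈ R) :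
    ω k = ω' k' ∧ LEqv (pre ω' k') (pre ω k) := by
  classical
  have hne : ∀ {ω : ℕ → S} {k : ℕ}, 0 < k → pre ω k ≠ [] := by
    intro ω k hk hc
    have := congrArg List.length hc
    rw [pre_length, List.length_nil] at this
    omega
  have hcnt : ∀ {ω : ℕ → S} {k : ℕ}, Good R M o ω → (∀ x ∈ pre ω k, x ∉ R) → (∀ i, k ≤ i → ω i ∈ R) →
      ∀ p, (steps (pre ω k ++ [ω k])).count p = if p.1 ∈ R then 0 else M p := by
    intro ω k h hk ht p
    split_ifs with hp
    · rw [List.count_eq_zero]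
      intro hm
      have := steps_fst (pre ω k) (ω k)
      have hm2 : p.1 ∈ (steps (pre ω k ++ [ω k])).map Prod.fst := List.mem_map_of_mem hm
      rw [this] at hm2
      exact hk _ hm2 hp
    · obtain ⟨N, hN⟩ := h.2.1 p hp
      rw [← hN (max N k) (le_max_left _ _), steps_of_tail ht hp _ (le_max_right _ _), cnt, pre_succ]
  refine word_perm (hne hk0) (hne hk0') hk hk' (ht k le_rfl) (ht' k' le_rfl) ?_ ?_
  · obtain ⟨m, rfl⟩ : ∃ m, k = m + 1 := ⟨k - 1, by omega⟩
    obtain ⟨m', rfl⟩ : ∃ m, k' = m + 1 := ⟨k' - 1, by omega⟩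
    rw [pre_succ' ω, pre_succ' ω', h.1, h'.1]; rfl
  · rw [List.perm_iff_count]
    intro p
    rw [hcnt h hk ht, hcnt h' hk' ht']

end p9d

end PartP9d

section PartP9e

section p9e
variable [MeasurableSpace S] [DiscreteMeasurableSpace S] [Countable S]

lemma ae_of_aftr {μ : Measure (ℕ → S)} {a : List S} {o : S} {P : (ℕ → S) → Prop}
    (h : ∀ᵐ ω ∂(aftr μ a o), P ω) : ∀ᵐ ω ∂μ, ω ∈ cyl (a ++ [o]) → P (shift a.length ω) := by
  rw [aftr, ae_restrict_iff' (measurableSet_cyl _), aft] at h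
  have h2 := ae_of_ae_map (measurable_shift _).aemeasurable h
  rw [ae_restrict_iff' (measurableSet_cyl _)] at h2
  filter_upwards [h2] with ω hω hm
  rw [mem_cyl_append] at hm
  exact hω hm.1 hm.2

lemma stay_in {μ : Measure (ℕ → S)} [IsFiniteMeasure μ] (hpe : LPE μ) {R : Set S}
    (hR : ∀ v ∈ R, ∀ᵐ ω ∂μ, ω ∈ Io v) (hR' : ∀ v, v ∉ R → ∀ᵐ ω ∂μ, ω ∉ Io v) :
    ∀ᵐ ω ∂μ, ∀ i j, ω i ∈ R → i ≤ j → ω j ∈ R := by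
  have key : ∀ (a : List S) (r : S), ∀ᵐ ω ∂μ, r ∈ R → ω ∈ cyl (a ++ [r]) → ∀ j, shift a.length ω j ∈ R := by
    intro a r
    by_cases hr : r ∈ R
    · have hfin : IsFiniteMeasure (aftr μ a r) := aftr_finite μ a r
      have hrec : RecAt r (aftr μ a r) := by
        have h1 : ∀ᵐ ω ∂(aftr μ a r), ω ∈ Io r := aftr_ae (P := fun ω => ω ∈ Io r) (measurableSet_io r)
          ((hR r hr).mono fun ω hω _ => (io_shift r _ ω).2 hω)
        filter_upwards [h1, aftr_start μ a r] with ω h2 h3 using ⟨h3, h2⟩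
      have h4 : ∀ᵐ ω ∂(aftr μ a r), ∀ j, ω j ∈ R := by
        have h5 : ∀ᵐ ω ∂(aftr μ a r), ∀ v, v ∉ R → ω ∉ Io v := by
          rw [ae_all_iff]
          intro v
          by_cases hv : v ∈ R
          · exact Eventually.of_forall fun _ h => absurd hv h
          · have : ∀ᵐ ω ∂(aftr μ a r), ω ∉ Io v := aftr_ae (P := fun ω => ω ∉ Io v)
              (measurableSet_io v).compl ((hR' v hv).mono fun ω hω _ h => hω ((io_shift v _ ω).1 h))
            exact this.mono fun _ h _ => h
        have h6 : ∀ᵐ ω ∂(aftr μ a r), ∀ v, (∃ i, ω i = v) → ω ∈ Io v :=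
          ae_all_iff.2 fun v => visited_io (aftr_lpe hpe a r) hrec v
        filter_upwards [h5, h6] with ω h7 h8 j
        by_contra hc
        exact h7 _ hc (h8 _ ⟨j, rfl⟩)
      exact (ae_of_aftr h4).mono fun _ h _ => h
    · exact Eventually.of_forall fun _ h => absurd h hr
  have key' : ∀ᵐ ω ∂μ, ∀ (a : List S) (r : S), r ∈ R → ω ∈ cyl (a ++ [r]) → ∀ j, shift a.length ω j ∈ R :=
    ae_all_iff.2 fun a => ae_all_iff.2 fun r => key a r
  filter_upwards [key'] with ω hω i j hi hij
  have := hω (pre ω i) (ω i) hi (by rw [← pre_succ]; exact mem_cyl_pre _ _) (j - i)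
  rw [pre_length, shift, show i + (j - i) = j by omega] at this
  exact this

lemma mix_le (a0 : List S) {ρ ν : Measure (ℕ → S)} (h : ρ ≤ ν) : mixm a0 ρ ≤ mixm a0 ν := by
  refine Measure.le_iff.2 fun A hA => ?_
  rw [mix_apply _ _ hA, mix_apply _ _ hA]
  exact Finset.sum_le_sum fun a _ => h _

lemma caseB2_core {μ : Measure (ℕ → S)} (h : IsExtremePE μ) {o : S} (ho : ∀ᵐ ω ∂μ, ω 0 = o)
    {R : Set S} (hR : ∀ v ∈ R, ∀ᵐ ω ∂μ, ω ∈ Io v) (hR' : ∀ v, v ∉ R → ∀ᵐ ω ∂μ, ω ∉ Io v)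
    (hoR : o ∉ R) {r0 : S} (hr0 : r0 ∈ R) :
    ∃ (a0 : List S) (s1 : S) (ν : Measure (ℕ → S)), a0 ≠ [] ∧ (∀ x ∈ a0, x ∉ R) ∧
      μ = ((clF a0).card : ℝ≥0∞)⁻¹ • mixm a0 ν ∧ IsExtremePE ν ∧ RecAt s1 ν ∧ ∀ᵐ ω ∂ν, ∀ i, ω i ∈ R := by
  have hprob := h.prob
  have hev : ∀ p : S × S, ∃ k, p.1 ∉ R → ∀ᵐ ω ∂μ, ω ∈ Ev p k := by
    intro p
    by_cases hp : p.1 ∈ R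
    · exact ⟨0, fun h => absurd hp h⟩
    · obtain ⟨k, hk⟩ := ext_ev h (hR' p.1 hp) p.2
      exact ⟨k, fun _ => hk⟩
  choose M hM using hev
  have hM' : ∀ᵐ ω ∂μ, ∀ p : S × S, p.1 ∉ R → ω ∈ Ev p (M p) := by
    rw [ae_all_iff]; intro p
    by_cases hp : p.1 ∈ R
    · exact Eventually.of_forall fun _ h => absurd hp h
    · exact (hM p hp).mono fun _ h _ => h
  have hgood : ∀ᵐ ω ∂μ, Good R M o ω := by
    filter_upwards [ho, hM', hR r0 hr0, stay_in h.lpe hR hR'] with ω h1 h2 h3 h4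
    obtain ⟨m, _, hm⟩ := h3 0
    exact ⟨h1, h2, ⟨m, by rw [hm]; exact hr0⟩, h4⟩
  obtain ⟨x, hx⟩ := hgood.exists
  obtain ⟨k, hk0, hk, ht⟩ := hx.split hoR
  set a0 := pre x k with ha0
  have ha0ne : a0 ≠ [] := by
    intro hc
    have := congrArg List.length hc
    rw [ha0, pre_length, List.length_nil] at this
    omega
  have hae : ∀ᵐ ω ∂μ, ∃ a ∈ clF a0, ω ∈ cyl a ∧ shift a.length ω 0 = x k ∧ ∀ i, shift a.length ω i ∈ R := by
    filter_upwards [hgood] with ω hω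
    obtain ⟨k', hk0', hk', ht'⟩ := hω.split hoR
    obtain ⟨e1, e2⟩ := good_pair hω hx hk0' hk0 hk' hk ht' ht
    refine ⟨pre ω k', mem_clF.2 e2, mem_cyl_pre _ _, ?_, fun i => ?_⟩
    · rw [pre_length]; exact e1
    · rw [pre_length]; exact ht' _ (Nat.le_add_right _ _)
  have haft : ∀ᵐ ω ∂(aft μ a0), ω 0 = x k ∧ ∀ i, ω i ∈ R := by
    have hms : MeasurableSet {ω : ℕ → S | ω 0 = x k ∧ ∀ i, ω i ∈ R} := by
      rw [setOf_and, setOf_forall]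
      exact (measurableSet_coord 0 {x k}).inter (MeasurableSet.iInter fun i => measurableSet_coord i R)
    rw [aft, ae_map_iff (measurable_shift _).aemeasurable hms, ae_restrict_iff' (measurableSet_cyl _)]
    filter_upwards [hae] with ω hω hm
    obtain ⟨a, ha, h1, h2⟩ := hω
    have hlen : a.length = a0.length := ((mem_clF.1 ha).length_eq).symm
    rwa [← hlen]
  have hfin : IsFiniteMeasure (aft μ a0) := aft_finite μ a0
  have hmix : μ = mixm a0 (aft μ a0) := by
    refine mix_decomp (fun a ha => aft_class h.lpe ha0ne (mem_clF.1 ha)) ?_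
    rw [← mem_ae_iff]
    filter_upwards [hae] with ω hω
    obtain ⟨a, ha, h1, _⟩ := hω
    exact mem_iUnion₂.2 ⟨a, ha, h1⟩
  set c : ℝ≥0∞ := ((clF a0).card : ℝ≥0∞) with hc
  have hc0 : c ≠ 0 := clF_card_ne a0
  have hct : c ≠ ⊤ := ENNReal.natCast_ne_top _
  have hcc : c⁻¹ * c = 1 := ENNReal.inv_mul_cancel hc0 hct
  set ν := c • aft μ a0 with hν
  have hνae : ∀ᵐ ω ∂ν, ω 0 = x k ∧ ∀ i, ω i ∈ R := Measure.ae_smul_measure haft c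
  have hμν : μ = c⁻¹ • mixm a0 ν := by
    rw [hν, mix_smul, smul_smul, hcc, one_smul]; exact hmix
  have hν1 : ν univ = 1 := by
    have := congrArg (fun m => m univ) hmix
    simp only [mix_univ, measure_univ] at this
    rw [hν, Measure.smul_apply, smul_eq_mul]; exact this.symm
  have hνlpe : LPE ν := lpe_smul (aft_lpe h.lpe a0) c
  have hνprob : IsProbabilityMeasure ν := ⟨hν1⟩
  have hνext : IsExtremePE ν := by
    refine ext_of_le hν1 hνlpe fun ρ hρ hle => ?_
    have hρf : IsFiniteMeasure ρ := isFiniteMeasure_of_le ν hle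
    have hρR : ∀ᵐ ω ∂ρ, ∀ i, ω i ∉ Rᶜ := by
      have h1 : ρ ≪ ν := Measure.absolutelyContinuous_of_le hle
      have h9 : ∀ᵐ ω ∂ρ, ω 0 = x k ∧ ∀ i, ω i ∈ R := h1.ae_le hνae
      exact h9.mono fun ω hω i hi => hi (hω.2 i)
    have h2 : LPE (c⁻¹ • mixm a0 ρ) := lpe_smul (mix_lpe (F := Rᶜ) ha0ne hk hρ hρR) _
    have h3 : c⁻¹ • mixm a0 ρ ≤ μ := by
      rw [hμν]
      refine Measure.le_iff.2 fun A _ => ?_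
      rw [Measure.smul_apply, Measure.smul_apply, smul_eq_mul, smul_eq_mul]
      gcongr
      exact mix_le a0 hle
    have h4 := ext_le h h2 h3
    have h5 : (c⁻¹ • mixm a0 ρ) univ = ρ univ := by
      rw [Measure.smul_apply, mix_univ, smul_eq_mul, ← mul_assoc, hcc, one_mul]
    rw [h5] at h4
    have h6 : mixm a0 ρ = mixm a0 (ρ univ • ν) := by
      have h7 : c • (c⁻¹ • mixm a0 ρ) = c • (ρ univ • μ) := by rw [h4]
      rw [smul_smul, mul_comm, hcc, one_smul] at h7
      rw [h7, mix_smul]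
      nth_rewrite 1 [hμν]
      rw [smul_smul, smul_smul]
      congr 1
      rw [mul_comm c, mul_assoc, mul_comm c, hcc, mul_one]
    have hfin2 : IsFiniteMeasure (ρ univ • ν) := Measure.smul_finite ν (measure_ne_top ρ _)
    calc ρ = aft (mixm a0 ρ) a0 := (mix_aft a0 ρ (LEqv.refl a0)).symm
      _ = aft (mixm a0 (ρ univ • ν)) a0 := by rw [← h6]
      _ = ρ univ • ν := mix_aft a0 _ (LEqv.refl a0)
  refine ⟨a0, x k, ν, ha0ne, hk, hμν, hνext, ?_, hνae.mono fun _ h => h.2⟩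
  have hio : ∀ᵐ ω ∂(aft μ a0), ω ∈ Io (x k) := by
    rw [aft, ae_map_iff (p := fun ω => ω ∈ Io (x k)) (measurable_shift _).aemeasurable (measurableSet_io (x k)), ae_restrict_iff' (measurableSet_cyl _)]
    filter_upwards [hR (x k) (ht k le_rfl)] with ω hω _
    exact (io_shift _ _ ω).2 hω
  filter_upwards [hνae, Measure.ae_smul_measure hio c] with ω h1 h2 using ⟨h1.1, h2⟩

end p9e

end PartP9e

section PartP9f

section seqgraph
variable {V : Type}

def seqG (f : ℕ → V) (N : ℕ) : DigraphStruct V (Fin N) := ⟨fun i => f i, fun i => f (i + 1)⟩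

lemma seqG_path (f : ℕ → V) (N : ℕ) : ∀ (d k : ℕ) (h : k + d = N),
    IsPathList (seqG f N) (f k) (f N) (List.ofFn (fun j : Fin d => (⟨k + j, by omega⟩ : Fin N)))
  | 0, k, h => by
    have : k = N := by omega
    subst this
    simp [IsPathList]
  | d + 1, k, h => by
    rw [List.ofFn_succ]
    refine ⟨rfl, ?_⟩
    have := seqG_path f N d (k + 1) (by omega)
    convert this using 3
    · rfl
    · apply Fin.ext
      simp
      omega

lemma seqG_euler (f : ℕ → V) (N : ℕ) : IsEulerList (seqG f N) (f 0) (f N) (List.finRange N) := by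
  refine ⟨?_, List.nodup_finRange N, List.mem_finRange⟩
  have := seqG_path f N N 0 (by omega)
  convert this using 1
  rw [← List.ofFn_id]
  congr 1
  funext j
  apply Fin.ext
  simp

lemma seqG_deg [DecidableEq V] (f : ℕ → V) (N : ℕ) (v : V) :
    (seqG f N).outDeg v + (if f N = v then 1 else 0) = (seqG f N).inDeg v + (if f 0 = v then 1 else 0) := by
  have key : ∀ g : ℕ → V, {i : Fin N | g i = v}.ncard = ∑ i ∈ Finset.range N, if g i = v then 1 else 0 := by
    intro g
    rw [← Fin.sum_univ_eq_sum_range (fun i => if g i = v then 1 else 0), ← Finset.card_filter, ← Set.ncard_coe_finset]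
    congr 1
    ext i; simp
  have h1 : (seqG f N).outDeg v = ∑ i ∈ Finset.range N, if f i = v then 1 else 0 := key f
  have h2 : (seqG f N).inDeg v = ∑ i ∈ Finset.range N, if f (i + 1) = v then 1 else 0 := key (fun i => f (i + 1))
  rw [h1, h2, ← Finset.sum_range_succ (fun i => if f i = v then 1 else 0),
    ← Finset.sum_range_succ' (fun i => if f i = v then 1 else 0)]

lemma seqG_fin (f : ℕ → V) (N : ℕ) (hf : ∀ v, ∃ i, i ≤ N ∧ f i = v) :
    IsFinEulerian (seqG f N) (f 0) (f N) := by
  classical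
  have hadj : ∀ i, i < N → (seqG f N).dirAdj (f i) (f (i + 1)) := fun i hi => ⟨⟨i, hi⟩, rfl, rfl⟩
  refine ⟨?_, inferInstance, ?_, ?_, ?_, ?_⟩
  · refine Finite.of_surjective (fun i : Fin (N + 1) => f i) fun v => ?_
    obtain ⟨i, hi, rfl⟩ := hf v
    exact ⟨⟨i, by omega⟩, rfl⟩
  · intro v
    obtain ⟨i, hi, rfl⟩ := hf v
    induction i with
    | zero => exact .refl
    | succ i ih => exact (ih (by omega)).tail (hadj i (by omega))
  · intro v
    obtain ⟨i, hi, rfl⟩ := hf v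
    obtain ⟨d, hd⟩ := Nat.exists_eq_add_of_le hi
    induction d generalizing i with
    | zero => rw [show i = N by omega]
    | succ d ih => exact Relation.ReflTransGen.head (hadj i (by omega)) (ih (i + 1) (by omega) (by omega))
  · intro hne
    refine ⟨fun v h1 h2 => ?_, ?_, ?_⟩
    · have := seqG_deg f N v
      rw [if_neg (Ne.symm h1), if_neg (Ne.symm h2)] at this
      omega
    · have := seqG_deg f N (f 0)
      rw [if_pos rfl, if_neg (Ne.symm hne)] at this
      omega
    · have := seqG_deg f N (f N)
      rw [if_pos rfl, if_neg hne] at this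
      omega
  · intro he v
    have := seqG_deg f N v
    rw [he] at this
    omega

end seqgraph

section p9f
variable [MeasurableSpace S] [DiscreteMeasurableSpace S] [Countable S]

lemma ext_caseB2 {μ : Measure (ℕ → S)} (h : IsExtremePE μ) {o : S} (ho : ∀ᵐ ω ∂μ, ω 0 = o)
    {R : Set S} (hR : ∀ v ∈ R, ∀ᵐ ω ∂μ, ω ∈ Io v) (hR' : ∀ v, v ∉ R → ∀ᵐ ω ∂μ, ω ∉ Io v)
    (hoR : o ∉ R) {r0 : S} (hr0 : r0 ∈ R) : IsMixedLaw μ := by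
  classical
  obtain ⟨a0, s1, ν, hne, haR, hμ, hext, hrec, hνR⟩ := caseB2_core h ho hR hR' hoR hr0
  have hνp := hext.prob
  obtain ⟨S', p, hMC, hS'⟩ := ext_rec hext hrec
  obtain ⟨N, hN⟩ : ∃ N, a0.length = N + 1 := by
    cases a0 with
    | nil => exact absurd rfl hne
    | cons x l => exact ⟨l.length, rfl⟩
  have hlt : ∀ i, min i N < a0.length := fun i => by omega
  let f : ℕ → {s : S // s ∈ a0.toFinset} := fun i => ⟨a0[min i N]'(hlt i), by simp⟩
  have hf : ∀ v, ∃ i, i ≤ N ∧ f i = v := by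
    rintro ⟨v, hv⟩
    rw [List.mem_toFinset] at hv
    obtain ⟨i, hi, rfl⟩ := List.getElem_of_mem hv
    refine ⟨i, by omega, Subtype.ext ?_⟩
    simp only [f, show min i N = i by omega]
  have ha0 : ((f 0 : S) :: (List.finRange N).map (fun e => (((seqG f N).dst e : {s : S // s ∈ a0.toFinset}) : S))) = a0 := by
    refine List.ext_getElem (by simp [hN]) fun i h1 h2 => ?_
    cases i with
    | zero => simp [f]
    | succ i =>
      simp only [List.length_cons, List.length_map, List.length_finRange] at h1
      simp [f, seqG, show min (i + 1) N = i + 1 by omega]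
  refine ⟨a0.toFinset, Fin N, inferInstance, seqG f N, f 0, f N, S', p, s1, ν, seqG_fin f N hf, ?_, hMC,
    hrec.infinite, fun A hA => ?_⟩
  · rw [Set.disjoint_left]
    intro u hu hu'
    rw [Finset.mem_coe, List.mem_toFinset] at hu
    obtain ⟨w, hw⟩ := hS' u hu'
    apply hw
    refine measure_mono_null (t := {ω | ∀ i, ω i ∈ R}ᶜ) ?_ hνR
    intro ω hω hc
    rw [mem_cyl_append, mem_cyl_single] at hω
    have := hc w.length
    rw [show ω w.length = u from hω.2] at this
    exact haR u hu this
  · rw [mixed_eq (ι := Subtype.val) Subtype.val_injective (seqG_euler f N) ν hA]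
    rw [ha0, ← hμ]

theorem ext_cases {μ : Measure (ℕ → S)} (h : IsExtremePE μ) :
    IsRecMCLaw μ ∨ IsGibbsVertexLaw μ ∨ IsMixedLaw μ := by
  obtain ⟨o, ho⟩ := ext_start h
  let R : Set S := {v | ∀ᵐ ω ∂μ, ω ∈ Io v}
  have hR' : ∀ v, v ∉ R → ∀ᵐ ω ∂μ, ω ∉ Io v := fun v hv => (ext_io h v).resolve_right hv
  by_cases hoR : o ∈ R
  · exact Or.inl (ext_caseA h ho hoR)
  · by_cases hne : ∃ r, r ∈ R
    · obtain ⟨r, hr⟩ := hne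
      exact Or.inr (Or.inr (ext_caseB2 h ho (R := R) (fun _ hv => hv) hR' hoR hr))
    · exact Or.inr (Or.inl (ext_caseB1 h ho fun v => hR' v fun hv => hne ⟨v, hv⟩))

end p9f

end PartP9f

/-- The extreme points of the set of partially exchangeable probability
measures on `S^ℕ` are exactly: laws of recurrent Markov chains with non-random initial state on
subsets of `S`; vertex-sequence laws of proper Gibbs measures on Eulerian paths on sourced
Eulerian digraphs on subsets of `S`; and laws of a uniform Eulerian path on a finite Eulerian
digraph on a subset of `S` followed by a recurrent Markov chain on a disjoint subset of `S`. -/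
theorem stmt6 {S : Type} [Countable S] [Nonempty S] [MeasurableSpace S]
    [DiscreteMeasurableSpace S] (μ : Measure (ℕ → S)) :
    IsExtremePE μ ↔ (IsRecMCLaw μ ∨ IsGibbsVertexLaw μ ∨ IsMixedLaw μ) := by
  exact ⟨ext_cases, fun h => by
    rcases h with h | h | h
    exacts [recMC_extreme h, gibbs_extreme h, mixed_extreme h]⟩

end DF
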